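/- Let X be a Polish space, p ≥ 1, μ ∈ P(X), ν ∈ P_p(ℝ^d), and let C : X × P_p(ℝ^d) → [0,∞] be lower semicontinuous, convex in its second argument, and decreasing in the convex order in its second argument. Assume condition (B): C(x,ρ) ≤ a(x) + ∫ b dρ for some μ-integrable a : X → ℝ and ν-integrable b : ℝ^d → ℝ; and condition (C): for every increasing sequence (Y_k) of Borel sets with ⋃_k Y_k = ℝ^d, C(x,ρ) ≥ limsup_k C(x, ρ(· ∩ Y_k)/ρ(Y_k)). Then inf_{π ∈ Π(μ,ν)} ∫_X C(x, π_x) dμ(x) = sup { ∫_X ψ^C dμ − ∫ ψ dν : (ψ^C, ψ) ∈ Φ_C(μ,ν), ψ convex }, and this supremum is attained by some ν-integrable convex function ψ : ℝ^d → (−∞,∞]. -/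

import Mathlib

open MeasureTheory Set Filter Topology
open scoped ENNReal

noncomputable section

/-- `ℝ^d`, modelled as Euclidean space. -/
abbrev Rd (d : ℕ) : Type := EuclideanSpace ℝ (Fin d)

/-- A Borel measure on `ℝ^d` has finite `p`-th moment. -/
def HasMomentP (p : ℝ) {d : ℕ} (ρ : Measure (Rd d)) : Prop :=
  ∫⁻ y, ENNReal.ofReal (‖y‖ ^ p) ∂ρ ≠ ⊤

/-- `P_p(ℝ^d)`: Borel probability measures on `ℝ^d` with finite `p`-th moment. -/
abbrev Pp (p : ℝ) (d : ℕ) : Type :=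
  {ρ : Measure (Rd d) // IsProbabilityMeasure ρ ∧ HasMomentP p ρ}

/-- Continuous test functions of growth of order at most `p`. -/
def GrowthP (p : ℝ) {d : ℕ} (f : Rd d → ℝ) : Prop :=
  Continuous f ∧ ∃ K : ℝ, ∀ y, |f y| ≤ K * (1 + ‖y‖ ^ p)

/-- The `p`-weak topology on `P_p(ℝ^d)`: the initial topology induced by integration
against continuous functions of growth of order at most `p`. -/
instance PpTopology (p : ℝ) (d : ℕ) : TopologicalSpace (Pp p d) :=
  ⨅ f : {f : Rd d → ℝ // GrowthP p f},
    TopologicalSpace.induced (fun ρ : Pp p d => ∫ y, f.1 y ∂ρ.1) inferInstance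

instance PpMeasurableSpace (p : ℝ) (d : ℕ) : MeasurableSpace (Pp p d) := borel _

/-- `C_{b,p}(ℝ^d)`: continuous functions bounded from below by a constant and bounded
above by `K (1 + |y - y₀|^p)` for some `K > 0`, `y₀`. -/
def Cbp (p : ℝ) {d : ℕ} (ψ : Rd d → ℝ) : Prop :=
  Continuous ψ ∧ (∃ c : ℝ, ∀ y, c ≤ ψ y) ∧
    ∃ K : ℝ, 0 < K ∧ ∃ y₀ : Rd d, ∀ y, ψ y ≤ K * (1 + ‖y - y₀‖ ^ p)

open scoped Classical in
/-- The nonnegative part of an extended real, as an extended nonnegative real. -/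
def erealToENN (x : EReal) : ℝ≥0∞ := if x = ⊤ then ⊤ else ENNReal.ofReal x.toReal

/-- Canonical extended integral of an `EReal`-valued function: the lower integral of the
positive part minus the lower integral of the negative part. -/
def eInt {α : Type*} [MeasurableSpace α] (μ : Measure α) (f : α → EReal) : EReal :=
  ((∫⁻ x, erealToENN (f x) ∂μ : ℝ≥0∞) : EReal) -
    ((∫⁻ x, erealToENN (-(f x)) ∂μ : ℝ≥0∞) : EReal)

/-- The convex order on measures on `ℝ^d`: `ρ₁ ≼_c ρ₂` iff `∫ f dρ₁ ≤ ∫ f dρ₂` for every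
convex function `f : ℝ^d → ℝ` (integrals taken in the extended sense). -/
def ConvexOrder {d : ℕ} (ρ₁ ρ₂ : Measure (Rd d)) : Prop :=
  ∀ f : Rd d → ℝ, ConvexOn ℝ univ f →
    eInt ρ₁ (fun y => (f y : EReal)) ≤ eInt ρ₂ (fun y => (f y : EReal))

/-- Coordinatewise increasing functions on `ℝ^d`. -/
def CoordMono {d : ℕ} (f : Rd d → ℝ) : Prop :=
  ∀ y z : Rd d, (∀ i, y i ≤ z i) → f y ≤ f z

/-- The increasing convex order on measures on `ℝ^d`. -/
def IcxOrder {d : ℕ} (ρ₁ ρ₂ : Measure (Rd d)) : Prop :=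
  ∀ f : Rd d → ℝ, ConvexOn ℝ univ f → CoordMono f →
    eInt ρ₁ (fun y => (f y : EReal)) ≤ eInt ρ₂ (fun y => (f y : EReal))

/-- `π` is a coupling of `μ` and `ν`. -/
def IsCoupling {X Y : Type*} [MeasurableSpace X] [MeasurableSpace Y]
    (π : Measure (X × Y)) (μ : Measure X) (ν : Measure Y) : Prop :=
  IsProbabilityMeasure π ∧ π.map Prod.fst = μ ∧ π.map Prod.snd = ν

open scoped Classical in
/-- Disintegration of a measure on a product space with respect to its first marginal. -/
def disint {X : Type*} [MeasurableSpace X] {Y : Type*} [MeasurableSpace Y]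
    [StandardBorelSpace Y] [Nonempty Y] (π : Measure (X × Y)) :
    ProbabilityTheory.Kernel X Y :=
  if h : IsFiniteMeasure π then (haveI := h; π.condKernel) else 0

/-- The primal weak optimal transport value `inf_{π ∈ Π(μ,ν)} ∫ C(x, π_x) dμ(x)`. -/
def primal {X : Type*} [MeasurableSpace X] {d : ℕ}
    (μ : Measure X) (ν : Measure (Rd d)) (C : X → Measure (Rd d) → ℝ≥0∞) : ℝ≥0∞ :=
  ⨅ π : {π : Measure (X × Rd d) // IsCoupling π μ ν}, ∫⁻ x, C x (disint π.1 x) ∂μ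

/-- The `C`-conjugate `ψ^C (x) = inf_{ρ ∈ P_p} ρ(ψ) + C(x, ρ)`. -/
def conj (p : ℝ) {X : Type*} [MeasurableSpace X] {d : ℕ}
    (C : X → Measure (Rd d) → ℝ≥0∞) (ψ : Rd d → ℝ) (x : X) : EReal :=
  ⨅ ρ : Pp p d, ((∫ y, ψ y ∂ρ.1 : ℝ) : EReal) + ((C x ρ.1 : ℝ≥0∞) : EReal)

/-- The dual value `μ(ψ^C) - ν(ψ)`. -/
def dualVal (p : ℝ) {X : Type*} [MeasurableSpace X] {d : ℕ}
    (μ : Measure X) (ν : Measure (Rd d)) (C : X → Measure (Rd d) → ℝ≥0∞)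
    (ψ : Rd d → ℝ) : EReal :=
  eInt μ (conj p C ψ) - ((∫ y, ψ y ∂ν : ℝ) : EReal)

end

noncomputable section

/-- `ψ ∈ L¹(ρ)`: a `(-∞,∞]`-valued Borel function that is `ρ`-integrable. -/
def MemL1 {α : Type*} [MeasurableSpace α] (ρ : Measure α) (ψ : α → EReal) : Prop :=
  Measurable ψ ∧ (∀ y, ψ y ≠ ⊥) ∧
    (∫⁻ y, erealToENN (ψ y) + erealToENN (-(ψ y)) ∂ρ) ≠ ⊤

/-- The `C`-conjugate for possibly non-regular potentials:
`ψ^C(x) = inf { ρ(ψ) + C(x,ρ) : ρ ∈ P_p(ℝ^d), ψ ∈ L¹(ρ) }`, with `inf ∅ = ⊤`. -/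
def conjL1 (p : ℝ) {X : Type*} [MeasurableSpace X] {d : ℕ}
    (C : X → Measure (Rd d) → ℝ≥0∞) (ψ : Rd d → EReal) (x : X) : EReal :=
  ⨅ ρ : {ρ : Pp p d // MemL1 ρ.1 ψ}, eInt ρ.1.1 ψ + ((C x ρ.1.1 : ℝ≥0∞) : EReal)

/-- The set `Φ_C(μ,ν)` of admissible dual pairs. -/
def InPhi (p : ℝ) {X : Type*} [MeasurableSpace X] {d : ℕ}
    (μ : Measure X) (ν : Measure (Rd d)) (C : X → Measure (Rd d) → ℝ≥0∞)
    (φ : X → EReal) (ψ : Rd d → EReal) : Prop :=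
  MemL1 μ (fun x => -φ x) ∧ MemL1 ν ψ ∧
    ∀ x : X, ∀ ρ : Pp p d, MemL1 ρ.1 ψ →
      φ x - eInt ρ.1 ψ ≤ ((C x ρ.1 : ℝ≥0∞) : EReal)

/-- Convexity for `(-∞,∞]`-valued functions on `ℝ^d`. -/
def EConvex {d : ℕ} (ψ : Rd d → EReal) : Prop :=
  ∀ y z : Rd d, ∀ t : ℝ, 0 ≤ t → t ≤ 1 →
    ψ (t • y + (1 - t) • z) ≤ (t : EReal) * ψ y + ((1 - t : ℝ) : EReal) * ψ z

/-- Coordinatewise monotonicity for `(-∞,∞]`-valued functions on `ℝ^d`. -/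
def ECoordMono {d : ℕ} (ψ : Rd d → EReal) : Prop :=
  ∀ y z : Rd d, (∀ i, y i ≤ z i) → ψ y ≤ ψ z

/-- Condition (B): the cost is bounded above by `a(x) + ρ(b)` with `a ∈ L¹(μ)`, `b ∈ L¹(ν)`. -/
def CondB (p : ℝ) {X : Type*} [MeasurableSpace X] {d : ℕ}
    (μ : Measure X) (ν : Measure (Rd d)) (C : X → Measure (Rd d) → ℝ≥0∞) : Prop :=
  ∃ a : X → ℝ, Integrable a μ ∧ ∃ b : Rd d → ℝ, Integrable b ν ∧
    ∀ x : X, ∀ ρ : Pp p d,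
      ((C x ρ.1 : ℝ≥0∞) : EReal) ≤ (a x : EReal) + eInt ρ.1 (fun y => (b y : EReal))

/-- Condition (C): upper semicontinuity of the cost along restrictions to an exhausting
increasing sequence of Borel sets. -/
def CondC (p : ℝ) {X : Type*} [MeasurableSpace X] {d : ℕ}
    (C : X → Measure (Rd d) → ℝ≥0∞) : Prop :=
  ∀ x : X, ∀ ρ : Pp p d, ∀ Y : ℕ → Set (Rd d),
    (∀ k, MeasurableSet (Y k)) → Monotone Y → (⋃ k, Y k) = Set.univ →
    Filter.limsup (fun k => C x ((ρ.1 (Y k))⁻¹ • ρ.1.restrict (Y k))) Filter.atTop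
      ≤ C x ρ.1

end

theorem ConvexOn.eventually_lt_of_polyhedron {E ι : Type*} [NormedAddCommGroup E] [NormedSpace ℝ E]
    [Finite ι] {ℓ : ι → E →L[ℝ] ℝ} {c : ι → ℝ} {f : E → ℝ}
    (hf : ConvexOn ℝ {y | ∀ i, ℓ i y ≤ c i} f) {M : ℝ} (hM : ∀ y, (∀ i, ℓ i y ≤ c i) → f y ≤ M)
    {y : E} (hy : ∀ i, ℓ i y ≤ c i) {ε : ℝ} (hε : 0 < ε) :
    ∀ᶠ z in 𝓝[{y | ∀ i, ℓ i y ≤ c i}] y, f z < f y + ε := by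
  obtain ⟨s, hs0, hs1, hs⟩ : ∃ s : ℝ, 0 < s ∧ s < 1 ∧ s * (M - f y) < ε := by
    have h0 : 0 ≤ M - f y := sub_nonneg.2 (hM y hy)
    refine ⟨ε / (ε + (M - f y) + 1), by positivity, ?_, ?_⟩
    · rw [div_lt_one (by positivity)]; linarith
    · rw [div_mul_eq_mul_div, div_lt_iff₀ (by positivity)]; nlinarith
  have key : ∀ᶠ z in 𝓝[{y | ∀ i, ℓ i y ≤ c i}] y, ∀ i, ℓ i (y + s⁻¹ • (z - y)) ≤ c i := by
    rw [eventually_all]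
    intro i
    rcases (hy i).eq_or_lt with h | h
    · filter_upwards [self_mem_nhdsWithin] with z hz
      have h1 : ℓ i z - c i ≤ 0 := sub_nonpos.2 (hz i)
      have h2 : s⁻¹ * (ℓ i z - c i) ≤ 0 := mul_nonpos_of_nonneg_of_nonpos (by positivity) h1
      simp only [map_add, map_smul, map_sub, smul_eq_mul, h]
      linarith
    · have hc : Continuous fun z => ℓ i (y + s⁻¹ • (z - y)) := by fun_prop
      have := hc.continuousAt (x := y) |>.eventually_lt_const (u := c i) (by simpa using h)
      filter_upwards [mem_nhdsWithin_of_mem_nhds this] with z hz using le_of_lt hz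
  filter_upwards [key] with z hz
  have h1 := hf.2 (show y ∈ {y | ∀ i, ℓ i y ≤ c i} from hy)
    (show y + s⁻¹ • (z - y) ∈ {y | ∀ i, ℓ i y ≤ c i} from hz)
    (show (0:ℝ) ≤ 1 - s by linarith) hs0.le (by ring)
  have h2 : (1 - s) • y + s • (y + s⁻¹ • (z - y)) = z := by
    rw [smul_add, smul_smul, mul_inv_cancel₀ hs0.ne']; module
  rw [h2] at h1
  have h3 := hM _ hz
  simp only [smul_eq_mul] at h1
  nlinarith

theorem stdSimplex_eq_polyhedron (ι : Type*) [Fintype ι] :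
    ∃ (ℓ : Option (Option ι) → (ι → ℝ) →L[ℝ] ℝ) (c : Option (Option ι) → ℝ),
      stdSimplex ℝ ι = {w | ∀ i, ℓ i w ≤ c i} := by
  refine ⟨fun i => match i with
    | none => ∑ j, ContinuousLinearMap.proj j
    | some none => -∑ j, ContinuousLinearMap.proj j
    | some (some j) => -ContinuousLinearMap.proj j,
    fun i => match i with
    | none => 1
    | some none => -1
    | some (some j) => 0, ?_⟩
  ext w
  simp only [stdSimplex, mem_ofPred_eq, Option.forall]
  constructor
  · rintro ⟨h1, h2⟩
    simp [h2, h1]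
  · rintro ⟨h1, h2, h3⟩
    simp at h1 h2 h3
    exact ⟨h3, le_antisymm h1 h2⟩

theorem ConvexOn.eventually_lt_stdSimplex {ι : Type*} [Fintype ι] {f : (ι → ℝ) → ℝ}
    (hf : ConvexOn ℝ (stdSimplex ℝ ι) f) {M : ℝ} (hM : ∀ w ∈ stdSimplex ℝ ι, f w ≤ M)
    {w : ι → ℝ} (hw : w ∈ stdSimplex ℝ ι) {ε : ℝ} (hε : 0 < ε) :
    ∀ᶠ z in 𝓝[stdSimplex ℝ ι] w, f z < f w + ε := by
  obtain ⟨ℓ, c, h⟩ := stdSimplex_eq_polyhedron ι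
  rw [h] at hf hM hw ⊢
  exact hf.eventually_lt_of_polyhedron hM hw hε

theorem measurable_iInf_compact {X K : Type*} [TopologicalSpace X] [MeasurableSpace X]
    [BorelSpace X] [TopologicalSpace K] [CompactSpace K] {g : X × K → ℝ≥0∞}
    (hg : LowerSemicontinuous g) : Measurable fun x => ⨅ k, g (x, k) := by
  refine measurable_of_Iio fun c => ?_
  have : (fun x => ⨅ k, g (x, k)) ⁻¹' Iio c
      = ⋃ q ∈ {q : ℚ | ENNReal.ofReal q < c}, Prod.fst '' (g ⁻¹' Iic (ENNReal.ofReal q)) := by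
    ext x
    simp only [mem_preimage, mem_Iio, iInf_lt_iff, mem_ofPred_eq, mem_iUnion, mem_image, mem_Iic,
      Prod.exists, exists_and_right, exists_eq_right, exists_prop]
    constructor
    · rintro ⟨k, hk⟩
      obtain ⟨q, hq0, h1, h2⟩ := ENNReal.lt_iff_exists_rat_btwn.1 hk
      exact ⟨q, h2, k, h1.le⟩
    · rintro ⟨q, hq, k, hk⟩
      exact ⟨k, hk.trans_lt hq⟩
  rw [this]
  refine MeasurableSet.biUnion (to_countable _) fun q _ => ?_
  exact (isClosedMap_fst_of_compactSpace _ (hg.isClosed_preimage _)).measurableSet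

/-- The convex hull of a compact set in a finite-dimensional space is compact. -/
theorem IsCompact.convexHull_finrank {E : Type*} [NormedAddCommGroup E] [NormedSpace ℝ E]
    [FiniteDimensional ℝ E] {s : Set E} (hs : IsCompact s) : IsCompact (convexHull ℝ s) := by
  rcases s.eq_empty_or_nonempty with rfl | ⟨x0, hx0⟩
  · simp
  let n := Module.finrank ℝ E + 1
  have hK : IsCompact (stdSimplex ℝ (Fin n) ×ˢ (Set.univ.pi fun _ : Fin n => s)) :=
    (isCompact_stdSimplex ℝ _).prod (isCompact_univ_pi fun _ => hs)
  have hc : Continuous fun q : (Fin n → ℝ) × (Fin n → E) => ∑ i, q.1 i • q.2 i := by fun_prop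
  convert hK.image hc
  ext x
  constructor
  · intro hx
    obtain ⟨ι, hι, z, w, hz, hind, hw, hw1, hx⟩ := eq_pos_convex_span_of_mem_convexHull hx
    have hcard : Fintype.card ι ≤ Fintype.card (Fin n) := by
      have := hind.card_le_finrank_succ
      simp only [n, Fintype.card_fin]
      exact this.trans (by gcongr; exact Submodule.finrank_le _)
    obtain ⟨e⟩ := Function.Embedding.nonempty_of_card_le hcard
    classical
    refine ⟨⟨Function.extend e w 0, Function.extend e z fun _ => x0⟩, ⟨⟨fun i => ?_, ?_⟩, ?_⟩, ?_⟩
    · by_cases h : ∃ j, e j = i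
      · obtain ⟨j, rfl⟩ := h
        simp [e.injective.extend_apply, (hw j).le]
      · simp [Function.extend_apply' _ _ _ h]
    · rw [← hw1]
      symm
      refine Finset.sum_of_injOn e e.injective.injOn (by simp) ?_ ?_
      · intro i _ hi
        exact Function.extend_apply' _ _ _ (by simpa using hi)
      · intro i _; simp [e.injective.extend_apply]
    · intro i _
      by_cases h : ∃ j, e j = i
      · obtain ⟨j, rfl⟩ := h
        simp only [e.injective.extend_apply]
        exact hz ⟨j, rfl⟩
      · simpa only [Function.extend_apply' _ _ _ h] using hx0
    · rw [← hx]
      symm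
      refine Finset.sum_of_injOn e e.injective.injOn (by simp) ?_ ?_
      · intro i _ hi
        simp only [smul_eq_zero]
        left; simpa using Function.extend_apply' w (0 : Fin n → ℝ) i (by simpa using hi)
      · intro i _; simp [e.injective.extend_apply]
  · rintro ⟨⟨w, z⟩, ⟨⟨h0, h1⟩, h2⟩, rfl⟩
    exact (convex_convexHull ℝ s).sum_mem (fun i _ => h0 i) h1
      fun i _ => subset_convexHull ℝ s (h2 i (mem_univ i))

/-- Approximate minimization of a family of convex functions over the standard simplex. -/
theorem exists_measurable_minimum_stdSimplex {X ι : Type*} [MeasurableSpace X] [Fintype ι]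
    [Nonempty ι] {μ : Measure X} [IsProbabilityMeasure μ] {g : X → (ι → ℝ) → ℝ} {A : X → ℝ}
    (hmeas : ∀ w, w ∈ stdSimplex ℝ ι → Measurable fun x => g x w)
    (hcv : ∀ x, ConvexOn ℝ (stdSimplex ℝ ι) (g x))
    (hA : Integrable A μ) (hgA : ∀ x, ∀ w ∈ stdSimplex ℝ ι, |g x w| ≤ A x) :
    ∃ φ : X → ℝ, Measurable φ ∧ Integrable φ μ ∧ (∀ x, ∀ w ∈ stdSimplex ℝ ι, φ x ≤ g x w) ∧
      ∀ ε > 0, ∃ w : X → ι → ℝ, Measurable w ∧ (∀ x, w x ∈ stdSimplex ℝ ι) ∧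
        ∀ x, g x (w x) ≤ φ x + ε := by
  classical
  have : Nonempty (stdSimplex ℝ ι) :=
    ⟨⟨_, single_mem_stdSimplex ℝ (Classical.arbitrary ι)⟩⟩
  let D := TopologicalSpace.denseSeq (stdSimplex ℝ ι)
  have hbd : ∀ x, BddBelow (range fun N => g x (D N)) := fun x =>
    ⟨-A x, by rintro _ ⟨N, rfl⟩; exact (abs_le.1 (hgA x _ (D N).2)).1⟩
  have hφm : Measurable fun x => ⨅ N, g x (D N) := Measurable.iInf fun N => hmeas _ (D N).2
  refine ⟨fun x => ⨅ N, g x (D N), hφm, ?_, ?_, ?_⟩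
  · refine hA.mono' hφm.aestronglyMeasurable (ae_of_all _ fun x => ?_)
    rw [Real.norm_eq_abs, abs_le]
    exact ⟨le_ciInf fun N => (abs_le.1 (hgA x _ (D N).2)).1,
      (ciInf_le (hbd x) 0).trans (abs_le.1 (hgA x _ (D 0).2)).2⟩
  · intro x w hw
    refine le_of_forall_pos_lt_add fun ε hε => ?_
    have h1 := (hcv x).eventually_lt_stdSimplex (fun w hw => (abs_le.1 (hgA x w hw)).2) hw hε
    rw [nhdsWithin_eq_map_subtype_coe hw, eventually_map] at h1
    obtain ⟨N, hN⟩ := (TopologicalSpace.denseRange_denseSeq (stdSimplex ℝ ι)).exists_mem_open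
      isOpen_interior ⟨⟨w, hw⟩, mem_interior_iff_mem_nhds.2 h1⟩
    have h2 := interior_subset hN
    simp only [mem_ofPred_eq] at h2
    exact (ciInf_le (hbd x) N).trans_lt h2
  · intro ε hε
    have hex : ∀ x, ∃ N, g x (D N) < (⨅ N, g x (D N)) + ε := fun x =>
      exists_lt_of_ciInf_lt (by linarith)
    have hfm : Measurable fun x => Nat.find (hex x) := measurable_find _ fun N =>
      measurableSet_lt (hmeas _ (D N).2) (hφm.add_const _)
    exact ⟨fun x => (D (Nat.find (hex x)) : ι → ℝ),
      (measurable_from_nat (f := fun n => (D n : ι → ℝ))).comp hfm, fun x => (D _).2,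
      fun x => (Nat.find_spec (hex x)).le⟩

/-- Linear duality for a convex cost on a finite simplex. -/
theorem exists_dual_stdSimplex {X ι : Type*} [MeasurableSpace X] [Fintype ι] [Nonempty ι]
    {μ : Measure X} [IsProbabilityMeasure μ] {c : X → (ι → ℝ) → ℝ} {A : X → ℝ}
    (hmeas : ∀ w : X → ι → ℝ, Measurable w → (∀ x, w x ∈ stdSimplex ℝ ι) →
      Measurable fun x => c x (w x))
    (hcv : ∀ x, ConvexOn ℝ (stdSimplex ℝ ι) (c x)) (hA : Integrable A μ)
    (h0 : ∀ x, ∀ w ∈ stdSimplex ℝ ι, 0 ≤ c x w) (hcA : ∀ x, ∀ w ∈ stdSimplex ℝ ι, c x w ≤ A x)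
    {η : ι → ℝ} (hη : η ∈ stdSimplex ℝ ι) (hpos : ∀ i, 0 < η i) {V : ℝ}
    (hV : ∀ w : X → ι → ℝ, Measurable w → (∀ x, w x ∈ stdSimplex ℝ ι) →
      ∫ x, w x ∂μ = η → V ≤ ∫ x, c x (w x) ∂μ) {ε : ℝ} (hε : 0 < ε) :
    ∃ (ψ : ι → ℝ) (φ : X → ℝ), Measurable φ ∧ Integrable φ μ ∧
      (∀ x, ∀ w ∈ stdSimplex ℝ ι, φ x ≤ c x w + ∑ i, ψ i * w i) ∧
      V + ∑ i, ψ i * η i ≤ ∫ x, φ x ∂μ + ε := by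
  classical
  let S : Set (X → ι → ℝ) := {w | Measurable w ∧ ∀ x, w x ∈ stdSimplex ℝ ι}
  have hwint : ∀ w ∈ S, Integrable w μ := fun w hw => by
    refine Integrable.of_bound hw.1.aestronglyMeasurable 1 (ae_of_all _ fun x => ?_)
    rw [pi_norm_le_iff_of_nonneg zero_le_one]
    intro i
    rw [Real.norm_eq_abs, abs_of_nonneg ((hw.2 x).1 i)]
    exact (mem_Icc_of_mem_stdSimplex (hw.2 x) i).2
  have hcint : ∀ w ∈ S, Integrable (fun x => c x (w x)) μ := fun w hw => by
    refine hA.mono' (hmeas w hw.1 hw.2).aestronglyMeasurable (ae_of_all _ fun x => ?_)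
    rw [Real.norm_eq_abs, abs_of_nonneg (h0 x _ (hw.2 x))]
    exact hcA x _ (hw.2 x)
  have hηS : (fun _ => η) ∈ S := ⟨measurable_const, fun _ => hη⟩
  have hbar : ∀ w ∈ S, ∫ x, w x ∂μ ∈ stdSimplex ℝ ι := fun w hw =>
    (convex_stdSimplex ℝ ι).integral_mem (isClosed_stdSimplex ℝ ι) (ae_of_all _ hw.2) (hwint w hw)
  have hconvS : ∀ w ∈ S, ∀ w' ∈ S, ∀ s t : ℝ, 0 ≤ s → 0 ≤ t → s + t = 1 →
      s • w + t • w' ∈ S := fun w hw w' hw' s t hs ht hst =>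
    ⟨(hw.1.const_smul s).add (hw'.1.const_smul t), fun x =>
      convex_stdSimplex ℝ ι (hw.2 x) (hw'.2 x) hs ht hst⟩
  have hconvc : ∀ w ∈ S, ∀ w' ∈ S, ∀ s t : ℝ, 0 ≤ s → 0 ≤ t → s + t = 1 →
      ∫ x, c x ((s • w + t • w') x) ∂μ ≤ s * ∫ x, c x (w x) ∂μ + t * ∫ x, c x (w' x) ∂μ := by
    intro w hw w' hw' s t hs ht hst
    rw [← integral_const_mul, ← integral_const_mul, ← integral_add ((hcint w hw).const_mul s)
      ((hcint w' hw').const_mul t)]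
    refine integral_mono (hcint _ (hconvS w hw w' hw' s t hs ht hst))
      (((hcint w hw).const_mul s).add ((hcint w' hw').const_mul t)) fun x => ?_
    exact (hcv x).2 (hw.2 x) (hw'.2 x) hs ht hst
  have hbarlin : ∀ w ∈ S, ∀ w' ∈ S, ∀ s t : ℝ,
      ∫ x, (s • w + t • w') x ∂μ = s • ∫ x, w x ∂μ + t • ∫ x, w' x ∂μ := by
    intro w hw w' hw' s t
    rw [← integral_smul, ← integral_smul]
    exact integral_add ((hwint w hw).smul s) ((hwint w' hw').smul t)
  obtain ⟨δ, hδ0, hδ⟩ : ∃ δ > 0, ∀ i, δ ≤ η i := by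
    obtain ⟨i, hi⟩ := Finite.exists_min η
    exact ⟨η i, hpos i, hi⟩
  have hA0 : 0 ≤ ∫ x, A x ∂μ :=
    integral_nonneg fun x => (h0 x η hη).trans (hcA x η hη)
  have hcle : ∀ w ∈ S, ∫ x, c x (w x) ∂μ ≤ ∫ x, A x ∂μ := fun w hw =>
    integral_mono (hcint w hw) hA fun x => hcA x _ (hw.2 x)
  have hc0 : ∀ w ∈ S, 0 ≤ ∫ x, c x (w x) ∂μ := fun w hw =>
    integral_nonneg fun x => h0 x _ (hw.2 x)
  set L : ℝ := (∫ x, A x ∂μ) / δ with hL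
  have hL0 : 0 ≤ L := by positivity
  -- penalised lower bound
  have hpen : ∀ w ∈ S, V ≤ ∫ x, c x (w x) ∂μ + L * ‖∫ x, w x ∂μ - η‖ := by
    intro w hw
    set z := ∫ x, w x ∂μ with hz
    rcases eq_or_ne z η with h | h
    · simpa [h] using hV w hw.1 hw.2 h
    set t : ℝ := ‖z - η‖ / δ with ht
    have ht0 : 0 < t := div_pos (norm_pos_iff.2 (sub_ne_zero.2 h)) hδ0
    have hLt : L * ‖z - η‖ = t * ∫ x, A x ∂μ := by rw [hL, ht]; ring
    rw [hLt]
    rcases le_total 1 t with h1 | h1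
    · calc V ≤ ∫ x, c x η ∂μ := hV (fun _ => η) hηS.1 hηS.2 (by simp)
        _ ≤ ∫ x, A x ∂μ := hcle _ hηS
        _ ≤ _ := by nlinarith [hc0 w hw]
    · have hζ : z + t⁻¹ • (η - z) ∈ stdSimplex ℝ ι := by
        refine ⟨fun i => ?_, ?_⟩
        · simp only [Pi.add_apply, Pi.smul_apply, Pi.sub_apply, smul_eq_mul]
          have hzi := (hbar w hw).1 i
          rcases le_total (z i) (η i) with h2 | h2
          · have : 0 ≤ t⁻¹ * (η i - z i) := mul_nonneg (by positivity) (by linarith)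
            linarith
          · have h3 : z i - η i ≤ ‖z - η‖ :=
              (le_abs_self _).trans (norm_le_pi_norm (z - η) i)
            have h4 : t⁻¹ * (z i - η i) ≤ δ := by
              rw [inv_mul_le_iff₀ ht0, ht, div_mul_cancel₀ _ hδ0.ne']; exact h3
            have := hδ i
            nlinarith
        · simp only [Pi.add_apply, Pi.smul_apply, Pi.sub_apply, smul_eq_mul,
            Finset.sum_add_distrib, ← Finset.mul_sum, Finset.sum_sub_distrib, hη.2,
            (hbar w hw).2, hz]
          simp
      have hS2 : (fun _ : X => z + t⁻¹ • (η - z)) ∈ S := ⟨measurable_const, fun _ => hζ⟩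
      have hm := hconvS w hw _ hS2 (1 - t) t (by linarith) ht0.le (by ring)
      have h5 := hV _ hm.1 hm.2 (by
        rw [hbarlin w hw _ hS2]
        simp only [integral_const, probReal_univ, one_smul]
        rw [smul_add, smul_smul, mul_inv_cancel₀ ht0.ne', ← hz]; module)
      have h6 := hconvc w hw _ hS2 (1 - t) t (by linarith) ht0.le (by ring)
      have h7 := hcle _ hS2
      have h8 := hc0 w hw
      nlinarith
  have : Nonempty S := ⟨⟨_, hηS⟩⟩
  let F : (ι → ℝ) → ℝ := fun h => ⨅ w : S, (∫ x, c x (w.1 x) ∂μ + L * ‖∫ x, w.1 x ∂μ - h‖)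
  have hFb : ∀ h, BddBelow (range fun w : S => (∫ x, c x (w.1 x) ∂μ + L * ‖∫ x, w.1 x ∂μ - h‖)) :=
    fun h => ⟨0, by rintro _ ⟨w, rfl⟩; have := hc0 w.1 w.2; positivity⟩
  have hFcv : ConvexOn ℝ univ F := by
    refine ⟨convex_univ, fun h _ h' _ s t hs ht hst => ?_⟩
    refine le_of_forall_pos_le_add fun e he => ?_
    obtain ⟨w, hw⟩ := exists_lt_of_ciInf_lt (show F h < F h + e by linarith)
    obtain ⟨w', hw'⟩ := exists_lt_of_ciInf_lt (show F h' < F h' + e by linarith)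
    refine (ciInf_le (hFb _) ⟨_, hconvS w.1 w.2 w'.1 w'.2 s t hs ht hst⟩).trans ?_
    have h1 := hconvc w.1 w.2 w'.1 w'.2 s t hs ht hst
    have h2 : ‖∫ x, (s • w.1 + t • w'.1) x ∂μ - (s • h + t • h')‖
        ≤ s * ‖∫ x, w.1 x ∂μ - h‖ + t * ‖∫ x, w'.1 x ∂μ - h'‖ := by
      rw [hbarlin w.1 w.2 w'.1 w'.2]
      have : s • ∫ x, w.1 x ∂μ + t • ∫ x, w'.1 x ∂μ - (s • h + t • h')
          = s • (∫ x, w.1 x ∂μ - h) + t • (∫ x, w'.1 x ∂μ - h') := by module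
      rw [this]
      refine (norm_add_le _ _).trans ?_
      rw [norm_smul, norm_smul, Real.norm_of_nonneg hs, Real.norm_of_nonneg ht]
    have h3 := mul_le_mul_of_nonneg_left h2 hL0
    simp only [smul_eq_mul]
    have h4 := mul_le_mul_of_nonneg_left hw.le hs
    have h5 := mul_le_mul_of_nonneg_left hw'.le ht
    have h6 : s * e + t * e = e := by rw [← add_mul, hst, one_mul]
    nlinarith
  have hFc : ContinuousOn F univ := hFcv.continuousOn isOpen_univ
  obtain ⟨l, k, hlk, hl0⟩ := hFcv.exists_affine_le_of_lt (𝕜 := ℝ) (mem_univ η)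
    (show F η - ε / 2 < F η by linarith) isClosed_univ hFc.lowerSemicontinuousOn
  have hVF : V ≤ F η := le_ciInf fun w => hpen w.1 w.2
  have hsub : ∀ w ∈ S, V - ε / 2 + l (∫ x, w x ∂μ - η) ≤ ∫ x, c x (w x) ∂μ := by
    intro w hw
    have h1 := hlk ⟨∫ x, w x ∂μ, mem_univ _⟩
    simp at h1
    have h2 : F (∫ x, w x ∂μ) ≤ _ := ciInf_le (hFb _) ⟨w, hw⟩
    simp at h2 hl0
    rw [map_sub]
    linarith
  set ψ : ι → ℝ := fun i => -l (Pi.single i 1) with hψ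
  have hlψ : ∀ u : ι → ℝ, ∑ i, ψ i * u i = -l u := by
    intro u
    conv_rhs => rw [← Finset.univ_sum_single u, map_sum, ← Finset.sum_neg_distrib]
    refine Finset.sum_congr rfl fun i _ => ?_
    have : (Pi.single i (u i) : ι → ℝ) = u i • Pi.single i 1 := by
      rw [← Pi.single_smul]; simp
    rw [this, map_smul, smul_eq_mul, hψ]; ring
  have hψb : ∀ w ∈ stdSimplex ℝ ι, |∑ i, ψ i * w i| ≤ ∑ i, |ψ i| := by
    intro w hw
    refine (Finset.abs_sum_le_sum_abs _ _).trans (Finset.sum_le_sum fun i _ => ?_)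
    rw [abs_mul, abs_of_nonneg (hw.1 i)]
    exact mul_le_of_le_one_right (abs_nonneg _) (mem_Icc_of_mem_stdSimplex hw i).2
  obtain ⟨φ, hφm, hφi, hφle, hφw⟩ := exists_measurable_minimum_stdSimplex (μ := μ)
    (g := fun x w => c x w + ∑ i, ψ i * w i) (A := fun x => A x + ∑ i, |ψ i|)
    (fun w hw => (hmeas (fun _ => w) measurable_const fun _ => hw).add_const _)
    (fun x => by
      refine (hcv x).add ⟨convex_stdSimplex ℝ ι, fun u _ v _ s t _ _ _ => le_of_eq ?_⟩
      simp only [hlψ, map_add, map_smul, smul_eq_mul]; ring)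
    (hA.add (integrable_const _)) (fun x w hw => by
      refine (abs_add_le _ _).trans (add_le_add ?_ (hψb w hw))
      rw [abs_of_nonneg (h0 x w hw)]; exact hcA x w hw)
  refine ⟨ψ, φ, hφm, hφi, hφle, ?_⟩
  obtain ⟨w, hwm, hwΔ, hw⟩ := hφw (ε / 2) (by linarith)
  have hwS : w ∈ S := ⟨hwm, hwΔ⟩
  have h1 := hsub w hwS
  have h2 : ∫ x, (c x (w x) + ∑ i, ψ i * w x i) ∂μ ≤ ∫ x, (φ x + ε / 2) ∂μ := by
    refine integral_mono ((hcint w hwS).add ?_) (hφi.add (integrable_const _)) hw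
    simp only [hlψ]
    exact (l.integrable_comp (hwint w hwS)).neg
  rw [integral_add hφi (integrable_const _)] at h2
  simp only [hlψ] at h2 ⊢
  rw [integral_add (g := fun x => -l (w x)) (hcint w hwS) (l.integrable_comp (hwint w hwS)).neg,
    integral_neg, l.integral_comp_comm (hwint w hwS)] at h2
  rw [map_sub] at h1
  simp at h2
  linarith

theorem exists_dual_stdSimplex_mix {X ι : Type*} [MeasurableSpace X] [Fintype ι] [Nonempty ι]
    {μ : Measure X} [IsProbabilityMeasure μ] {c : X → (ι → ℝ) → ℝ} {A : X → ℝ}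
    (hmeas : ∀ w : X → ι → ℝ, Measurable w → (∀ x, w x ∈ stdSimplex ℝ ι) →
      Measurable fun x => c x (w x))
    (hcv : ∀ x, ConvexOn ℝ (stdSimplex ℝ ι) (c x)) (hA : Integrable A μ)
    (h0 : ∀ x, ∀ w ∈ stdSimplex ℝ ι, 0 ≤ c x w) (hcA : ∀ x, ∀ w ∈ stdSimplex ℝ ι, c x w ≤ A x)
    {η u : ι → ℝ} (hη : η ∈ stdSimplex ℝ ι) (hu : u ∈ stdSimplex ℝ ι) (hpos : ∀ i, 0 < u i)
    {θ : ℝ} (hθ0 : 0 < θ) (hθ1 : θ < 1) {V : ℝ}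
    (hV : ∀ w : X → ι → ℝ, Measurable w → (∀ x, w x ∈ stdSimplex ℝ ι) →
      ∫ x, w x ∂μ = (1 - θ) • η + θ • u → V ≤ ∫ x, c x (w x) ∂μ) {ε : ℝ} (hε : 0 < ε) :
    ∃ (ψ : ι → ℝ) (φ : X → ℝ), Measurable φ ∧ Integrable φ μ ∧
      (∀ x, ∀ w ∈ stdSimplex ℝ ι, φ x ≤ c x w + ∑ i, ψ i * w i) ∧
      V - θ * ∫ x, A x ∂μ - ε + ∑ i, ψ i * η i ≤ ∫ x, φ x ∂μ := by
  rcases le_total (V - θ * ∫ x, A x ∂μ - ε) 0 with hneg | hneg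
  · refine ⟨0, 0, measurable_const, integrable_zero _ _ _, fun x w hw => ?_, ?_⟩
    · simpa using h0 x w hw
    · simpa using hneg
  have hm : (1 - θ) • η + θ • u ∈ stdSimplex ℝ ι :=
    convex_stdSimplex ℝ ι hη hu (by linarith) hθ0.le (by ring)
  obtain ⟨ψ, φ, hφm, hφi, hφ, h⟩ := exists_dual_stdSimplex hmeas hcv hA h0 hcA hm (fun i => by
    have h1 := mul_pos hθ0 (hpos i)
    have h2 := mul_nonneg (sub_nonneg.2 hθ1.le) (hη.1 i)
    simp only [Pi.add_apply, Pi.smul_apply, smul_eq_mul]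
    linarith) hV hε
  refine ⟨ψ, φ, hφm, hφi, hφ, ?_⟩
  have h1 : ∫ x, φ x ∂μ ≤ ∫ x, A x ∂μ + ∑ i, ψ i * u i := by
    have : ∫ x, φ x ∂μ ≤ ∫ x, (A x + ∑ i, ψ i * u i) ∂μ :=
      integral_mono hφi (hA.add (integrable_const _)) fun x =>
        (hφ x u hu).trans (by linarith [hcA x u hu])
    rwa [integral_add hA (integrable_const _), integral_const, probReal_univ, one_smul] at this
  have h2 : ∑ i, ψ i * ((1 - θ) • η + θ • u) i
      = (1 - θ) * ∑ i, ψ i * η i + θ * ∑ i, ψ i * u i := by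
    simp only [Finset.mul_sum, ← Finset.sum_add_distrib]
    refine Finset.sum_congr rfl fun i _ => ?_
    simp only [Pi.add_apply, Pi.smul_apply, smul_eq_mul]; ring
  rw [h2] at h
  have h3 : (V - θ * ∫ x, A x ∂μ - ε) ≤ (1 - θ) * (∫ x, φ x ∂μ - ∑ i, ψ i * η i) := by
    nlinarith
  by_contra! hcon
  have h4 : ∫ x, φ x ∂μ - ∑ i, ψ i * η i < V - θ * ∫ x, A x ∂μ - ε := by linarith
  nlinarith

/-- Weights of convex combinations of the tail `n, n + 1, …`. -/
def tailWeights (n : ℕ) : Set (ℕ →₀ ℝ) :=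
  {l | (∀ j, 0 ≤ l j) ∧ (∀ j, l j ≠ 0 → n ≤ j) ∧ (l.sum fun _ a => a) = 1}

theorem tailWeights_antitone : Antitone tailWeights := fun _ _ hnm _ hl =>
  ⟨hl.1, fun j hj => hnm.trans (hl.2.1 j hj), hl.2.2⟩

theorem convex_tailWeights (n : ℕ) : Convex ℝ (tailWeights n) := by
  intro l hl m hm s t hs ht hst
  refine ⟨fun j => ?_, fun j hj => ?_, ?_⟩
  · simp only [Finsupp.add_apply, Finsupp.smul_apply, smul_eq_mul]
    have := hl.1 j; have := hm.1 j; positivity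
  · by_contra hc
    have h1 : l j = 0 := by by_contra h; exact hc (hl.2.1 j h)
    have h2 : m j = 0 := by by_contra h; exact hc (hm.2.1 j h)
    simp [h1, h2] at hj
  · rw [Finsupp.sum_add_index' (by simp) (by simp), Finsupp.sum_smul_index' (by simp),
      Finsupp.sum_smul_index' (by simp)]
    simp only [smul_eq_mul]
    rw [← Finsupp.mul_sum, ← Finsupp.mul_sum, hl.2.2, hm.2.2]
    linarith

theorem single_mem_tailWeights (n : ℕ) : Finsupp.single n (1 : ℝ) ∈ tailWeights n := by
  refine ⟨fun j => ?_, fun j hj => ?_, by simp⟩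
  · rw [Finsupp.single_apply]; split_ifs <;> simp
  · rw [Finsupp.single_apply] at hj
    by_contra hc
    exact hj (if_neg (by omega))

theorem tailWeights_linearCombination_mem {E : Type*} [AddCommGroup E] [Module ℝ E] {n : ℕ}
    {l : ℕ →₀ ℝ} (hl : l ∈ tailWeights n) {s : Set E} (hs : Convex ℝ s) {f : ℕ → E}
    (hf : ∀ j, n ≤ j → f j ∈ s) : Finsupp.linearCombination ℝ f l ∈ s := by
  rw [Finsupp.linearCombination_apply]
  exact hs.sum_mem (fun j _ => hl.1 j) hl.2.2 fun j hj => hf j (hl.2.1 j (by simpa using hj))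

/-- A Komlós type lemma: nonnegative functions have forward convex combinations
that converge almost everywhere in `[0, ∞]`. -/
theorem exists_tailWeights_tendsto_exp {Ω : Type*} [MeasurableSpace Ω] {μ : Measure Ω}
    [IsFiniteMeasure μ] {f : ℕ → Ω → ℝ} (hf : ∀ n, AEMeasurable (f n) μ)
    (h0 : ∀ n x, 0 ≤ f n x) :
    ∃ l : ℕ → ℕ →₀ ℝ, (∀ n, l n ∈ tailWeights n) ∧ ∀ᵐ x ∂μ, ∃ r : ℝ,
      Tendsto (fun n => Real.exp (-(Finsupp.linearCombination ℝ f (l n) x) / 2)) atTop (𝓝 r) := by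
  let F : (ℕ →₀ ℝ) → Ω → ℝ := fun l => Finsupp.linearCombination ℝ f l
  have hF0 : ∀ n, ∀ l ∈ tailWeights n, ∀ x, 0 ≤ F l x := fun n l hl x =>
    tailWeights_linearCombination_mem hl (s := {g : Ω → ℝ | 0 ≤ g x})
      (fun g hg g' hg' s t hs ht _ => by
        simp only [mem_ofPred_eq, Pi.add_apply, Pi.smul_apply, smul_eq_mul] at *
        positivity) fun j _ => h0 j x
  have hFm : ∀ l, AEMeasurable (F l) μ := fun l => by
    simp only [F, Finsupp.linearCombination_apply, Finsupp.sum]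
    exact Finset.aemeasurable_sum _ fun j _ => (hf j).const_smul _
  have hei : ∀ g : Ω → ℝ, AEMeasurable g μ → (∀ x, 0 ≤ g x) →
      Integrable (fun x => Real.exp (-g x)) μ := fun g hg hg0 => by
    refine Integrable.of_bound (hg.neg.exp.aestronglyMeasurable) 1 (ae_of_all _ fun x => ?_)
    rw [Real.norm_of_nonneg (Real.exp_pos _).le, Real.exp_le_one_iff]
    simpa using hg0 x
  let I : (ℕ →₀ ℝ) → ℝ := fun l => ∫ x, Real.exp (-F l x) ∂μ
  have hI0 : ∀ l, 0 ≤ I l := fun l => integral_nonneg fun x => (Real.exp_pos _).le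
  have hne : ∀ n, Nonempty (tailWeights n) := fun n => ⟨⟨_, single_mem_tailWeights n⟩⟩
  let J : ℕ → ℝ := fun n => ⨅ l : tailWeights n, I l.1
  have hJb : ∀ n, BddBelow (range fun l : tailWeights n => I l.1) := fun n =>
    ⟨0, by rintro _ ⟨l, rfl⟩; exact hI0 _⟩
  have hJI : ∀ n, ∀ l ∈ tailWeights n, J n ≤ I l := fun n l hl => ciInf_le (hJb n) ⟨l, hl⟩
  have hJmono : Monotone J := fun n m hnm =>
    le_ciInf fun l => hJI n _ (tailWeights_antitone hnm l.2)
  have hJbdd : BddAbove (range J) := ⟨∫ _, (1 : ℝ) ∂μ, by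
    rintro _ ⟨n, rfl⟩
    refine (hJI n _ (single_mem_tailWeights n)).trans (integral_mono
      (hei _ (hFm _) (hF0 n _ (single_mem_tailWeights n))) (integrable_const _) fun x => ?_)
    simpa using hF0 n _ (single_mem_tailWeights n) x⟩
  let δ : ℕ → ℝ := fun n => (1 / 2 : ℝ) ^ n
  have hδ : ∀ n, 0 < δ n := fun n => by positivity
  have hex : ∀ n, ∃ l ∈ tailWeights n, I l < J n + δ n := fun n => by
    obtain ⟨l, hl⟩ := exists_lt_of_ciInf_lt (show J n < J n + δ n by linarith [hδ n])
    exact ⟨l.1, l.2, hl⟩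
  choose l hl hlI using hex
  have hJle : ∀ n, J n ≤ ⨆ n, J n := le_ciSup hJbdd
  have key : ∀ n m, n ≤ m → ∫ x, (Real.exp (-F (l n) x / 2) - Real.exp (-F (l m) x / 2)) ^ 2 ∂μ
      ≤ ((⨆ n, J n) - J n) + 2 * δ n := by
    intro n m hnm
    have hm : (1 / 2 : ℝ) • l n + (1 / 2 : ℝ) • l m ∈ tailWeights n :=
      convex_tailWeights n (hl n) (tailWeights_antitone hnm (hl m)) (by norm_num) (by norm_num)
        (by norm_num)
    have h1 := hJI n _ hm
    have e1 : ∀ x, (Real.exp (-F (l n) x / 2) - Real.exp (-F (l m) x / 2)) ^ 2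
        = (Real.exp (-F (l n) x) + Real.exp (-F (l m) x))
          - 2 * Real.exp (-F ((1 / 2 : ℝ) • l n + (1 / 2 : ℝ) • l m) x) := fun x => by
      have : F ((1 / 2 : ℝ) • l n + (1 / 2 : ℝ) • l m) x = F (l n) x / 2 + F (l m) x / 2 := by
        simp only [F, map_add, map_smul, Pi.add_apply, Pi.smul_apply, smul_eq_mul]; ring
      rw [this, sub_sq, ← Real.exp_nat_mul, ← Real.exp_nat_mul, mul_assoc, ← Real.exp_add]
      push_cast
      ring_nf
    simp only [e1]
    have i1 := hei _ (hFm (l n)) (hF0 n _ (hl n))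
    have i2 := hei _ (hFm (l m)) (hF0 m _ (hl m))
    have i3 := hei _ (hFm _) (hF0 n _ hm)
    have e2 := integral_sub (i1.add i2) (i3.const_mul 2)
    simp only [Pi.add_apply] at e2
    rw [e2, integral_add i1 i2, integral_const_mul]
    have h2 := hlI n
    have h3 := hlI m
    have h4 : δ m ≤ δ n := pow_le_pow_of_le_one (by norm_num) (by norm_num) hnm
    have h5 := hJle m
    simp only [I] at h1 h2 h3
    linarith
  have hlim : Tendsto (fun n => ((⨆ n, J n) - J n) + 2 * δ n) atTop (𝓝 0) := by
    have h1 := (tendsto_atTop_ciSup hJmono hJbdd).const_sub (⨆ n, J n)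
    have h2 : Tendsto δ atTop (𝓝 0) :=
      tendsto_pow_atTop_nhds_zero_of_lt_one (by norm_num) (by norm_num)
    simpa using h1.add (h2.const_mul 2)
  obtain ⟨σ, hσ, hσ2⟩ := extraction_forall_of_eventually' (P := fun k n =>
    ((⨆ n, J n) - J n) + 2 * δ n < (1 / 4 : ℝ) ^ k) fun k =>
      eventually_atTop.1 (hlim.eventually_lt_const (by positivity))
  refine ⟨fun k => l (σ k), fun k => tailWeights_antitone (hσ.id_le k) (hl _), ?_⟩
  let D : ℕ → Ω → ℝ := fun k x =>
    Real.exp (-F (l (σ k)) x / 2) - Real.exp (-F (l (σ (k + 1))) x / 2)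
  have hDm : ∀ k, AEMeasurable (D k) μ := fun k =>
    ((hFm _).neg.div_const 2).exp.sub ((hFm _).neg.div_const 2).exp
  have hDb : ∀ k x, |D k x| ≤ 1 := fun k x => by
    have a1 := Real.exp_pos (-F (l (σ k)) x / 2)
    have a2 := Real.exp_pos (-F (l (σ (k + 1))) x / 2)
    have a3 : Real.exp (-F (l (σ k)) x / 2) ≤ 1 := Real.exp_le_one_iff.2 (by
      linarith [hF0 _ _ (hl (σ k)) x])
    have a4 : Real.exp (-F (l (σ (k + 1))) x / 2) ≤ 1 := Real.exp_le_one_iff.2 (by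
      linarith [hF0 _ _ (hl (σ (k + 1))) x])
    rw [abs_le]; constructor <;> simp only [D] <;> linarith
  have hDi : ∀ k, ∫ x, D k x ^ 2 ∂μ ≤ (1 / 4 : ℝ) ^ k := fun k =>
    (key _ _ (hσ.monotone k.le_succ)).trans (hσ2 k).le
  have hDl : ∀ k, ∫⁻ x, ENNReal.ofReal (2 ^ k * D k x ^ 2) ∂μ ≤ ENNReal.ofReal ((1 / 2) ^ k) := by
    intro k
    have hint : Integrable (fun x => 2 ^ k * D k x ^ 2) μ := by
      refine Integrable.const_mul (Integrable.of_bound ((hDm k).pow_const 2).aestronglyMeasurable 1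
        (ae_of_all _ fun x => ?_)) _
      rw [norm_pow, Real.norm_eq_abs]
      exact pow_le_one₀ (abs_nonneg _) (hDb k x)
    rw [← ofReal_integral_eq_lintegral_ofReal hint (ae_of_all _ fun x => by positivity)]
    refine ENNReal.ofReal_le_ofReal ?_
    rw [integral_const_mul]
    calc (2 : ℝ) ^ k * ∫ x, D k x ^ 2 ∂μ ≤ 2 ^ k * (1 / 4) ^ k := by gcongr; exact hDi k
      _ = _ := by rw [← mul_pow]; norm_num
  have hsum : ∫⁻ x, ∑' k, ENNReal.ofReal (2 ^ k * D k x ^ 2) ∂μ ≠ ⊤ := by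
    rw [lintegral_tsum fun k => (((hDm k).pow_const 2).const_mul _).ennreal_ofReal]
    refine ne_top_of_le_ne_top ?_ (ENNReal.tsum_le_tsum hDl)
    rw [← ENNReal.ofReal_tsum_of_nonneg (fun k => by positivity) summable_geometric_two]
    exact ENNReal.ofReal_ne_top
  have hae := ae_lt_top' (AEMeasurable.tsum fun k =>
    (((hDm k).pow_const 2).const_mul _).ennreal_ofReal) hsum
  filter_upwards [hae] with x hx
  have h1 := ENNReal.summable_toReal hx.ne
  have h2 : Summable fun k => |D k x| := by
    refine Summable.of_nonneg_of_le (fun k => abs_nonneg _) (fun k => ?_)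
      (h1.add summable_geometric_two)
    rw [ENNReal.toReal_ofReal (by positivity)]
    have h3 : (2 : ℝ) ^ k * (1 / 2) ^ k = 1 := by rw [← mul_pow]; norm_num
    have h4 : (0 : ℝ) < (1 / 2) ^ k := by positivity
    have h5 : (0 : ℝ) < 2 ^ k := by positivity
    have h6 : 0 ≤ |D k x| := abs_nonneg _
    rw [← sq_abs]
    set p : ℝ := 2 ^ k
    set q : ℝ := (1 / 2) ^ k
    set z := |D k x|
    have h7 : 0 ≤ p * (z - q) ^ 2 := by positivity
    have h8 : p * (z - q) ^ 2 = p * z ^ 2 - 2 * (p * q) * z + (p * q) * q := by ring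
    rw [h8, h3] at h7
    linarith
  exact cauchySeq_tendsto_of_complete (cauchySeq_of_summable_dist h2)

theorem sum_hat {N : ℕ} {t : ℝ} (ht : |t| ≤ N) :
    ∑ k ∈ Finset.Icc (-N : ℤ) N, max 0 (1 - |t - k|) = 1 ∧
      ∑ k ∈ Finset.Icc (-N : ℤ) N, max 0 (1 - |t - k|) * (k : ℝ) = t := by
  have hout : ∀ k : ℤ, k ∉ Finset.Icc (-N : ℤ) N → max 0 (1 - |t - k|) = 0 := by
    intro k hk
    refine max_eq_left ?_
    rw [abs_le] at ht
    have : k ≤ -N - 1 ∨ N + 1 ≤ k := by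
      rw [Finset.mem_Icc] at hk; omega
    rcases this with h | h
    · have h' : (k : ℝ) ≤ -N - 1 := by exact_mod_cast h
      have := le_abs_self (t - k); linarith
    · have h' : (N : ℝ) + 1 ≤ k := by exact_mod_cast h
      have := neg_abs_le (t - k); linarith
  have hfl := Int.floor_le t
  have hfl2 := Int.lt_floor_add_one t
  have hout2 : ∀ k : ℤ, k ∉ ({⌊t⌋, ⌊t⌋ + 1} : Finset ℤ) → max 0 (1 - |t - k|) = 0 := by
    intro k hk
    refine max_eq_left ?_
    have : k ≤ ⌊t⌋ - 1 ∨ ⌊t⌋ + 2 ≤ k := by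
      simp only [Finset.mem_insert, Finset.mem_singleton] at hk; omega
    rcases this with h | h
    · have h' : (k : ℝ) ≤ ⌊t⌋ - 1 := by exact_mod_cast h
      have := le_abs_self (t - k); linarith
    · have h' : (⌊t⌋ : ℝ) + 2 ≤ k := by exact_mod_cast h
      have := neg_abs_le (t - k); linarith
  have hsw : ∀ g : ℤ → ℝ, ∑ k ∈ Finset.Icc (-N : ℤ) N, max 0 (1 - |t - k|) * g k
      = ∑ k ∈ ({⌊t⌋, ⌊t⌋ + 1} : Finset ℤ), max 0 (1 - |t - k|) * g k := by
    intro g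
    rw [Finset.sum_subset (Finset.subset_union_left (s₂ := {⌊t⌋, ⌊t⌋ + 1}))
      (fun k _ hk => by rw [hout k hk, zero_mul])]
    symm
    exact Finset.sum_subset Finset.subset_union_right
      (fun k _ hk => by rw [hout2 k hk, zero_mul])
  have e1 : max 0 (1 - |t - ⌊t⌋|) = 1 - (t - ⌊t⌋) := by
    rw [abs_of_nonneg (by linarith), max_eq_right (by linarith)]
  have e2 : max 0 (1 - |t - ((⌊t⌋ + 1 : ℤ) : ℝ)|) = t - ⌊t⌋ := by
    push_cast
    rw [abs_of_nonpos (by linarith), max_eq_right (by linarith)]; ring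
  have hne : ⌊t⌋ ≠ ⌊t⌋ + 1 := by omega
  constructor
  · have := hsw fun _ => 1
    simp only [mul_one] at this
    rw [this, Finset.sum_pair hne, e1, e2]; ring
  · rw [hsw, Finset.sum_pair hne, e1, e2]; push_cast; ring

/-- The cube `[-R, R]^d`. -/
def box (d R : ℕ) : Set (Rd d) := {y | ∀ i, |y i| ≤ R}

theorem isClosed_box (d R : ℕ) : IsClosed (box d R) := by
  simp only [box, ofPred_forall]
  exact isClosed_iInter fun i => isClosed_le (by fun_prop) continuous_const

theorem norm_le_of_coord_le {d : ℕ} {y : Rd d} {r : ℝ} (hr : 0 ≤ r) (h : ∀ i, |y i| ≤ r) :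
    ‖y‖ ≤ (d + 1) * r := by
  rw [EuclideanSpace.norm_eq]
  refine Real.sqrt_le_iff.2 ⟨by positivity, ?_⟩
  calc ∑ i, ‖y i‖ ^ 2 ≤ ∑ _i : Fin d, r ^ 2 := by
        gcongr with i
        exact h i
    _ = d * r ^ 2 := by simp
    _ ≤ _ := by rw [mul_pow]; gcongr; nlinarith [(Nat.cast_nonneg d : (0 : ℝ) ≤ d)]

theorem isCompact_box (d R : ℕ) : IsCompact (box d R) :=
  Metric.isCompact_of_isClosed_isBounded (isClosed_box d R)
    ((Metric.isBounded_closedBall (x := 0) (r := (d + 1) * (R : ℝ))).subset fun y hy => by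
      rw [mem_closedBall_zero_iff]
      exact norm_le_of_coord_le (Nat.cast_nonneg _) hy)

theorem convex_box (d R : ℕ) : Convex ℝ (box d R) := by
  intro y hy z hz s t hs ht hst i
  simp only [PiLp.add_apply, PiLp.smul_apply, smul_eq_mul]
  refine (abs_add_le _ _).trans ?_
  rw [abs_mul, abs_mul, abs_of_nonneg hs, abs_of_nonneg ht]
  have h1 := mul_le_mul_of_nonneg_left (hy i) hs
  have h2 := mul_le_mul_of_nonneg_left (hz i) ht
  have : s * (R : ℝ) + t * R = R := by rw [← add_mul, hst, one_mul]
  linarith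

theorem box_mono {d : ℕ} : Monotone (box d) := fun _ _ h _ hy i =>
  (hy i).trans (Nat.cast_le.2 h)

theorem zero_mem_box (d R : ℕ) : (0 : Rd d) ∈ box d R := fun i => by simp

theorem exists_mem_box {d : ℕ} (y : Rd d) : ∃ R, y ∈ box d R := by
  obtain ⟨R, hR⟩ := exists_nat_ge ‖y‖
  exact ⟨R, fun i => (PiLp.norm_apply_le y i).trans hR⟩

theorem iUnion_box (d : ℕ) : ⋃ R, box d R = univ :=
  eq_univ_of_forall fun y => mem_iUnion.2 (exists_mem_box y)

theorem measurableSet_box (d R : ℕ) : MeasurableSet (box d R) := (isClosed_box d R).measurableSet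

/-- A fine grid in the cube together with a martingale interpolation onto it. -/
theorem exists_grid (d R : ℕ) {ε : ℝ} (hε : 0 < ε) :
    ∃ (ι : Type) (_ : Fintype ι) (_ : Nonempty ι) (pt : ι → Rd d) (τ : Rd d → ι → ℝ),
      (∀ g, Continuous fun y => τ y g) ∧ (∀ g, pt g ∈ box d R) ∧ ∀ y ∈ box d R,
        τ y ∈ stdSimplex ℝ ι ∧ ∑ g, τ y g • pt g = y ∧ ∀ g, τ y g ≠ 0 → ‖pt g - y‖ ≤ ε := by
  obtain ⟨m, hm⟩ := exists_nat_gt ((d + 1) / ε)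
  have hm0 : (0 : ℝ) < m := lt_of_le_of_lt (by positivity) hm
  let N : ℕ := R * m
  let I := ↥(Finset.Icc (-N : ℤ) N)
  let h : ℝ → ℤ → ℝ := fun t k => max 0 (1 - |t - k|)
  have hsum : ∀ t : ℝ, |t| ≤ N → ∑ k : I, h t k = 1 ∧ ∑ k : I, h t k * (k : ℝ) = t := by
    intro t ht
    have := sum_hat ht
    exact ⟨(Finset.sum_coe_sort _ fun k : ℤ => h t k).trans this.1,
      (Finset.sum_coe_sort _ fun k : ℤ => h t k * (k : ℝ)).trans this.2⟩
  have hI : ∀ k : I, |((k : ℤ) : ℝ)| ≤ N := fun k => by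
    have := Finset.mem_Icc.1 k.2
    rw [abs_le]
    exact ⟨by exact_mod_cast this.1, by exact_mod_cast this.2⟩
  have hI0 : Nonempty I := ⟨⟨0, by simp⟩⟩
  refine ⟨Fin d → I, inferInstance, inferInstance,
    fun k => WithLp.toLp 2 fun i => ((k i : ℤ) : ℝ) / m,
    fun y k => ∏ i, h (y i * m) (k i), fun k => ?_, fun k i => ?_, fun y hy => ?_⟩
  · fun_prop
  · simp only [abs_div, Nat.abs_cast]
    rw [div_le_iff₀ hm0]
    exact_mod_cast hI (k i)
  have hyi : ∀ i, |y i * m| ≤ N := fun i => by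
    rw [abs_mul, Nat.abs_cast]
    simp only [N, Nat.cast_mul]
    exact mul_le_mul_of_nonneg_right (hy i) hm0.le
  have hone : ∑ k : Fin d → I, ∏ i, h (y i * m) (k i) = 1 := by
    have := Finset.prod_univ_sum (t := fun _ : Fin d => (Finset.univ : Finset I))
      (f := fun i k => h (y i * m) k)
    rw [Fintype.piFinset_univ] at this
    rw [← this]
    exact Finset.prod_eq_one fun i _ => (hsum _ (hyi i)).1
  refine ⟨⟨fun k => Finset.prod_nonneg fun i _ => le_max_left _ _, hone⟩, ?_, fun k hk => ?_⟩
  · ext i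
    simp only [WithLp.ofLp_sum, WithLp.ofLp_smul, Finset.sum_apply, Pi.smul_apply, smul_eq_mul]
    have := Finset.prod_univ_sum (t := fun _ : Fin d => (Finset.univ : Finset I))
      (f := fun j k => h (y j * m) k * if j = i then (k : ℝ) else 1)
    rw [Fintype.piFinset_univ] at this
    simp only [Finset.prod_mul_distrib, Finset.prod_ite_eq', Finset.mem_univ, if_true] at this
    have h2 : ∏ j, ∑ k : I, (h (y j * m) k * if j = i then (k : ℝ) else 1) = y i * m := by
      rw [Finset.prod_eq_single i]
      · simpa using (hsum _ (hyi i)).2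
      · intro j _ hj
        simpa [hj] using (hsum _ (hyi j)).1
      · simp
    rw [h2] at this
    simp only [← mul_div_assoc, ← Finset.sum_div]
    rw [← this, mul_div_cancel_right₀ _ hm0.ne']
  · have hk2 : ∀ i, h (y i * m) (k i) ≠ 0 := fun i =>
      Finset.prod_ne_zero_iff.1 hk i (Finset.mem_univ i)
    have : ∀ i, |(WithLp.toLp 2 (fun i => ((k i : ℤ) : ℝ) / m) - y : Rd d) i| ≤ 1 / m := by
      intro i
      have h1 : |y i * m - (k i : ℤ)| ≤ 1 := by
        by_contra! hc
        exact hk2 i (max_eq_left (by linarith))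
      simp only [PiLp.sub_apply]
      rw [le_div_iff₀ hm0, ← abs_of_pos hm0, ← abs_mul, abs_of_pos hm0, sub_mul,
        div_mul_cancel₀ _ hm0.ne', abs_sub_comm]
      exact h1
    refine (norm_le_of_coord_le (by positivity) this).trans ?_
    rw [mul_one_div, div_le_iff₀ hm0]
    rw [div_lt_iff₀ hε] at hm
    linarith

section ExtendedIntegral

variable {α : Type*} [MeasurableSpace α] {ρ : Measure α}

@[simp] theorem erealToENN_coe (r : ℝ) : erealToENN (r : EReal) = ENNReal.ofReal r := by
  simp [erealToENN]

@[simp] theorem erealToENN_top : erealToENN ⊤ = ⊤ := by simp [erealToENN]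

theorem coe_ennreal_eq_coe_toReal {x : ℝ≥0∞} (hx : x ≠ ⊤) : (x : EReal) = (x.toReal : EReal) := by
  lift x to NNReal using hx
  rfl

theorem eInt_coe {f : α → ℝ} (hf : Integrable f ρ) :
    eInt ρ (fun y => (f y : EReal)) = ((∫ y, f y ∂ρ : ℝ) : EReal) := by
  have h1 : ∫⁻ y, ENNReal.ofReal (f y) ∂ρ ≠ ⊤ := hf.lintegral_lt_top.ne
  have h2 : ∫⁻ y, ENNReal.ofReal (-f y) ∂ρ ≠ ⊤ := hf.neg.lintegral_lt_top.ne
  simp only [eInt, ← EReal.coe_neg, erealToENN_coe]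
  rw [integral_eq_lintegral_pos_part_sub_lintegral_neg_part hf, EReal.coe_sub,
    coe_ennreal_eq_coe_toReal h1, coe_ennreal_eq_coe_toReal h2]

theorem eInt_congr {f g : α → EReal} (h : f =ᵐ[ρ] g) : eInt ρ f = eInt ρ g := by
  unfold eInt
  have h1 : ∫⁻ y, erealToENN (f y) ∂ρ = ∫⁻ y, erealToENN (g y) ∂ρ :=
    lintegral_congr_ae (h.mono fun y hy => by simp only [hy])
  have h2 : ∫⁻ y, erealToENN (-(f y)) ∂ρ = ∫⁻ y, erealToENN (-(g y)) ∂ρ :=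
    lintegral_congr_ae (h.mono fun y hy => by simp only [hy])
  rw [h1, h2]

theorem memL1_iff {ψ : α → EReal} : MemL1 ρ ψ ↔ Measurable ψ ∧ (∀ y, ψ y ≠ ⊥) ∧
    (∀ᵐ y ∂ρ, ψ y ≠ ⊤) ∧ Integrable (fun y => (ψ y).toReal) ρ := by
  unfold MemL1
  refine and_congr_right fun hm => and_congr_right fun hb => ?_
  have hmt : Measurable fun y => (ψ y).toReal := hm.ereal_toReal
  have e1 : ∀ y, ψ y ≠ ⊤ → erealToENN (ψ y) + erealToENN (-(ψ y)) = ‖(ψ y).toReal‖ₑ := by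
    intro y hy
    lift ψ y to ℝ using ⟨hy, hb y⟩ with r
    rw [← EReal.coe_neg, erealToENN_coe, erealToENN_coe, EReal.toReal_coe,
      Real.enorm_eq_ofReal_abs]
    rcases le_total 0 r with h | h
    · rw [abs_of_nonneg h, ENNReal.ofReal_of_nonpos (p := -r) (by linarith), add_zero]
    · rw [abs_of_nonpos h, ENNReal.ofReal_of_nonpos h, zero_add]
  have hms : MeasurableSet {y | ψ y = ⊤} := hm (measurableSet_singleton ⊤)
  constructor
  · intro h
    have hae : ∀ᵐ y ∂ρ, ψ y ≠ ⊤ := by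
      rw [ae_iff]
      simp only [not_not]
      by_contra hne
      refine h (top_le_iff.1 ?_)
      calc ⊤ = ∫⁻ y in {y | ψ y = ⊤}, ⊤ ∂ρ := by
            rw [setLIntegral_const, ENNReal.top_mul hne]
        _ ≤ ∫⁻ y in {y | ψ y = ⊤}, erealToENN (ψ y) + erealToENN (-(ψ y)) ∂ρ := by
            refine setLIntegral_mono' hms fun y hy => ?_
            rw [show ψ y = ⊤ from hy]; simp
        _ ≤ _ := setLIntegral_le_lintegral _ _
    refine ⟨hae, hmt.aestronglyMeasurable, ?_⟩
    rw [HasFiniteIntegral, ← lintegral_congr_ae (hae.mono e1)]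
    exact h.lt_top
  · rintro ⟨hae, -, hi⟩
    rw [lintegral_congr_ae (hae.mono e1)]
    exact hi.ne

theorem MemL1.integrable {ψ : α → EReal} (h : MemL1 ρ ψ) :
    Integrable (fun y => (ψ y).toReal) ρ := (memL1_iff.1 h).2.2.2

theorem MemL1.ae_ne_top {ψ : α → EReal} (h : MemL1 ρ ψ) : ∀ᵐ y ∂ρ, ψ y ≠ ⊤ :=
  (memL1_iff.1 h).2.2.1

theorem MemL1.eInt_eq {ψ : α → EReal} (h : MemL1 ρ ψ) :
    eInt ρ ψ = ((∫ y, (ψ y).toReal ∂ρ : ℝ) : EReal) := by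
  rw [← eInt_coe h.integrable]
  exact eInt_congr (h.ae_ne_top.mono fun y hy => (EReal.coe_toReal hy (h.2.1 y)).symm)

end ExtendedIntegral

section Moments

variable {d : ℕ} {p : ℝ}

theorem continuous_Pp_iff {T : Type*} [TopologicalSpace T] {g : T → Pp p d} :
    Continuous g ↔ ∀ f, GrowthP p f → Continuous fun t => ∫ y, f y ∂(g t).1 := by
  refine continuous_iInf_rng.trans ?_
  simp only [continuous_induced_rng, Subtype.forall]
  rfl

theorem hasMomentP_of_ae_le (hp : 1 ≤ p) {ρ : Measure (Rd d)} [IsFiniteMeasure ρ] {r : ℝ}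
    (h : ∀ᵐ y ∂ρ, ‖y‖ ≤ r) : HasMomentP p ρ := by
  refine ne_top_of_le_ne_top ?_ (lintegral_mono_ae (h.mono fun y hy =>
    ENNReal.ofReal_le_ofReal (Real.rpow_le_rpow (norm_nonneg y) hy (by linarith))))
  rw [lintegral_const]
  exact ENNReal.mul_ne_top ENNReal.ofReal_ne_top (measure_ne_top _ _)

theorem exists_norm_le_of_mem_box (d R : ℕ) : ∃ r : ℝ, ∀ y ∈ box d R, ‖y‖ ≤ r :=
  ⟨(d + 1) * R, fun _ hy => norm_le_of_coord_le (Nat.cast_nonneg _) hy⟩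

theorem hasMomentP_of_box (hp : 1 ≤ p) {ρ : Measure (Rd d)} [IsFiniteMeasure ρ] {R : ℕ}
    (h : ρ (box d R)ᶜ = 0) : HasMomentP p ρ := by
  obtain ⟨r, hr⟩ := exists_norm_le_of_mem_box d R
  exact hasMomentP_of_ae_le hp ((measure_eq_zero_iff_ae_notMem.1 h).mono fun y hy =>
    hr y (not_not.1 hy))

theorem HasMomentP.mono {ρ ρ' : Measure (Rd d)} (h : HasMomentP p ρ) (hle : ρ' ≤ ρ) :
    HasMomentP p ρ' :=
  ne_top_of_le_ne_top h (lintegral_mono' hle le_rfl)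

theorem HasMomentP.smul {ρ : Measure (Rd d)} (h : HasMomentP p ρ) {c : ℝ≥0∞} (hc : c ≠ ⊤) :
    HasMomentP p (c • ρ) := by
  unfold HasMomentP
  rw [lintegral_smul_measure]
  exact ENNReal.mul_ne_top hc h

theorem HasMomentP.add {ρ ρ' : Measure (Rd d)} (h : HasMomentP p ρ) (h' : HasMomentP p ρ') :
    HasMomentP p (ρ + ρ') := by
  unfold HasMomentP
  rw [lintegral_add_measure]
  exact ENNReal.add_ne_top.2 ⟨h, h'⟩

theorem integrable_of_continuous_box {ρ : Measure (Rd d)} [IsFiniteMeasure ρ] {R : ℕ}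
    (h : ρ (box d R)ᶜ = 0) {f : Rd d → ℝ} (hf : Continuous f) : Integrable f ρ := by
  rw [← Measure.restrict_eq_self_of_ae_mem (s := box d R)
    ((measure_eq_zero_iff_ae_notMem.1 h).mono fun y hy => not_not.1 hy)]
  exact hf.continuousOn.integrableOn_compact (isCompact_box d R)

theorem ConvexOn.continuous_univ {f : Rd d → ℝ} (hf : ConvexOn ℝ univ f) : Continuous f :=
  continuousOn_univ.1 (hf.continuousOn isOpen_univ)

theorem convexOrder_of_box {ρ₁ ρ₂ : Measure (Rd d)} [IsFiniteMeasure ρ₁] [IsFiniteMeasure ρ₂]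
    {R : ℕ} (h₁ : ρ₁ (box d R)ᶜ = 0) (h₂ : ρ₂ (box d R)ᶜ = 0)
    (h : ∀ f : Rd d → ℝ, ConvexOn ℝ univ f → ∫ y, f y ∂ρ₁ ≤ ∫ y, f y ∂ρ₂) :
    ConvexOrder ρ₁ ρ₂ := fun f hf => by
  rw [eInt_coe (integrable_of_continuous_box h₁ hf.continuous_univ),
    eInt_coe (integrable_of_continuous_box h₂ hf.continuous_univ)]
  exact_mod_cast h f hf

/-- Push-forward of probability measures on a compact space to `P_p`. -/
noncomputable def pushPp (hp : 1 ≤ p) {K : Type*} [TopologicalSpace K] [CompactSpace K]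
    [MeasurableSpace K] [BorelSpace K] (F : C(K, Rd d)) (ρ : ProbabilityMeasure K) : Pp p d :=
  ⟨(ρ : Measure K).map F,
    have h1 : IsProbabilityMeasure ((ρ : Measure K).map F) :=
      Measure.isProbabilityMeasure_map F.continuous.aemeasurable
    ⟨h1, by
      obtain ⟨r, hr⟩ := (isCompact_range F.continuous).isBounded.exists_norm_le
      refine hasMomentP_of_ae_le hp (r := r) ?_
      rw [ae_map_iff F.continuous.aemeasurable (measurableSet_le (by fun_prop) (by fun_prop))]
      exact ae_of_all _ fun k => hr _ (mem_range_self k)⟩⟩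

theorem integral_pushPp (hp : 1 ≤ p) {K : Type*} [TopologicalSpace K] [CompactSpace K]
    [MeasurableSpace K] [BorelSpace K] (F : C(K, Rd d)) (ρ : ProbabilityMeasure K)
    {f : Rd d → ℝ} (hf : Continuous f) :
    ∫ y, f y ∂(pushPp hp F ρ).1 = ∫ k, f (F k) ∂(ρ : Measure K) :=
  integral_map F.continuous.aemeasurable hf.aestronglyMeasurable

theorem continuous_pushPp (hp : 1 ≤ p) {K : Type*} [TopologicalSpace K] [CompactSpace K]
    [MeasurableSpace K] [BorelSpace K] (F : C(K, Rd d)) :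
    Continuous (pushPp hp F : ProbabilityMeasure K → Pp p d) := by
  rw [continuous_Pp_iff]
  intro f hf
  simp only [fun ρ => integral_pushPp hp F ρ hf.1]
  exact ProbabilityMeasure.continuous_integral_boundedContinuousFunction
    (BoundedContinuousFunction.mkOfCompact ⟨fun k => f (F k), hf.1.comp F.continuous⟩)

end Moments

section Discrete

variable {α ι : Type*} [MeasurableSpace α] [Fintype ι]

/-- The discrete measure with atoms `pt i` of mass `w i`. -/
noncomputable def dm (pt : ι → α) (w : ι → ℝ) : Measure α :=
  ∑ i, ENNReal.ofReal (w i) • Measure.dirac (pt i)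

theorem lintegral_dm [MeasurableSingletonClass α] (pt : ι → α) (w : ι → ℝ) (f : α → ℝ≥0∞) :
    ∫⁻ y, f y ∂(dm pt w) = ∑ i, ENNReal.ofReal (w i) * f (pt i) := by
  simp [dm, lintegral_finsetSum_measure]

theorem dm_apply_eq_zero (pt : ι → α) (w : ι → ℝ) {s : Set α} (hs : MeasurableSet s)
    (h : ∀ i, pt i ∉ s) : dm pt w s = 0 := by
  simp [dm, Measure.finsetSum_apply, hs, h]

instance isFiniteMeasure_dm (pt : ι → α) (w : ι → ℝ) : IsFiniteMeasure (dm pt w) := by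
  refine ⟨?_⟩
  simp [dm, Measure.finsetSum_apply]

theorem isProbabilityMeasure_dm (pt : ι → α) {w : ι → ℝ} (hw : w ∈ stdSimplex ℝ ι) :
    IsProbabilityMeasure (dm pt w) := by
  refine ⟨?_⟩
  simp only [dm, Measure.finsetSum_apply, Measure.smul_apply, measure_univ, smul_eq_mul, mul_one]
  rw [← ENNReal.ofReal_sum_of_nonneg fun i _ => hw.1 i, hw.2, ENNReal.ofReal_one]

theorem integral_dm [MeasurableSingletonClass α] (pt : ι → α) {w : ι → ℝ} (hw : ∀ i, 0 ≤ w i)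
    (f : α → ℝ) : ∫ y, f y ∂(dm pt w) = ∑ i, w i * f (pt i) := by
  rw [dm, integral_finsetSum_measure fun i _ =>
    (integrable_dirac (by simp)).smul_measure ENNReal.ofReal_ne_top]
  simp [integral_smul_measure, ENNReal.toReal_ofReal (hw _)]

theorem dm_mix (pt : ι → α) {w w' : ι → ℝ} (hw : ∀ i, 0 ≤ w i) (hw' : ∀ i, 0 ≤ w' i) {s t : ℝ}
    (hs : 0 ≤ s) (ht : 0 ≤ t) :
    dm pt (s • w + t • w') = ENNReal.ofReal s • dm pt w + ENNReal.ofReal t • dm pt w' := by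
  simp only [dm, Finset.smul_sum, ← Finset.sum_add_distrib, smul_smul, ← add_smul]
  refine Finset.sum_congr rfl fun i _ => ?_
  congr 1
  simp only [Pi.add_apply, Pi.smul_apply, smul_eq_mul]
  rw [ENNReal.ofReal_add (mul_nonneg hs (hw i)) (mul_nonneg ht (hw' i)), ENNReal.ofReal_mul hs,
    ENNReal.ofReal_mul ht]

theorem hasMomentP_dm {d : ℕ} (p : ℝ) (pt : ι → Rd d) (w : ι → ℝ) : HasMomentP p (dm pt w) := by
  unfold HasMomentP
  rw [lintegral_dm]
  exact ENNReal.sum_ne_top.2 fun i _ => ENNReal.mul_ne_top ENNReal.ofReal_ne_top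
    ENNReal.ofReal_ne_top

theorem continuous_dm {d : ℕ} (p : ℝ) (pt : ι → Rd d) :
    Continuous fun w : stdSimplex ℝ ι =>
      (⟨dm pt w, isProbabilityMeasure_dm pt w.2, hasMomentP_dm p pt w⟩ : Pp p d) := by
  rw [continuous_Pp_iff]
  intro f _
  refine Continuous.congr (f := fun w : stdSimplex ℝ ι => ∑ i, w.1 i * f (pt i)) ?_
    fun w => (integral_dm pt w.2.1 f).symm
  exact continuous_finsetSum _ fun i _ =>
    ((continuous_apply i).comp continuous_subtype_val).mul continuous_const

end Discrete

theorem integral_bind_kernel {X Y : Type*} [MeasurableSpace X] [MeasurableSpace Y] {μ : Measure X}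
    (κ : ProbabilityTheory.Kernel X Y) {f : Y → ℝ} (hf : Integrable f (μ.bind κ)) :
    ∫ y, f y ∂(μ.bind κ) = ∫ x, ∫ y, f y ∂(κ x) ∂μ := by
  have e : (κ.comp (ProbabilityTheory.Kernel.const Unit μ)) () = μ.bind κ := by
    rw [ProbabilityTheory.Kernel.comp_apply, ProbabilityTheory.Kernel.const_apply]
  rw [← e] at hf ⊢
  exact ProbabilityTheory.Kernel.integral_comp hf

section LimitKernel

variable {X K : Type*} [MeasurableSpace X] [MetricSpace K] [CompactSpace K] [MeasurableSpace K]
  [BorelSpace K]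

theorem integrable_continuousMap (ρ : Measure K) [IsFiniteMeasure ρ] (f : C(K, ℝ)) :
    Integrable f ρ :=
  (BoundedContinuousFunction.mkOfCompact f).integrable ρ

theorem abs_integral_continuousMap_le {K : Type*} [TopologicalSpace K] [CompactSpace K]
    [MeasurableSpace K] (ρ : Measure K) [IsProbabilityMeasure ρ] (f : C(K, ℝ)) :
    |∫ k, f k ∂ρ| ≤ ‖f‖ := by
  have := norm_integral_le_of_norm_le_const (μ := ρ) (ae_of_all _ fun k => f.norm_coe_le_norm k)
  simpa using this

theorem continuous_integral_continuousMap (ρ : Measure K) [IsProbabilityMeasure ρ] :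
    Continuous fun f : C(K, ℝ) => ∫ k, f k ∂ρ := by
  refine (LipschitzWith.of_dist_le_mul (K := 1) fun f g => ?_).continuous
  rw [Real.dist_eq, ← integral_sub (integrable_continuousMap ρ f) (integrable_continuousMap ρ g),
    NNReal.coe_one, one_mul, dist_eq_norm]
  exact abs_integral_continuousMap_le ρ (f - g)

theorem continuous_probabilityMeasure_integral (f : C(K, ℝ)) :
    Continuous fun ρ : ProbabilityMeasure K => ∫ k, f k ∂(ρ : Measure K) :=
  ProbabilityMeasure.continuous_integral_boundedContinuousFunction
    (BoundedContinuousFunction.mkOfCompact f)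

theorem ext_of_integral_continuousMap {K : Type*} [MetricSpace K] [MeasurableSpace K]
    [BorelSpace K] {ρ ρ' : Measure K} [IsFiniteMeasure ρ] [IsFiniteMeasure ρ']
    (h : ∀ f : C(K, ℝ), ∫ k, f k ∂ρ = ∫ k, f k ∂ρ') : ρ = ρ' :=
  ext_of_forall_integral_eq_of_IsFiniteMeasure fun f => h f.toContinuousMap

theorem measurable_of_integral_continuousMap {κ : X → ProbabilityMeasure K}
    (h : ∀ f : C(K, ℝ), Measurable fun x => ∫ k, f k ∂(κ x : Measure K)) :
    Measurable fun x => (κ x : Measure K) := by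
  have hgen : ‹MeasurableSpace K› = .generateFrom {s : Set K | IsClosed s} := by
    rw [BorelSpace.measurable_eq (α := K), borel_eq_generateFrom_isClosed]
  refine Measurable.measure_of_isPiSystem_of_isProbabilityMeasure hgen isPiSystem_isClosed
    fun s hs => ?_
  refine measurable_of_tendsto_metrizable (f := fun n x => ∫⁻ k, (hs.apprSeq n k : ℝ≥0∞)
    ∂(κ x : Measure K)) (fun n => ?_) (tendsto_pi_nhds.2 fun x =>
      HasOuterApproxClosed.tendsto_lintegral_apprSeq hs _)
  have e : ∀ x, ∫⁻ k, (hs.apprSeq n k : ℝ≥0∞) ∂(κ x : Measure K)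
      = ENNReal.ofReal (∫ k, (⟨fun k => (hs.apprSeq n k : ℝ), by fun_prop⟩ : C(K, ℝ)) k
        ∂(κ x : Measure K)) := fun x => by
    rw [ofReal_integral_eq_lintegral_ofReal (integrable_continuousMap _ _)
      (ae_of_all _ fun k => by simp)]
    simp
  simp only [e]
  exact (h _).ennreal_ofReal

theorem exists_kernel_of_tendsto {μ : Measure X} [IsProbabilityMeasure μ]
    {D : X → ProbabilityMeasure K → ℝ≥0∞} (hlsc : ∀ x, LowerSemicontinuous (D x))
    (hcv : ∀ x (ρ₁ ρ₂ ρ : ProbabilityMeasure K) (s t : ℝ), 0 ≤ s → 0 ≤ t → s + t = 1 →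
      (ρ : Measure K) = ENNReal.ofReal s • (ρ₁ : Measure K) + ENNReal.ofReal t • (ρ₂ : Measure K) →
      D x ρ ≤ ENNReal.ofReal s * D x ρ₁ + ENNReal.ofReal t * D x ρ₂)
    {κ : ℕ → X → ProbabilityMeasure K}
    (hκ : ∀ n (f : C(K, ℝ)), Measurable fun x => ∫ k, f k ∂(κ n x : Measure K))
    {r : ℕ → X → ℝ} (hr : ∀ n, Measurable (r n)) (hr0 : ∀ n x, 0 ≤ r n x)
    (hri : ∀ n, Integrable (r n) μ) (hD : ∀ n x, D x (κ n x) ≤ ENNReal.ofReal (r n x)) {v : ℝ}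
    (hv : ∀ n, ∫ x, r n x ∂μ ≤ v) {ν : Measure K} [IsProbabilityMeasure ν]
    (hlim : ∀ f : C(K, ℝ), Tendsto (fun n => ∫ x, ∫ k, f k ∂(κ n x : Measure K) ∂μ) atTop
      (𝓝 (∫ k, f k ∂ν))) :
    ∃ η : X → ProbabilityMeasure K, Measurable (fun x => (η x : Measure K)) ∧
      μ.bind (fun x => (η x : Measure K)) = ν ∧ ∫⁻ x, D x (η x) ∂μ ≤ ENNReal.ofReal v := by
  classical
  let I : ℕ → C(K, ℝ) → X → ℝ := fun n f x => ∫ k, f k ∂(κ n x : Measure K)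
  let dq : ℕ → C(K, ℝ) := TopologicalSpace.denseSeq C(K, ℝ)
  let f' : ℕ → C(K, ℝ) := fun j => dq j + ContinuousMap.const K ‖dq j‖
  have hf'0 : ∀ j k, 0 ≤ f' j k := fun j k => by
    have := neg_le_of_abs_le ((dq j).norm_coe_le_norm k)
    simp only [f', ContinuousMap.add_apply, ContinuousMap.const_apply]
    linarith
  have hI0 : ∀ n j x, 0 ≤ I n (f' j) x := fun n j x => integral_nonneg (hf'0 j)
  have : IsFiniteMeasure (μ.prod (Measure.count : Measure ℕ).toFinite) := inferInstance
  obtain ⟨l, hl, hae⟩ := exists_tailWeights_tendsto_exp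
    (μ := μ.prod (Measure.count : Measure ℕ).toFinite)
    (f := fun n (q : X × ℕ) => I n (f' q.2) q.1)
    (fun n => (measurable_from_prod_countable_left fun j => hκ n (f' j)).aemeasurable)
    (fun n q => hI0 n q.2 q.1)
  let L : ℕ → C(K, ℝ) → X → ℝ :=
    fun n f x => Finsupp.linearCombination ℝ (fun m => I m f x) (l n)
  let rr : ℕ → X → ℝ := fun n x => Finsupp.linearCombination ℝ (fun m => r m x) (l n)
  -- the combined measures
  have hcomb : ∀ n x, ∃ ρ : ProbabilityMeasure K, (∀ f : C(K, ℝ), ∫ k, f k ∂(ρ : Measure K)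
      = L n f x) ∧ D x ρ ≤ ENNReal.ofReal (rr n x) := by
    intro n x
    let S : Set ((C(K, ℝ) → ℝ) × ℝ) := {q | 0 ≤ q.2 ∧ ∃ ρ : ProbabilityMeasure K,
      (∀ f : C(K, ℝ), ∫ k, f k ∂(ρ : Measure K) = q.1 f) ∧ D x ρ ≤ ENNReal.ofReal q.2}
    have hS : Convex ℝ S := by
      rintro ⟨g₁, r₁⟩ ⟨h₁, ρ₁, hg₁, hD₁⟩ ⟨g₂, r₂⟩ ⟨h₂, ρ₂, hg₂, hD₂⟩ s t hs ht hst
      have hρ : IsProbabilityMeasure (ENNReal.ofReal s • (ρ₁ : Measure K)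
          + ENNReal.ofReal t • (ρ₂ : Measure K)) := ⟨by
        simp [← ENNReal.ofReal_add hs ht, hst]⟩
      refine ⟨?_, ⟨_, hρ⟩, fun f => ?_, ?_⟩
      · simp only [Prod.smul_mk, Prod.mk_add_mk, smul_eq_mul] at h₁ h₂ ⊢; positivity
      · simp only [ProbabilityMeasure.coe_mk]
        rw [integral_add_measure ((integrable_continuousMap _ f).smul_measure ENNReal.ofReal_ne_top)
          ((integrable_continuousMap _ f).smul_measure ENNReal.ofReal_ne_top),
          integral_smul_measure, integral_smul_measure, hg₁, hg₂, ENNReal.toReal_ofReal hs,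
          ENNReal.toReal_ofReal ht]
        simp
      · refine (hcv x ρ₁ ρ₂ ⟨_, hρ⟩ s t hs ht hst rfl).trans ?_
        simp only [Prod.smul_mk, Prod.mk_add_mk, smul_eq_mul] at h₁ h₂ ⊢
        rw [ENNReal.ofReal_add (mul_nonneg hs h₁) (mul_nonneg ht h₂), ENNReal.ofReal_mul hs,
          ENNReal.ofReal_mul ht]
        gcongr
    have hmem := tailWeights_linearCombination_mem (hl n) hS
      (f := fun m => ((fun f => I m f x), r m x)) fun m _ => ⟨hr0 m x, κ m x, fun f => rfl, hD m x⟩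
    obtain ⟨-, ρ, h1, h2⟩ := hmem
    refine ⟨ρ, fun f => ?_, ?_⟩
    · rw [h1 f]
      exact Finsupp.apply_linearCombination ℝ
        ((LinearMap.proj f : (C(K, ℝ) → ℝ) →ₗ[ℝ] ℝ) ∘ₗ LinearMap.fst ℝ _ ℝ) _ _
    · refine h2.trans_eq (congrArg _ ?_)
      exact Finsupp.apply_linearCombination ℝ (LinearMap.snd ℝ (C(K, ℝ) → ℝ) ℝ) _ _
  choose ρ hρ hρD using hcomb
  have hLm : ∀ n f, Measurable (L n f) := fun n f => by
    simp only [L, Finsupp.linearCombination_apply, Finsupp.sum]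
    exact Finset.measurable_sum _ fun m _ => (hκ m f).const_smul (l n m)
  have hrm : ∀ n, Measurable (rr n) := fun n => by
    simp only [rr, Finsupp.linearCombination_apply, Finsupp.sum]
    exact Finset.measurable_sum _ fun m _ => (hr m).const_smul (l n m)
  let G : Set X := ⋂ j, {x | ∃ c, Tendsto (fun n => L n (f' j) x) atTop (𝓝 c)}
  have hGm : MeasurableSet G := MeasurableSet.iInter fun j =>
    measurableSet_exists_tendsto fun n => hLm n (f' j)
  have hG : ∀ᵐ x ∂μ, x ∈ G := by
    filter_upwards [Measure.ae_ae_of_ae_prod hae] with x hx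
    rw [ae_toFinite, Measure.ae_count_iff] at hx
    refine mem_iInter.2 fun j => ?_
    obtain ⟨c, hc⟩ := hx j
    have e : ∀ n, Finsupp.linearCombination ℝ (fun n (q : X × ℕ) => I n (f' q.2) q.1) (l n) (x, j)
        = L n (f' j) x := fun n =>
      Finsupp.apply_linearCombination ℝ (LinearMap.proj (x, j) : (X × ℕ → ℝ) →ₗ[ℝ] ℝ) _ _
    simp only [e] at hc
    have hc0 : Real.exp (-‖f' j‖ / 2) ≤ c := by
      refine ge_of_tendsto' hc fun n => Real.exp_le_exp.2 ?_
      have := le_of_abs_le (abs_integral_continuousMap_le (ρ n x : Measure K) (f' j))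
      rw [hρ n x] at this
      linarith
    have hc1 : c ≠ 0 := ((Real.exp_pos _).trans_le hc0).ne'
    refine ⟨-2 * Real.log c, ?_⟩
    have := (hc.log hc1).const_mul (-2)
    simp only [Real.log_exp] at this
    exact this.congr fun n => by ring
  let Φ : ProbabilityMeasure K → ℕ → ℝ := fun ρ j => ∫ k, f' j k ∂(ρ : Measure K)
  have hΦc : Continuous Φ :=
    continuous_pi fun j => continuous_probabilityMeasure_integral (f' j)
  have hΦi : Function.Injective Φ := by
    intro ρ₁ ρ₂ h
    have i₁ : IsProbabilityMeasure ρ₁.1 := ρ₁.2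
    have i₂ : IsProbabilityMeasure ρ₂.1 := ρ₂.2
    refine Subtype.ext (ext_of_integral_continuousMap fun f => ?_)
    have hcl : IsClosed {f : C(K, ℝ) | ∫ k, f k ∂(ρ₁ : Measure K) = ∫ k, f k ∂(ρ₂ : Measure K)} :=
      isClosed_eq (continuous_integral_continuousMap _) (continuous_integral_continuousMap _)
    refine hcl.closure_subset_iff.2 ?_ ((TopologicalSpace.denseRange_denseSeq C(K, ℝ)) f)
    rintro _ ⟨j, rfl⟩
    have hj := congrFun h j
    simp only [Φ, f', ContinuousMap.add_apply, ContinuousMap.const_apply] at hj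
    rw [integral_add (integrable_continuousMap _ _) (integrable_const _),
      integral_add (integrable_continuousMap _ _) (integrable_const _)] at hj
    simpa [dq] using hj
  have hemb : IsClosedEmbedding Φ := hΦc.isClosedEmbedding hΦi
  have hconv : ∀ x ∈ G, ∃ η : ProbabilityMeasure K, Tendsto (fun n => ρ n x) atTop (𝓝 η) := by
    intro x hx
    have hx' := fun j => mem_iInter.1 hx j
    choose c hc using hx'
    have ht : Tendsto (fun n => Φ (ρ n x)) atTop (𝓝 c) :=
      tendsto_pi_nhds.2 fun j => by simpa only [Φ, hρ] using hc j
    obtain ⟨η, rfl⟩ := hemb.isClosed_range.mem_of_tendsto ht (Eventually.of_forall fun n =>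
      mem_range_self _)
    exact ⟨η, hemb.isInducing.tendsto_nhds_iff.2 ht⟩
  let ρ₀ : ProbabilityMeasure K := ⟨ν, inferInstance⟩
  let η : X → ProbabilityMeasure K := fun x => if hx : x ∈ G then (hconv x hx).choose else ρ₀
  have hη : ∀ x ∈ G, Tendsto (fun n => ρ n x) atTop (𝓝 (η x)) := fun x hx => by
    simp only [η, hx, dif_pos]; exact (hconv x hx).choose_spec
  have hηf : ∀ (f : C(K, ℝ)) x, x ∈ G →
      Tendsto (fun n => L n f x) atTop (𝓝 (∫ k, f k ∂(η x : Measure K))) := fun f x hx => by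
    have := ((continuous_probabilityMeasure_integral f).tendsto _).comp (hη x hx)
    exact this.congr fun n => hρ n x f
  have hηm : Measurable fun x => (η x : Measure K) := by
    refine measurable_of_integral_continuousMap fun f => ?_
    refine measurable_of_tendsto_metrizable
      (f := fun n x => if x ∈ G then L n f x else ∫ k, f k ∂(ρ₀ : Measure K))
      (fun n => Measurable.ite hGm (hLm n f) measurable_const) (tendsto_pi_nhds.2 fun x => ?_)
    by_cases hx : x ∈ G
    · simpa only [hx, if_true] using hηf f x hx
    · simp [η, hx]
  have hLint : ∀ n f, ∫ x, L n f x ∂μ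
      = Finsupp.linearCombination ℝ (fun m => ∫ x, I m f x ∂μ) (l n) := fun n f => by
    simp only [L, Finsupp.linearCombination_apply, Finsupp.sum]
    rw [integral_finsetSum]
    · simp only [integral_smul]
    · refine fun m _ => Integrable.smul (l n m) ?_
      exact Integrable.of_bound (hκ m f).aestronglyMeasurable ‖f‖ (ae_of_all _ fun x =>
        abs_integral_continuousMap_le _ f)
  refine ⟨η, hηm, ?_, ?_⟩
  · have hprob : IsProbabilityMeasure (μ.bind fun x => (η x : Measure K)) :=
      ⟨by rw [Measure.bind_apply .univ hηm.aemeasurable]; simp⟩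
    refine ext_of_integral_continuousMap fun f => ?_
    have h1 : Tendsto (fun n => ∫ x, L n f x ∂μ) atTop
        (𝓝 (∫ x, ∫ k, f k ∂(η x : Measure K) ∂μ)) := by
      refine tendsto_integral_of_dominated_convergence (fun _ => ‖f‖)
        (fun n => (hLm n f).aestronglyMeasurable) (integrable_const _)
        (fun n => ae_of_all _ fun x => ?_) (hG.mono fun x hx => hηf f x hx)
      rw [← hρ n x f]
      exact abs_integral_continuousMap_le _ f
    have h2 : Tendsto (fun n => ∫ x, L n f x ∂μ) atTop (𝓝 (∫ k, f k ∂ν)) := by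
      simp only [hLint]
      rw [Metric.tendsto_atTop]
      intro ε hε
      obtain ⟨N, hN⟩ := Metric.tendsto_atTop.1 (hlim f) ε hε
      exact ⟨N, fun n hn => tailWeights_linearCombination_mem (tailWeights_antitone hn (hl n))
        (convex_ball (∫ k, f k ∂ν) ε) hN⟩
    rw [← tendsto_nhds_unique h1 h2]
    exact integral_bind_kernel ⟨fun x => (η x : Measure K), hηm⟩ (integrable_continuousMap _ f)
  · have hrint : ∀ n, ∫ x, rr n x ∂μ ≤ v := fun n => by
      have e : ∫ x, rr n x ∂μ = Finsupp.linearCombination ℝ (fun m => ∫ x, r m x ∂μ) (l n) := by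
        simp only [rr, Finsupp.linearCombination_apply, Finsupp.sum]
        rw [integral_finsetSum (l n).support (f := fun m x => l n m • r m x) fun m _ =>
          (hri m).smul (l n m)]
        simp only [integral_smul]
      rw [e]
      exact tailWeights_linearCombination_mem (hl n) (convex_Iic v) fun m _ => hv m
    have hrr0 : ∀ n x, 0 ≤ rr n x := fun n x =>
      tailWeights_linearCombination_mem (hl n) (convex_Ici (0 : ℝ)) fun m _ => hr0 m x
    have hrri : ∀ n, Integrable (rr n) μ := fun n => by
      simp only [rr, Finsupp.linearCombination_apply, Finsupp.sum]
      exact integrable_finsetSum _ fun m _ => (hri m).smul (l n m)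
    calc ∫⁻ x, D x (η x) ∂μ ≤ ∫⁻ x, liminf (fun n => ENNReal.ofReal (rr n x)) atTop ∂μ := by
          refine lintegral_mono_ae (hG.mono fun x hx => ?_)
          refine ((hlsc x).le_liminf (η x)).trans ?_
          exact (liminf_le_liminf_of_le (hη x hx)).trans
            (liminf_le_liminf (Eventually.of_forall fun n => hρD n x))
      _ ≤ liminf (fun n => ∫⁻ x, ENNReal.ofReal (rr n x) ∂μ) atTop :=
          lintegral_liminf_le fun n => (hrm n).ennreal_ofReal
      _ ≤ ENNReal.ofReal v := by
          refine liminf_le_of_frequently_le' (Frequently.of_forall fun n => ?_)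
          rw [← ofReal_integral_eq_lintegral_ofReal (hrri n) (ae_of_all _ (hrr0 n))]
          exact ENNReal.ofReal_le_ofReal (hrint n)

end LimitKernel

/-- Structural properties of a weak transport cost. -/
structure CostData {X : Type*} [TopologicalSpace X] {d : ℕ} (p : ℝ)
    (C : X → Measure (Rd d) → ℝ≥0∞) (a : X → ℝ) (b : Rd d → ℝ) : Prop where
  one_le : 1 ≤ p
  lsc : LowerSemicontinuous fun q : X × Pp p d => C q.1 q.2.1
  conv : ∀ x : X, ∀ ρ₁ ρ₂ : Pp p d, ∀ t : ℝ≥0∞, t ≤ 1 →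
    C x (t • ρ₁.1 + (1 - t) • ρ₂.1) ≤ t * C x ρ₁.1 + (1 - t) * C x ρ₂.1
  mono : ∀ x : X, ∀ ρ₁ ρ₂ : Pp p d, ConvexOrder ρ₁.1 ρ₂.1 → C x ρ₂.1 ≤ C x ρ₁.1
  a_nonneg : ∀ x, 0 ≤ a x
  b_nonneg : ∀ y, 0 ≤ b y
  bound : ∀ x (ρ : Pp p d), C x ρ.1 ≤ ENNReal.ofReal (a x) + ∫⁻ y, ENNReal.ofReal (b y) ∂ρ.1

namespace CostData

variable {X : Type*} [TopologicalSpace X] {d : ℕ} {p : ℝ} {C : X → Measure (Rd d) → ℝ≥0∞}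
  {a : X → ℝ} {b : Rd d → ℝ}

theorem le_of_box (hD : CostData p C a b) (x : X) {R : ℕ} {ρ₁ ρ₂ : Measure (Rd d)}
    [h₁ : IsProbabilityMeasure ρ₁] [h₂ : IsProbabilityMeasure ρ₂] (hb₁ : ρ₁ (box d R)ᶜ = 0)
    (hb₂ : ρ₂ (box d R)ᶜ = 0)
    (h : ∀ f : Rd d → ℝ, ConvexOn ℝ univ f → ∫ y, f y ∂ρ₁ ≤ ∫ y, f y ∂ρ₂) : C x ρ₂ ≤ C x ρ₁ :=
  hD.mono x ⟨ρ₁, h₁, hasMomentP_of_box hD.one_le hb₁⟩ ⟨ρ₂, h₂, hasMomentP_of_box hD.one_le hb₂⟩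
    (convexOrder_of_box hb₁ hb₂ h)

theorem conv_ofReal (hD : CostData p C a b) (x : X) (ρ₁ ρ₂ : Pp p d) {s t : ℝ} (hs : 0 ≤ s)
    (ht : 0 ≤ t) (hst : s + t = 1) :
    C x (ENNReal.ofReal s • ρ₁.1 + ENNReal.ofReal t • ρ₂.1)
      ≤ ENNReal.ofReal s * C x ρ₁.1 + ENNReal.ofReal t * C x ρ₂.1 := by
  have e : ENNReal.ofReal t = 1 - ENNReal.ofReal s := by
    rw [← ENNReal.ofReal_one, ← ENNReal.ofReal_sub _ hs]; congr 1; linarith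
  rw [e]
  exact hD.conv x ρ₁ ρ₂ _ (ENNReal.ofReal_le_one.2 (by linarith))

variable {ι : Type*} [Fintype ι] (pt : ι → Rd d)

theorem dm_le (hD : CostData p C a b) (x : X) {w : ι → ℝ} (hw : w ∈ stdSimplex ℝ ι) :
    C x (dm pt w) ≤ ENNReal.ofReal (a x + ∑ i, b (pt i)) := by
  refine (hD.bound x ⟨dm pt w, isProbabilityMeasure_dm pt hw, hasMomentP_dm p pt w⟩).trans ?_
  rw [ENNReal.ofReal_add (hD.a_nonneg x) (Finset.sum_nonneg fun i _ => hD.b_nonneg _),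
    ENNReal.ofReal_sum_of_nonneg fun i _ => hD.b_nonneg _, lintegral_dm]
  gcongr
  calc _ ≤ 1 * ENNReal.ofReal (b (pt i)) := by
        gcongr
        exact ENNReal.ofReal_le_one.2 (mem_Icc_of_mem_stdSimplex hw i).2
    _ = _ := one_mul _

theorem dm_ne_top (hD : CostData p C a b) (x : X) {w : ι → ℝ} (hw : w ∈ stdSimplex ℝ ι) :
    C x (dm pt w) ≠ ⊤ := ne_top_of_le_ne_top ENNReal.ofReal_ne_top (hD.dm_le pt x hw)

theorem toReal_dm_le (hD : CostData p C a b) (x : X) {w : ι → ℝ} (hw : w ∈ stdSimplex ℝ ι) :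
    (C x (dm pt w)).toReal ≤ a x + ∑ i, b (pt i) :=
  ENNReal.toReal_le_of_le_ofReal
    (add_nonneg (hD.a_nonneg x) (Finset.sum_nonneg fun _ _ => hD.b_nonneg _)) (hD.dm_le pt x hw)

theorem convexOn_dm (hD : CostData p C a b) (x : X) :
    ConvexOn ℝ (stdSimplex ℝ ι) fun w => (C x (dm pt w)).toReal := by
  refine ⟨convex_stdSimplex ℝ ι, fun w hw w' hw' s t hs ht hst => ?_⟩
  simp only [smul_eq_mul]
  rw [dm_mix pt hw.1 hw'.1 hs ht]
  have h := hD.conv_ofReal x ⟨dm pt w, isProbabilityMeasure_dm pt hw, hasMomentP_dm p pt w⟩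
    ⟨dm pt w', isProbabilityMeasure_dm pt hw', hasMomentP_dm p pt w'⟩ hs ht hst
  have h1 := ENNReal.mul_ne_top (ENNReal.ofReal_ne_top (r := s)) (hD.dm_ne_top pt x hw)
  have h2 := ENNReal.mul_ne_top (ENNReal.ofReal_ne_top (r := t)) (hD.dm_ne_top pt x hw')
  refine (ENNReal.toReal_mono (ENNReal.add_ne_top.2 ⟨h1, h2⟩) h).trans_eq ?_
  rw [ENNReal.toReal_add h1 h2, ENNReal.toReal_mul, ENNReal.toReal_mul, ENNReal.toReal_ofReal hs,
    ENNReal.toReal_ofReal ht]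

theorem measurable_dm [SecondCountableTopology X] [MeasurableSpace X] [BorelSpace X]
    (hD : CostData p C a b)
    {w : X → ι → ℝ} (hw : Measurable w) (hwS : ∀ x, w x ∈ stdSimplex ℝ ι) :
    Measurable fun x => C x (dm pt (w x)) := by
  have h1 : LowerSemicontinuous fun q : X × stdSimplex ℝ ι => C q.1 (dm pt q.2) :=
    hD.lsc.comp (continuous_fst.prodMk ((continuous_dm p pt).comp continuous_snd))
  exact h1.measurable.comp (measurable_id.prodMk (hw.subtype_mk (h := hwS)))

theorem exists_convex_potential (hD : CostData p C a b) [Nonempty ι] {R : ℕ}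
    (hpt : ∀ i, pt i ∈ box d R) {ψ : ι → ℝ} {φ : X → ℝ}
    (h : ∀ x, ∀ w ∈ stdSimplex ℝ ι, φ x ≤ (C x (dm pt w)).toReal + ∑ i, ψ i * w i)
    {τ : Rd d → ι → ℝ}
    (hτ : ∀ y ∈ box d R, τ y ∈ stdSimplex ℝ ι ∧ ∑ i, τ y i • pt i = y) :
    ∃ E : Rd d → ℝ, Measurable E ∧ ConvexOn ℝ (box d R) E ∧ (∃ M, ∀ y ∈ box d R, |E y| ≤ M) ∧
      (∀ y ∈ box d R, E y ≤ ∑ i, ψ i * τ y i) ∧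
      ∀ x (ρ : Measure (Rd d)) [IsProbabilityMeasure ρ], ρ (box d R)ᶜ = 0 →
        ENNReal.ofReal (φ x - ∫ y, E y ∂ρ) ≤ C x ρ := by
  set M : ℝ := ∑ i, |ψ i| with hM
  have hψM : ∀ w ∈ stdSimplex ℝ ι, |∑ i, ψ i * w i| ≤ M := fun w hw => by
    refine (Finset.abs_sum_le_sum_abs _ _).trans (Finset.sum_le_sum fun i _ => ?_)
    rw [abs_mul, abs_of_nonneg (hw.1 i)]
    exact mul_le_of_le_one_right (abs_nonneg _) (mem_Icc_of_mem_stdSimplex hw i).2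
  let bc : (ι → ℝ) → Rd d := fun w => ∑ i, w i • pt i
  have hbcc : Continuous bc := by fun_prop
  have hbcb : ∀ w ∈ stdSimplex ℝ ι, bc w ∈ box d R := fun w hw =>
    (convex_box d R).sum_mem (fun i _ => hw.1 i) hw.2 fun i _ => hpt i
  have hbcl : ∀ (w w' : ι → ℝ) (s t : ℝ), bc (s • w + t • w') = s • bc w + t • bc w' :=
    fun w w' s t => by
      simp only [bc, Pi.add_apply, Pi.smul_apply, smul_eq_mul, add_smul, mul_smul,
        Finset.sum_add_distrib, Finset.smul_sum]
  obtain ⟨r, hr⟩ := exists_norm_le_of_mem_box d R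
  let g : ℕ → Rd d → (ι → ℝ) → ℝ := fun k y w => ∑ i, ψ i * w i + k * ‖bc w - y‖
  have hgconv : ∀ k (y z : Rd d) (w w' : ι → ℝ) (s t : ℝ), 0 ≤ s → 0 ≤ t →
      g k (s • y + t • z) (s • w + t • w') ≤ s * g k y w + t * g k z w' := by
    intro k y z w w' s t hs ht
    have h1 : ‖bc (s • w + t • w') - (s • y + t • z)‖ ≤ s * ‖bc w - y‖ + t * ‖bc w' - z‖ := by
      rw [hbcl, show s • bc w + t • bc w' - (s • y + t • z) = s • (bc w - y) + t • (bc w' - z) by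
        module]
      refine (norm_add_le _ _).trans_eq ?_
      rw [norm_smul, norm_smul, Real.norm_of_nonneg hs, Real.norm_of_nonneg ht]
    have h2 : ∑ i, ψ i * (s • w + t • w') i = s * ∑ i, ψ i * w i + t * ∑ i, ψ i * w' i := by
      simp only [Pi.add_apply, Pi.smul_apply, smul_eq_mul, Finset.mul_sum,
        ← Finset.sum_add_distrib]
      exact Finset.sum_congr rfl fun i _ => by ring
    simp only [g, h2]
    nlinarith [mul_le_mul_of_nonneg_left h1 (Nat.cast_nonneg (α := ℝ) k)]
  have hmin : ∀ k, ∃ φ : Rd d → ℝ, Measurable φ ∧ Integrable φ (Measure.dirac (0 : Rd d)) ∧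
      (∀ y, ∀ w ∈ stdSimplex ℝ ι, φ y ≤ g k y w) ∧
      ∀ ε > 0, ∃ w : Rd d → ι → ℝ, Measurable w ∧ (∀ y, w y ∈ stdSimplex ℝ ι) ∧
        ∀ y, g k y (w y) ≤ φ y + ε := by
    intro k
    refine exists_measurable_minimum_stdSimplex (A := fun y => M + k * (r + ‖y‖))
      (fun w _ => by fun_prop) (fun y => ⟨convex_stdSimplex ℝ ι, fun w _ w' _ s t hs ht hst => ?_⟩)
      (integrable_dirac (by simp)) fun y w hw => ?_
    · have := hgconv k y y w w' s t hs ht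
      rwa [← add_smul, hst, one_smul] at this
    · refine (abs_add_le _ _).trans (add_le_add (hψM w hw) ?_)
      rw [abs_of_nonneg (by positivity)]
      gcongr
      exact (norm_sub_le _ _).trans (add_le_add (hr _ (hbcb w hw)) le_rfl)
  choose e hem _ heg hes using hmin
  have heτ : ∀ k, ∀ y ∈ box d R, e k y ≤ ∑ i, ψ i * τ y i := fun k y hy => by
    have h1 := heg k y _ (hτ y hy).1
    have h2 : bc (τ y) = y := (hτ y hy).2
    simpa [g, h2] using h1
  have heM : ∀ k, ∀ y ∈ box d R, e k y ≤ M := fun k y hy =>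
    (heτ k y hy).trans (le_of_abs_le (hψM _ (hτ y hy).1))
  have heM' : ∀ k y, -M ≤ e k y := fun k y => by
    refine le_of_forall_pos_le_add fun ε hε => ?_
    obtain ⟨w, -, hw, hw'⟩ := hes k ε hε
    refine le_trans ?_ (hw' y)
    have := neg_le_of_abs_le (hψM _ (hw y))
    have h2 : (0 : ℝ) ≤ k * ‖bc (w y) - y‖ := by positivity
    simp only [g]; linarith
  have hbdd : ∀ y ∈ box d R, BddAbove (range fun k => e k y) := fun y hy =>
    ⟨M, by rintro _ ⟨k, rfl⟩; exact heM k y hy⟩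
  have heconv : ∀ k (y z : Rd d) (s t : ℝ), 0 ≤ s → 0 ≤ t → s + t = 1 →
      e k (s • y + t • z) ≤ s * e k y + t * e k z := by
    intro k y z s t hs ht hst
    refine le_of_forall_pos_le_add fun ε hε => ?_
    obtain ⟨w, -, hw, hw'⟩ := hes k ε hε
    have h1 := heg k (s • y + t • z) _ (convex_stdSimplex ℝ ι (hw y) (hw z) hs ht hst)
    have h2 := hgconv k y z (w y) (w z) s t hs ht
    have h3 := mul_le_mul_of_nonneg_left (hw' y) hs
    have h4 := mul_le_mul_of_nonneg_left (hw' z) ht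
    have h5 : s * ε + t * ε = ε := by rw [← add_mul, hst, one_mul]
    linarith
  let E : Rd d → ℝ := fun y => ⨆ k, e k y
  have hEm : Measurable E := Measurable.iSup hem
  have hEM : ∀ y ∈ box d R, |E y| ≤ M := fun y hy => abs_le.2
    ⟨(heM' 0 y).trans (le_ciSup (hbdd y hy) 0), ciSup_le fun k => heM k y hy⟩
  refine ⟨E, hEm, ⟨convex_box d R, fun y hy z hz s t hs ht hst => ?_⟩, ⟨M, hEM⟩,
    fun y hy => ciSup_le fun k => heτ k y hy, ?_⟩
  · refine ciSup_le fun k => (heconv k y z s t hs ht hst).trans ?_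
    have h1 := mul_le_mul_of_nonneg_left (le_ciSup (hbdd y hy) k) hs
    have h2 := mul_le_mul_of_nonneg_left (le_ciSup (hbdd z hz) k) ht
    simpa [E] using add_le_add h1 h2
  intro x ρ _ hρ
  have hbox : ∀ᵐ y ∂ρ, y ∈ box d R :=
    (measure_eq_zero_iff_ae_notMem.1 hρ).mono fun y hy => not_not.1 hy
  choose l hlm hlS hlg using fun k : ℕ => hes k (1 / ((k : ℝ) + 1)) (by positivity)
  have hli : ∀ k, Integrable (l k) ρ := fun k => by
    refine Integrable.of_bound (hlm k).aestronglyMeasurable 1 (ae_of_all _ fun y => ?_)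
    rw [pi_norm_le_iff_of_nonneg zero_le_one]
    intro i
    rw [Real.norm_eq_abs, abs_of_nonneg ((hlS k y).1 i)]
    exact (mem_Icc_of_mem_stdSimplex (hlS k y) i).2
  have hlii : ∀ k i, Integrable (fun y => l k y i) ρ := fun k i =>
    Integrable.eval (hli k) i
  let W : ℕ → ι → ℝ := fun k => ∫ y, l k y ∂ρ
  have hWi : ∀ k i, W k i = ∫ y, l k y i ∂ρ := fun k i =>
    eval_integral (fun i => hlii k i) i
  have hWsum : ∀ k (f : ι → ℝ), ∑ i, f i * W k i = ∫ y, ∑ i, f i * l k y i ∂ρ := fun k f => by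
    rw [integral_finsetSum _ fun i _ => (hlii k i).const_mul _]
    simp only [integral_const_mul, hWi]
  have hWS : ∀ k, W k ∈ stdSimplex ℝ ι := fun k =>
    (convex_stdSimplex ℝ ι).integral_mem (isClosed_stdSimplex ℝ ι) (ae_of_all _ (hlS k)) (hli k)
  obtain ⟨w, hw, s, hs, hsW⟩ := (isCompact_stdSimplex ℝ ι).tendsto_subseq hWS
  have hsum : ∀ f : ι → ℝ, Tendsto (fun k => ∑ i, f i * W (s k) i) atTop (𝓝 (∑ i, f i * w i)) :=
    fun f => tendsto_finsetSum _ fun i _ => ((tendsto_pi_nhds.1 hsW i).const_mul (f i))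
  have hbc : ∀ y ∈ box d R, Tendsto (fun k => bc (l k y)) atTop (𝓝 y) := fun y hy => by
    rw [tendsto_iff_norm_sub_tendsto_zero]
    refine squeeze_zero (fun _ => norm_nonneg _) (fun k => ?_)
      ((tendsto_one_div_add_atTop_nhds_zero_nat (𝕜 := ℝ)).const_mul (2 * M + 1 + 2 * r) |>.trans_eq
        (by rw [mul_zero]))
    have h1 := hlg k y
    have h2 := heM k y hy
    have h3 := neg_le_of_abs_le (hψM _ (hlS k y))
    have h4 : (k : ℝ) * ‖bc (l k y) - y‖ ≤ 2 * M + 1 / ((k : ℝ) + 1) := by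
      simp only [g] at h1; linarith
    have h5 : 1 / ((k : ℝ) + 1) ≤ 1 := by
      rw [div_le_one (by positivity)]; linarith [Nat.cast_nonneg (α := ℝ) k]
    have h6 : ‖bc (l k y) - y‖ ≤ r + r :=
      (norm_sub_le _ _).trans (add_le_add (hr _ (hbcb _ (hlS k y))) (hr y hy))
    rw [mul_one_div, le_div_iff₀ (by positivity)]
    nlinarith
  have hψE : ∑ i, ψ i * w i ≤ ∫ y, E y ∂ρ := by
    have hEi : Integrable E ρ :=
      Integrable.of_bound hEm.aestronglyMeasurable M (hbox.mono fun y hy => hEM y hy)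
    have h1 : ∀ k, ∑ i, ψ i * W k i ≤ ∫ y, E y ∂ρ + 1 / ((k : ℝ) + 1) := fun k => by
      have e1 : ∫ y, E y ∂ρ + 1 / ((k : ℝ) + 1) = ∫ y, (E y + 1 / ((k : ℝ) + 1)) ∂ρ := by
        rw [integral_add hEi (integrable_const _)]; simp
      rw [hWsum, e1]
      refine integral_mono_ae (integrable_finsetSum _ fun i _ => (hlii k i).const_mul _)
        (hEi.add (integrable_const _)) (hbox.mono fun y hy => ?_)
      have h2 := hlg k y
      have h3 : e k y ≤ E y := le_ciSup (hbdd y hy) k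
      have h4 : (0 : ℝ) ≤ k * ‖bc (l k y) - y‖ := by positivity
      simp only [g] at h2
      simp only
      linarith
    have h2 : Tendsto (fun k => ∫ y, E y ∂ρ + 1 / ((s k : ℝ) + 1)) atTop (𝓝 (∫ y, E y ∂ρ)) := by
      have := ((tendsto_one_div_add_atTop_nhds_zero_nat (𝕜 := ℝ)).comp hs.tendsto_atTop).const_add
        (∫ y, E y ∂ρ)
      simpa using this
    exact le_of_tendsto_of_tendsto' (hsum ψ) h2 fun k => h1 (s k)
  have hjensen : ∀ f : Rd d → ℝ, ConvexOn ℝ univ f → ∫ y, f y ∂ρ ≤ ∫ y, f y ∂(dm pt w) := by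
    intro f hf
    rw [integral_dm pt hw.1]
    obtain ⟨B, hB⟩ := (isCompact_box d R).exists_bound_of_continuousOn
      hf.continuous_univ.continuousOn
    have hfi : ∀ k, Integrable (fun y => f (bc (l k y))) ρ := fun k =>
      Integrable.of_bound
        ((hf.continuous_univ.comp hbcc).measurable.comp (hlm k)).aestronglyMeasurable
        B (ae_of_all _ fun y => hB _ (hbcb _ (hlS k y)))
    have h1 : Tendsto (fun k => ∫ y, f (bc (l k y)) ∂ρ) atTop (𝓝 (∫ y, f y ∂ρ)) :=
      tendsto_integral_of_dominated_convergence (fun _ => B) (fun k => (hfi k).1)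
        (integrable_const _) (fun k => ae_of_all _ fun y => hB _ (hbcb _ (hlS k y)))
        (hbox.mono fun y hy => (hf.continuous_univ.tendsto y).comp (hbc y hy))
    have h2 : Tendsto (fun k => ∑ i, W (s k) i * f (pt i)) atTop (𝓝 (∑ i, w i * f (pt i))) := by
      simpa only [mul_comm] using hsum fun i => f (pt i)
    refine le_of_tendsto_of_tendsto' (h1.comp hs.tendsto_atTop) h2 fun k => ?_
    simp only [Function.comp, fun i => mul_comm (W (s k) i) (f (pt i)), hWsum]
    refine integral_mono (hfi _) (integrable_finsetSum _ fun i _ => (hlii _ i).const_mul _)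
      fun y => ?_
    have := hf.map_sum_le (t := Finset.univ) (p := pt) (fun i _ => (hlS (s k) y).1 i)
      (hlS (s k) y).2 fun i _ => mem_univ _
    simpa only [smul_eq_mul, mul_comm] using this
  have hwp := isProbabilityMeasure_dm pt hw
  calc ENNReal.ofReal (φ x - ∫ y, E y ∂ρ) ≤ ENNReal.ofReal (C x (dm pt w)).toReal :=
        ENNReal.ofReal_le_ofReal (by linarith [h x w hw])
    _ = C x (dm pt w) := ENNReal.ofReal_toReal (hD.dm_ne_top pt x hw)
    _ ≤ C x ρ := hD.le_of_box x hρ (dm_apply_eq_zero pt w (measurableSet_box d R).compl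
        fun i hi => hi (hpt i)) hjensen

end CostData

theorem map_dm {α β ι : Type*} [MeasurableSpace α] [MeasurableSpace β] [Fintype ι] (pt : ι → α)
    (w : ι → ℝ) {f : α → β} (hf : Measurable f) : (dm pt w).map f = dm (f ∘ pt) w := by
  ext s hs
  rw [Measure.map_apply hf hs]
  simp [dm, Measure.finsetSum_apply, hf hs, hs, indicator]
  rfl

namespace CostData

variable {X : Type*} [TopologicalSpace X] {d : ℕ} {p : ℝ} {C : X → Measure (Rd d) → ℝ≥0∞}
  {a : X → ℝ} {b : Rd d → ℝ}

theorem exists_dual_box [SecondCountableTopology X] [MeasurableSpace X] [BorelSpace X]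
    (hD : CostData p C a b) {μ : Measure X} [IsProbabilityMeasure μ] (ha : Integrable a μ)
    {ν : Measure (Rd d)} [IsProbabilityMeasure ν] {R : ℕ} (hν : ν (box d R)ᶜ = 0) {v : ℝ}
    (hv : ∀ κ : ProbabilityTheory.Kernel X (Rd d), ProbabilityTheory.IsMarkovKernel κ →
      (∀ x, κ x (box d R)ᶜ = 0) → μ.bind κ = ν → ENNReal.ofReal v < ∫⁻ x, C x (κ x) ∂μ)
    {ε : ℝ} (hε : 0 < ε) :
    ∃ (φ : X → ℝ) (E : Rd d → ℝ), Measurable φ ∧ Integrable φ μ ∧ Measurable E ∧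
      ConvexOn ℝ (box d R) E ∧ (∃ M, ∀ y ∈ box d R, |E y| ≤ M) ∧
      (∀ x (ρ : Measure (Rd d)) [IsProbabilityMeasure ρ], ρ (box d R)ᶜ = 0 →
        ENNReal.ofReal (φ x - ∫ y, E y ∂ρ) ≤ C x ρ) ∧
      v - ε + ∫ y, E y ∂ν ≤ ∫ x, φ x ∂μ := by
  let K := ↥(box d R)
  have hKc : CompactSpace K := isCompact_iff_compactSpace.1 (isCompact_box d R)
  let val : C(K, Rd d) := ⟨Subtype.val, continuous_subtype_val⟩
  have hvalm : Measurable (Subtype.val : K → Rd d) := measurable_subtype_coe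
  let νK : Measure K := ν.comap Subtype.val
  have hνK : νK.map Subtype.val = ν := by
    rw [(MeasurableEmbedding.subtype_coe (measurableSet_box d R)).map_comap, Subtype.range_coe]
    exact Measure.restrict_eq_self_of_ae_mem
      ((measure_eq_zero_iff_ae_notMem.1 hν).mono fun y hy => not_not.1 hy)
  have hνKp : IsProbabilityMeasure νK := by
    refine ⟨?_⟩
    rw [← preimage_univ (f := (Subtype.val : K → Rd d)), ← Measure.map_apply hvalm .univ, hνK]
    exact measure_univ
  choose ι hF hN pt τ hτc hpt hτ using
    fun m : ℕ => exists_grid d R (ε := 1 / ((m : ℝ) + 1)) (by positivity)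
  let A : ℕ → X → ℝ := fun m x => a x + ∑ i, b (pt m i)
  have hA : ∀ m, Integrable (A m) μ := fun m => ha.add (integrable_const _)
  have hA0 : ∀ m, 0 ≤ ∫ x, A m x ∂μ := fun m => integral_nonneg fun x =>
    add_nonneg (hD.a_nonneg x) (Finset.sum_nonneg fun _ _ => hD.b_nonneg _)
  have hθ : ∀ m : ℕ, ∃ θ : ℝ, 0 < θ ∧ θ < 1 ∧ θ ≤ 1 / ((m : ℝ) + 1) ∧
      θ * ∫ x, A m x ∂μ ≤ ε / 2 := fun m => by
    have h1 := hA0 m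
    refine ⟨min (1 / ((m : ℝ) + 2)) (ε / 2 / (1 + ∫ x, A m x ∂μ)), by positivity, ?_, ?_, ?_⟩
    · refine (min_le_left _ _).trans_lt ?_
      rw [div_lt_one (by positivity)]; linarith [Nat.cast_nonneg (α := ℝ) m]
    · refine (min_le_left _ _).trans ?_
      gcongr; norm_num
    · refine (mul_le_mul_of_nonneg_right (min_le_right _ _) h1).trans ?_
      rw [div_mul_eq_mul_div, div_le_iff₀ (by positivity)]
      nlinarith
  choose θ hθ0 hθ1 hθm hθA using hθ
  let u : ∀ m, ι m → ℝ := fun m _ => (Fintype.card (ι m) : ℝ)⁻¹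
  have hupos : ∀ m i, 0 < u m i := fun m i => by
    have : 0 < Fintype.card (ι m) := Fintype.card_pos
    positivity
  have hu : ∀ m, u m ∈ stdSimplex ℝ (ι m) := fun m => by
    refine ⟨fun i => (hupos m i).le, ?_⟩
    simp [u]
  have hτi : ∀ m, Integrable (fun k : K => τ m k) νK := fun m => by
    refine Integrable.of_bound (C := 1) ((measurable_pi_iff.2 fun i =>
      (hτc m i).measurable).comp hvalm).aestronglyMeasurable (ae_of_all _ fun k => ?_)
    rw [pi_norm_le_iff_of_nonneg zero_le_one]
    intro i
    have h1 := (hτ m k k.2).1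
    rw [Real.norm_eq_abs, abs_of_nonneg (h1.1 i)]
    exact (mem_Icc_of_mem_stdSimplex h1 i).2
  have hτii : ∀ m i, Integrable (fun k : K => τ m k i) νK := fun m i => Integrable.eval (hτi m) i
  let η : ∀ m, ι m → ℝ := fun m => ∫ k : K, τ m k ∂νK
  have hη : ∀ m, η m ∈ stdSimplex ℝ (ι m) := fun m =>
    (convex_stdSimplex ℝ _).integral_mem (isClosed_stdSimplex ℝ _)
      (ae_of_all _ fun k : K => (hτ m k k.2).1) (hτi m)
  have hηsum : ∀ m (f : ι m → ℝ), ∑ i, f i * η m i = ∫ k : K, ∑ i, f i * τ m k i ∂νK := by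
    intro m f
    rw [integral_finsetSum _ fun i _ => (hτii m i).const_mul _]
    simp only [integral_const_mul]
    exact Finset.sum_congr rfl fun i _ => by rw [← eval_integral (fun i => hτii m i) i]
  let c : ∀ m, X → (ι m → ℝ) → ℝ := fun m x w => (C x (dm (pt m) w)).toReal
  by_cases hm : ∃ m, ∀ w : X → ι m → ℝ, Measurable w → (∀ x, w x ∈ stdSimplex ℝ (ι m)) →
      ∫ x, w x ∂μ = (1 - θ m) • η m + θ m • u m → v ≤ ∫ x, c m x (w x) ∂μ
  · obtain ⟨m, hm⟩ := hm
    obtain ⟨ψ, φ, hφm, hφi, hφ, hφv⟩ := exists_dual_stdSimplex_mix (c := c m)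
      (fun w hw hwS => (hD.measurable_dm (pt m) hw hwS).ennreal_toReal)
      (fun x => hD.convexOn_dm (pt m) x) (hA m) (fun x w _ => ENNReal.toReal_nonneg)
      (fun x w hw => hD.toReal_dm_le (pt m) x hw) (hη m) (hu m) (hupos m) (hθ0 m) (hθ1 m) hm
      (half_pos hε)
    obtain ⟨E, hEm, hEc, ⟨M, hM⟩, hEτ, hE⟩ := hD.exists_convex_potential (pt m) (hpt m) hφ
      (τ := τ m) fun y hy => ⟨(hτ m y hy).1, (hτ m y hy).2.1⟩
    refine ⟨φ, E, hφm, hφi, hEm, hEc, ⟨M, hM⟩, hE, ?_⟩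
    have h1 : ∫ y, E y ∂ν ≤ ∑ i, ψ i * η m i := by
      rw [← hνK, integral_map hvalm.aemeasurable hEm.aestronglyMeasurable, hηsum]
      refine integral_mono (Integrable.of_bound (hEm.comp hvalm).aestronglyMeasurable M
        (ae_of_all _ fun k => hM k k.2))
        (integrable_finsetSum _ fun i _ => (hτii m i).const_mul _) fun k => hEτ k k.2
    linarith [hθA m]
  · exfalso
    push Not at hm
    choose w hwm hwS hwi hwlt using hm
    let ptK : ∀ m, ι m → K := fun m i => ⟨pt m i, hpt m i⟩
    let κ : ℕ → X → ProbabilityMeasure K := fun m x =>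
      ⟨dm (ptK m) (w m x), isProbabilityMeasure_dm _ (hwS m x)⟩
    let D : X → ProbabilityMeasure K → ℝ≥0∞ := fun x ρ => C x (pushPp hD.one_le val ρ).1
    have hκint : ∀ m (f : C(K, ℝ)) x,
        ∫ k, f k ∂(κ m x : Measure K) = ∑ i, w m x i * f (ptK m i) := fun m f x =>
      integral_dm (ptK m) (hwS m x).1 f
    have hwii : ∀ m i, Integrable (fun x => w m x i) μ := fun m i => by
      refine Integrable.of_bound ((measurable_pi_apply i).comp (hwm m)).aestronglyMeasurable 1
        (ae_of_all _ fun x => ?_)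
      have := mem_Icc_of_mem_stdSimplex (hwS m x) i
      rw [Real.norm_eq_abs, abs_of_nonneg this.1]
      exact this.2
    have hlim : ∀ f : C(K, ℝ), Tendsto (fun n => ∫ x, ∫ k, f k ∂(κ n x : Measure K) ∂μ) atTop
        (𝓝 (∫ k, f k ∂νK)) := by
      intro f
      have hb : ∀ m (z : ι m → ℝ), z ∈ stdSimplex ℝ (ι m) →
          |∑ i, z i * f (ptK m i)| ≤ ‖f‖ := fun m z hz => by
        rw [← integral_dm (ptK m) hz.1]
        have := isProbabilityMeasure_dm (ptK m) hz
        exact abs_integral_continuousMap_le _ f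
      have e : ∀ m, ∫ x, ∫ k, f k ∂(κ m x : Measure K) ∂μ =
          (1 - θ m) * ∑ i, η m i * f (ptK m i) + θ m * ∑ i, u m i * f (ptK m i) := fun m => by
        simp only [hκint]
        rw [integral_finsetSum _ fun i _ => (hwii m i).mul_const _, Finset.mul_sum,
          Finset.mul_sum, ← Finset.sum_add_distrib]
        refine Finset.sum_congr rfl fun i _ => ?_
        rw [integral_mul_const, ← eval_integral (fun i => hwii m i) i, hwi m]
        simp only [Pi.add_apply, Pi.smul_apply, smul_eq_mul]
        ring
      rw [Metric.tendsto_atTop]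
      intro δ hδ
      obtain ⟨δ', hδ', hf⟩ := Metric.uniformContinuous_iff.1
        (CompactSpace.uniformContinuous_of_continuous f.continuous) (δ / 3) (by positivity)
      obtain ⟨N, hN⟩ := exists_nat_gt (max (1 / δ') (6 * ‖f‖ / δ))
      refine ⟨N, fun m hm => ?_⟩
      have hmN : (N : ℝ) ≤ m := by exact_mod_cast hm
      have hm1 : 1 / δ' < (m : ℝ) + 1 := by linarith [le_max_left (1 / δ') (6 * ‖f‖ / δ)]
      have hm2 : 6 * ‖f‖ / δ < (m : ℝ) + 1 := by linarith [le_max_right (1 / δ') (6 * ‖f‖ / δ)]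
      have h1 : |∑ i, η m i * f (ptK m i) - ∫ k, f k ∂νK| ≤ δ / 3 := by
        have e2 : ∑ i, η m i * f (ptK m i) = ∫ k : K, ∑ i, f (ptK m i) * τ m k i ∂νK := by
          rw [← hηsum m fun i => f (ptK m i)]
          exact Finset.sum_congr rfl fun i _ => mul_comm _ _
        rw [e2, ← integral_sub (integrable_finsetSum _ fun i _ => (hτii m i).const_mul _)
          (integrable_continuousMap νK f)]
        rw [← Real.norm_eq_abs, ← mul_one (δ / 3), ← probReal_univ (μ := νK)]
        refine norm_integral_le_of_norm_le_const (ae_of_all _ fun k => ?_)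
        obtain ⟨hS, -, hn⟩ := hτ m k k.2
        have e1 : f k = ∑ i, f k * τ m k i := by rw [← Finset.mul_sum, hS.2, mul_one]
        rw [Real.norm_eq_abs]
        rw [e1]
        rw [← Finset.sum_sub_distrib]
        calc _ ≤ ∑ i, |f (ptK m i) * τ m k i - f k * τ m k i| := Finset.abs_sum_le_sum_abs _ _
          _ ≤ ∑ i, δ / 3 * τ m k i := Finset.sum_le_sum fun i _ => by
            rw [← sub_mul, abs_mul, abs_of_nonneg (hS.1 i)]
            by_cases h0 : τ m k i = 0
            · simp [h0]
            · refine mul_le_mul_of_nonneg_right ?_ (hS.1 i)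
              refine (hf ?_).le
              have h2 : dist (ptK m i) k = ‖pt m i - k‖ := by
                rw [Subtype.dist_eq, dist_eq_norm]
              rw [h2]
              refine (hn i h0).trans_lt ?_
              rwa [one_div_lt (by positivity) hδ']
          _ = δ / 3 := by rw [← Finset.mul_sum, hS.2, mul_one]
      have h3 : θ m * (2 * ‖f‖) ≤ δ / 3 := by
        have h4 : θ m * (2 * ‖f‖) ≤ 1 / ((m : ℝ) + 1) * (2 * ‖f‖) := by gcongr; exact hθm m
        refine h4.trans ?_
        rw [div_lt_iff₀ hδ] at hm2
        rw [one_div_mul_eq_div, div_le_iff₀ (by positivity)]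
        nlinarith
      have h5 := abs_le.1 (hb m _ (hη m))
      have h6 := abs_le.1 (hb m _ (hu m))
      have h7 := abs_le.1 h1
      have h8 := hθ0 m
      rw [Real.dist_eq, e, abs_lt]
      constructor <;> nlinarith
    obtain ⟨κ', hκ'm, hκ'b, hκ'v⟩ := exists_kernel_of_tendsto (μ := μ) (D := D) (κ := κ)
      (r := fun m x => c m x (w m x)) (v := v) (ν := νK)
      (fun x => hD.lsc.comp (continuous_const.prodMk (continuous_pushPp hD.one_le val)))
      (fun x ρ₁ ρ₂ ρ s t hs ht hst h => by
        have h1 := hD.conv_ofReal x (pushPp hD.one_le val ρ₁) (pushPp hD.one_le val ρ₂) hs ht hst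
        have h2 : (pushPp hD.one_le val ρ).1 = ENNReal.ofReal s • (pushPp hD.one_le val ρ₁).1 +
            ENNReal.ofReal t • (pushPp hD.one_le val ρ₂).1 := by
          simp only [pushPp, h]
          rw [Measure.map_add _ _ val.continuous.measurable, Measure.map_smul, Measure.map_smul]
        simp only [D, h2]
        exact h1)
      (fun m f => by
        simp only [hκint]
        exact Finset.measurable_fun_sum _ fun i _ =>
          ((measurable_pi_apply i).comp (hwm m)).mul_const _)
      (fun m => (hD.measurable_dm (pt m) (hwm m) (hwS m)).ennreal_toReal)
      (fun m x => ENNReal.toReal_nonneg)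
      (fun m => (hA m).mono' (hD.measurable_dm (pt m) (hwm m)
        (hwS m)).ennreal_toReal.aestronglyMeasurable (ae_of_all _ fun x => by
          rw [Real.norm_of_nonneg ENNReal.toReal_nonneg]
          exact hD.toReal_dm_le (pt m) x (hwS m x)))
      (fun m x => by
        have e1 : (pushPp hD.one_le val (κ m x)).1 = dm (pt m) (w m x) :=
          map_dm (ptK m) (w m x) hvalm
        simp only [D, e1, c]
        rw [ENNReal.ofReal_toReal (hD.dm_ne_top (pt m) x (hwS m x))])
      (fun m => (hwlt m).le) hlim
    refine (hv ⟨fun x => ((κ' x : Measure K)).map Subtype.val,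
      (Measure.measurable_map _ hvalm).comp hκ'm⟩ ⟨fun x =>
        Measure.isProbabilityMeasure_map hvalm.aemeasurable⟩ (fun x => ?_) ?_).not_ge hκ'v
    · change ((κ' x : Measure K)).map Subtype.val (box d R)ᶜ = 0
      rw [Measure.map_apply hvalm (measurableSet_box d R).compl]
      refine measure_mono_null (t := ∅) (fun k hk => hk k.2) (measure_empty)
    · rw [← hνK, ← hκ'b]
      ext s hs
      rw [Measure.map_apply hvalm hs, Measure.bind_apply (hvalm hs) hκ'm.aemeasurable,
        Measure.bind_apply hs (ProbabilityTheory.Kernel.aemeasurable _)]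
      refine lintegral_congr fun x => ?_
      change ((κ' x : Measure K)).map Subtype.val s = _
      rw [Measure.map_apply hvalm hs]

end CostData

theorem primal_le_lintegral_kernel {X : Type*} [MeasurableSpace X] {d : ℕ} {μ : Measure X}
    [IsProbabilityMeasure μ] {ν : Measure (Rd d)} (C : X → Measure (Rd d) → ℝ≥0∞)
    (κ : ProbabilityTheory.Kernel X (Rd d)) [ProbabilityTheory.IsMarkovKernel κ]
    (h : μ.bind κ = ν) : primal μ ν C ≤ ∫⁻ x, C x (κ x) ∂μ := by
  have hπ : IsCoupling (μ.compProd κ) μ ν :=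
    ⟨inferInstance, Measure.fst_compProd μ κ, (Measure.snd_compProd μ κ).trans h⟩
  refine iInf_le_of_le ⟨_, hπ⟩ (lintegral_mono_ae ?_)
  have h1 : disint (μ.compProd κ) = (μ.compProd κ).condKernel :=
    dif_pos (inferInstanceAs (IsFiniteMeasure (μ.compProd κ)))
  simp only [h1]
  filter_upwards [ProbabilityTheory.condKernel_compProd μ κ] with x hx
  rw [hx]

namespace CostData

variable {X : Type*} [TopologicalSpace X] {d : ℕ} {p : ℝ} {C : X → Measure (Rd d) → ℝ≥0∞}
  {a : X → ℝ} {b : Rd d → ℝ}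

theorem primal_le_of_box [MeasurableSpace X] (hD : CostData p C a b) {μ : Measure X}
    [IsProbabilityMeasure μ] (ha : Integrable a μ) {ν : Measure (Rd d)} [IsProbabilityMeasure ν]
    (hνp : HasMomentP p ν) (hb : Integrable b ν) {R : ℕ} {q : ℝ} (hq : q = ν.real (box d R))
    (hq0 : 0 < q) (κ : ProbabilityTheory.Kernel X (Rd d)) [ProbabilityTheory.IsMarkovKernel κ]
    (hκ : ∀ x, κ x (box d R)ᶜ = 0)
    (hκν : μ.bind κ = (ENNReal.ofReal q)⁻¹ • ν.restrict (box d R)) :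
    primal μ ν C ≤ ENNReal.ofReal q * ∫⁻ x, C x (κ x) ∂μ +
      ENNReal.ofReal ((1 - q) * ∫ x, a x ∂μ + ∫ y in (box d R)ᶜ, b y ∂ν) := by
  have hQ := measurableSet_box d R
  have hq1 : q ≤ 1 := hq ▸ measureReal_le_one
  have hqQ : ENNReal.ofReal q = ν (box d R) := by rw [hq, ofReal_measureReal]
  have hqc : ENNReal.ofReal (1 - q) = ν (box d R)ᶜ := by
    rw [← ofReal_measureReal, probReal_compl_eq_one_sub hQ, hq]
  have hq0' : ENNReal.ofReal q ≠ 0 := by simpa using hq0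
  have hinv : ENNReal.ofReal q * (ENNReal.ofReal q)⁻¹ = 1 :=
    ENNReal.mul_inv_cancel hq0' ENNReal.ofReal_ne_top
  have hβ : ENNReal.ofReal (∫ y in (box d R)ᶜ, b y ∂ν) =
      ∫⁻ y in (box d R)ᶜ, ENNReal.ofReal (b y) ∂ν :=
    ofReal_integral_eq_lintegral_ofReal hb.integrableOn (ae_of_all _ hD.b_nonneg)
  let κ' : ProbabilityTheory.Kernel X (Rd d) :=
    ⟨fun x => ENNReal.ofReal q • κ x + ν.restrict (box d R)ᶜ,
      Measure.measurable_of_measurable_coe _ fun s hs => by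
        simp only [Measure.add_apply, Measure.smul_apply, smul_eq_mul]
        exact ((κ.measurable_coe hs).const_mul _).add_const _⟩
  have hκ' : ∀ x, κ' x = ENNReal.ofReal q • κ x + ν.restrict (box d R)ᶜ := fun x => rfl
  have hM : ProbabilityTheory.IsMarkovKernel κ' := ⟨fun x => ⟨by
    rw [hκ']
    simp only [Measure.add_apply, Measure.smul_apply, smul_eq_mul, measure_univ, mul_one,
      Measure.restrict_apply_univ]
    rw [hqQ, measure_add_measure_compl hQ, measure_univ]⟩⟩
  have hbind : μ.bind κ' = ν := by
    ext s hs
    rw [Measure.bind_apply hs (ProbabilityTheory.Kernel.aemeasurable _)]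
    simp only [hκ', Measure.add_apply, Measure.smul_apply, smul_eq_mul]
    rw [lintegral_add_right _ measurable_const, lintegral_const_mul _ (κ.measurable_coe hs),
      ← Measure.bind_apply hs (ProbabilityTheory.Kernel.aemeasurable _), hκν]
    simp only [Measure.smul_apply, smul_eq_mul, lintegral_const, measure_univ, mul_one]
    rw [← mul_assoc, hinv, one_mul, Measure.restrict_apply hs, Measure.restrict_apply hs,
      ← sdiff_eq, measure_inter_add_sdiff _ hQ]
  have hC : ∀ x, C x (κ' x) ≤ ENNReal.ofReal q * C x (κ x) +
      (ENNReal.ofReal (1 - q) * ENNReal.ofReal (a x) +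
        ENNReal.ofReal (∫ y in (box d R)ᶜ, b y ∂ν)) := by
    intro x
    let ρ₁ : Pp p d := ⟨κ x, inferInstance, hasMomentP_of_box hD.one_le (hκ x)⟩
    rcases hq1.lt_or_eq with h1 | h1
    · have h0 : ν (box d R)ᶜ ≠ 0 := by rw [← hqc]; simpa using h1
      have h0' : ν (box d R)ᶜ ≠ ⊤ := measure_ne_top _ _
      let ρ₂ : Pp p d := ⟨(ν (box d R)ᶜ)⁻¹ • ν.restrict (box d R)ᶜ, ⟨by
        rw [Measure.smul_apply, Measure.restrict_apply_univ, smul_eq_mul,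
          ENNReal.inv_mul_cancel h0 h0']⟩,
        (hνp.mono Measure.restrict_le_self).smul (ENNReal.inv_ne_top.2 h0)⟩
      have e : κ' x = ENNReal.ofReal q • ρ₁.1 + ENNReal.ofReal (1 - q) • ρ₂.1 := by
        rw [hκ', hqc, smul_smul, ENNReal.mul_inv_cancel h0 h0', one_smul]
      rw [e]
      refine (hD.conv_ofReal x ρ₁ ρ₂ hq0.le (by linarith) (by ring)).trans ?_
      gcongr
      refine (mul_le_mul_right (hD.bound x ρ₂) _).trans_eq ?_
      rw [mul_add, lintegral_smul_measure, smul_eq_mul, ← mul_assoc, hqc,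
        ENNReal.mul_inv_cancel h0 h0', one_mul, hβ]
    · have h0 : ν (box d R)ᶜ = 0 := by rw [← hqc, h1]; simp
      rw [hκ', Measure.restrict_eq_zero.2 h0, add_zero, h1, ENNReal.ofReal_one, one_smul, one_mul]
      exact le_self_add
  refine (primal_le_lintegral_kernel C κ' hbind).trans ((lintegral_mono hC).trans ?_)
  have hc : 0 ≤ ∫ y in (box d R)ᶜ, b y ∂ν := integral_nonneg fun y => hD.b_nonneg y
  rw [lintegral_add_right' _ (by have := ha.aemeasurable; fun_prop),
    lintegral_const_mul' _ _ ENNReal.ofReal_ne_top, lintegral_add_right _ measurable_const,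
    lintegral_const_mul' _ _ ENNReal.ofReal_ne_top, lintegral_const, measure_univ, mul_one,
    ENNReal.ofReal_add (mul_nonneg (by linarith) (integral_nonneg hD.a_nonneg)) hc,
    ENNReal.ofReal_mul (by linarith),
    ofReal_integral_eq_lintegral_ofReal ha (ae_of_all _ hD.a_nonneg)]

theorem exists_dual_restrict [SecondCountableTopology X] [MeasurableSpace X] [BorelSpace X]
    (hD : CostData p C a b) {μ : Measure X} [IsProbabilityMeasure μ] (ha : Integrable a μ)
    {ν : Measure (Rd d)} [IsProbabilityMeasure ν] (hνp : HasMomentP p ν) (hb : Integrable b ν)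
    {v : ℝ} (hv0 : 0 ≤ v) (hv : ENNReal.ofReal v ≤ primal μ ν C) (n : ℕ) {ε : ℝ} (hε : 0 < ε) :
    ∃ (φ : X → ℝ) (E : Rd d → ℝ), Measurable φ ∧ Integrable φ μ ∧ Measurable E ∧
      ConvexOn ℝ (box d n) E ∧ (∃ M, ∀ y ∈ box d n, |E y| ≤ M) ∧ (∀ x, φ x ≤ a x) ∧
      (∀ y ∈ box d n, -b y ≤ E y) ∧
      (∀ x (ρ : Measure (Rd d)) [IsProbabilityMeasure ρ], ρ (box d n)ᶜ = 0 →
        ENNReal.ofReal (φ x - ∫ y, E y ∂ρ) ≤ C x ρ) ∧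
      ∫ x, (a x - φ x) ∂μ + ∫ y in box d n, (E y + b y) ∂ν ≤
        ∫ x, a x ∂μ + ∫ y, b y ∂ν - v + ε := by
  set α := ∫ x, a x ∂μ with hα
  set β := ∫ y, b y ∂ν with hβ
  have hα0 : 0 ≤ α := integral_nonneg hD.a_nonneg
  have hβ0 : 0 ≤ β := integral_nonneg hD.b_nonneg
  have hu := iUnion_box d
  have hlim1 : Tendsto (fun R => ν.real (box d R)) atTop (𝓝 1) := by
    have h1 := tendsto_setIntegral_of_monotone (μ := ν) (measurableSet_box d) (box_mono (d := d))
      (f := fun _ => (1 : ℝ)) (integrable_const _).integrableOn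
    simpa [hu] using h1
  have hlim2 : Tendsto (fun R => ∫ y in box d R, b y ∂ν) atTop (𝓝 β) := by
    have h1 := tendsto_setIntegral_of_monotone (μ := ν) (measurableSet_box d) (box_mono (d := d))
      (f := b) hb.integrableOn
    simpa [hu] using h1
  have hlim3 : Tendsto (fun R => (1 - ν.real (box d R)) * (2 * (α + β))
      + 2 * (β - ∫ y in box d R, b y ∂ν)) atTop (𝓝 0) := by
    have := ((hlim1.const_sub 1).mul_const (2 * (α + β))).add ((hlim2.const_sub β).const_mul 2)
    simpa using this
  obtain ⟨R, hR1, hR2, hRn⟩ := ((hlim1.eventually_const_lt (show (1 / 2 : ℝ) < 1 by norm_num)).and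
    ((hlim3.eventually_lt_const (half_pos hε)).and (eventually_ge_atTop n))).exists
  set q := ν.real (box d R) with hq
  have hQ := measurableSet_box d R
  have hq0 : 0 < q := by linarith
  have hq1 : q ≤ 1 := measureReal_le_one
  set β' := ∫ y in box d R, b y ∂ν with hβ'
  have hβ'0 : 0 ≤ β' := integral_nonneg hD.b_nonneg
  have hβc : ∫ y in (box d R)ᶜ, b y ∂ν = β - β' := by
    rw [hβ, hβ', ← integral_add_compl hQ hb]; ring
  have hβc0 : 0 ≤ β - β' := hβc ▸ integral_nonneg hD.b_nonneg
  have hqQ : ENNReal.ofReal q = ν (box d R) := ofReal_measureReal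
  let ν' : Measure (Rd d) := (ENNReal.ofReal q)⁻¹ • ν.restrict (box d R)
  have hqne : ENNReal.ofReal q ≠ 0 := by simpa using hq0
  have hν' : IsProbabilityMeasure ν' := ⟨by
    simp only [ν', Measure.smul_apply, Measure.restrict_apply_univ, smul_eq_mul]
    rw [← hqQ, ENNReal.inv_mul_cancel hqne ENNReal.ofReal_ne_top]⟩
  have hν'b : ν' (box d R)ᶜ = 0 := by
    simp [ν', Measure.restrict_apply hQ.compl]
  have hν'int : ∀ f : Rd d → ℝ, ∫ y, f y ∂ν' = q⁻¹ * ∫ y in box d R, f y ∂ν := fun f => by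
    simp only [ν']
    rw [integral_smul_measure, ENNReal.toReal_inv, ENNReal.toReal_ofReal hq0.le, smul_eq_mul]
  let v₀ := (v - (1 - q) * α - (β - β')) / q - ε / 8
  have hdual : ∃ (φ : X → ℝ) (E : Rd d → ℝ), Measurable φ ∧ Integrable φ μ ∧ Measurable E ∧
      ConvexOn ℝ (box d R) E ∧ (∃ M, ∀ y ∈ box d R, |E y| ≤ M) ∧
      (∀ x (ρ : Measure (Rd d)) [IsProbabilityMeasure ρ], ρ (box d R)ᶜ = 0 →
        ENNReal.ofReal (φ x - ∫ y, E y ∂ρ) ≤ C x ρ) ∧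
      v₀ - ε / 8 + ∫ y, E y ∂ν' ≤ ∫ x, φ x ∂μ := by
    rcases lt_or_ge v₀ 0 with h0 | h0
    · refine ⟨fun _ => 0, fun _ => 0, measurable_const, integrable_zero _ _ _, measurable_const,
        convexOn_const _ (convex_box d R), ⟨0, by simp⟩, fun x ρ _ _ => by simp, ?_⟩
      simp only [integral_zero]
      linarith
    refine hD.exists_dual_box ha hν'b (fun κ hκ hκb hκν => ?_) (by positivity)
    by_contra hcon
    have h1 := hD.primal_le_of_box ha hνp hb hq hq0 κ hκb hκν
    have h2 : ENNReal.ofReal v ≤ ENNReal.ofReal (q * v₀ + ((1 - q) * α + (β - β'))) := by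
      refine hv.trans (h1.trans ?_)
      rw [hβc, ENNReal.ofReal_add (by positivity)
        (add_nonneg (mul_nonneg (by linarith) hα0) hβc0), ENNReal.ofReal_mul hq0.le]
      gcongr
      exact not_lt.1 hcon
    have h3 : q * v₀ + ((1 - q) * α + (β - β')) = v - q * (ε / 8) := by
      simp only [v₀]; field_simp; ring
    rw [h3] at h2
    have h4 : 0 < q * (ε / 8) := by positivity
    rcases le_or_gt v (v - q * (ε / 8)) with h5 | h5
    · linarith
    · have h6 : 0 ≤ v - q * (ε / 8) := by
        rw [← h3]; exact add_nonneg (by positivity) (add_nonneg (mul_nonneg (by linarith) hα0) hβc0)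
      exact absurd ((ENNReal.ofReal_le_ofReal_iff h6).1 h2) (not_le.2 h5)
  obtain ⟨φ, E, hφm, hφi, hEm, hEc, ⟨M, hM⟩, hdual, hval⟩ := hdual
  have hpt : ∀ x, ∀ y ∈ box d R, φ x - E y ≤ a x + b y := by
    intro x y hy
    have h1 := hdual x (Measure.dirac y) (by simp [hy])
    have h2 := hD.bound x ⟨Measure.dirac y, inferInstance, by
      unfold HasMomentP; rw [lintegral_dirac]; exact ENNReal.ofReal_ne_top⟩
    have h3 := h1.trans h2
    simp only [integral_dirac, lintegral_dirac] at h3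
    rw [← ENNReal.ofReal_add (hD.a_nonneg x) (hD.b_nonneg y)] at h3
    exact (ENNReal.ofReal_le_ofReal_iff (add_nonneg (hD.a_nonneg x) (hD.b_nonneg y))).1 h3
  have hne : Nonempty X := nonempty_of_isProbabilityMeasure μ
  set s := ⨆ x, (φ x - a x) with hs
  have hbd : BddAbove (range fun x => φ x - a x) := ⟨E 0 + b 0, by
    rintro _ ⟨x, rfl⟩
    have := hpt x 0 (zero_mem_box d R)
    simp only
    linarith⟩
  have hsφ : ∀ x, φ x - a x ≤ s := fun x => le_ciSup hbd x
  have hsE : ∀ y ∈ box d R, s ≤ E y + b y := fun y hy => ciSup_le fun x => by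
    linarith [hpt x y hy]
  have hEint : ∀ (ρ : Measure (Rd d)) [IsFiniteMeasure ρ], ρ (box d R)ᶜ = 0 → Integrable E ρ :=
    fun ρ _ hρ => Integrable.of_bound hEm.aestronglyMeasurable M
      ((measure_eq_zero_iff_ae_notMem.1 hρ).mono fun y hy => hM y (not_not.1 hy))
  have hsub := box_mono (d := d) hRn
  have hEQ : IntegrableOn E (box d R) ν := hEint _ (by simp [Measure.restrict_apply hQ.compl])
  refine ⟨fun x => φ x - s, fun y => E y - s, hφm.sub_const s, hφi.sub (integrable_const _),
    hEm.sub_const s, ?_, ⟨M + |s|, fun y hy => ?_⟩, fun x => by linarith [hsφ x],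
    fun y hy => by linarith [hsE y (hsub hy)], fun x ρ _ hρ => ?_, ?_⟩
  · exact (hEc.subset hsub (convex_box d n)).sub (concaveOn_const _ (convex_box d n))
  · exact (abs_sub _ _).trans (add_le_add (hM y (hsub hy)) le_rfl)
  · have hρ' : ρ (box d R)ᶜ = 0 := measure_mono_null (compl_subset_compl.2 hsub) hρ
    refine le_trans (le_of_eq ?_) (hdual x ρ hρ')
    rw [integral_sub (hEint ρ hρ') (integrable_const _)]
    simp
  · have h1 : ∫ x, (a x - (φ x - s)) ∂μ = α - ∫ x, φ x ∂μ + s := by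
      have hφs : Integrable (fun x => φ x - s) μ := hφi.sub (integrable_const _)
      rw [integral_sub ha hφs, integral_sub hφi (integrable_const _)]
      simp; ring
    have h2 : ∫ y in box d n, (E y - s + b y) ∂ν ≤ ∫ y in box d R, (E y - s + b y) ∂ν := by
      refine setIntegral_mono_set ((hEQ.sub (integrable_const _)).add hb.integrableOn)
        ((ae_restrict_iff' hQ).2 (ae_of_all _ fun y hy => ?_)) hsub.eventuallyLE
      have := hsE y hy
      simp only [Pi.zero_apply]
      linarith
    have h3 : ∫ y in box d R, (E y - s + b y) ∂ν = q * ∫ y, E y ∂ν' - s * q + β' := by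
      have hEs : IntegrableOn (fun y => E y - s) (box d R) ν := hEQ.sub (integrable_const _)
      rw [hν'int, ← mul_assoc, mul_inv_cancel₀ hq0.ne', one_mul,
        integral_add hEs hb.integrableOn,
        integral_sub hEQ (integrable_const _)]
      simp [hq]; ring
    have h4 : s - 2 * β ≤ ∫ y, E y ∂ν' := by
      have h5 : q⁻¹ * β' ≤ 2 * β := by
        rw [inv_mul_le_iff₀ hq0]; nlinarith
      have h6 : ∫ y, (s - b y) ∂ν' ≤ ∫ y, E y ∂ν' := by
        refine integral_mono_ae ((integrable_const _).sub ?_) (hEint ν' hν'b) ?_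
        · exact Integrable.smul_measure hb.integrableOn (ENNReal.inv_ne_top.2 hqne)
        · refine (measure_eq_zero_iff_ae_notMem.1 hν'b).mono fun y hy => ?_
          have := hsE y (not_not.1 hy)
          simp only
          linarith
      rw [integral_sub (integrable_const _)
        (Integrable.smul_measure hb.integrableOn (ENNReal.inv_ne_top.2 hqne)), hν'int b] at h6
      simp at h6
      linarith
    have h7 : v - (2 * (1 - q) * α + 2 * (β - β')) ≤ v₀ + ε / 8 := by
      simp only [v₀]
      rw [sub_add_cancel, le_div_iff₀ hq0]
      nlinarith [mul_nonneg hv0 (sub_nonneg.2 hq1), mul_nonneg (sub_nonneg.2 hq1) hα0]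
    rw [h1]
    refine (add_le_add_right (h2.trans_eq h3) _).trans ?_
    nlinarith
end CostData

/-- Pairs of functions that are dual admissible on the box of size `n` and whose dual defect is at
most `T`. -/
structure IsDualPair {X : Type*} [MeasurableSpace X] {d : ℕ} (C : X → Measure (Rd d) → ℝ≥0∞)
    (a : X → ℝ) (b : Rd d → ℝ) (μ : Measure X) (ν : Measure (Rd d)) (n : ℕ) (T : ℝ)
    (q : (X → ℝ) × (Rd d → ℝ)) : Prop where
  measurable_fst : Measurable q.1
  integrable_fst : Integrable q.1 μ
  measurable_snd : Measurable q.2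
  convexOn : ConvexOn ℝ (box d n) q.2
  bounded : ∃ M, ∀ y ∈ box d n, |q.2 y| ≤ M
  fst_le : ∀ x, q.1 x ≤ a x
  neg_le_snd : ∀ y ∈ box d n, -b y ≤ q.2 y
  le_cost : ∀ x (ρ : Measure (Rd d)) [IsProbabilityMeasure ρ], ρ (box d n)ᶜ = 0 →
    ENNReal.ofReal (q.1 x - ∫ y, q.2 y ∂ρ) ≤ C x ρ
  defect_le : ∫ x, (a x - q.1 x) ∂μ + ∫ y in box d n, (q.2 y + b y) ∂ν ≤ T

theorem integrable_of_bounded_box {d n : ℕ} {E : Rd d → ℝ} (hE : Measurable E) {M : ℝ}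
    (hM : ∀ y ∈ box d n, |E y| ≤ M) {ρ : Measure (Rd d)} [IsFiniteMeasure ρ]
    (hρ : ρ (box d n)ᶜ = 0) : Integrable E ρ :=
  Integrable.of_bound hE.aestronglyMeasurable M (by
    rw [ae_iff]
    refine measure_mono_null (fun y hy => ?_) hρ
    exact fun hyb => hy (hM y hyb))

namespace IsDualPair

variable {X : Type*} [MeasurableSpace X] {d : ℕ} {C : X → Measure (Rd d) → ℝ≥0∞}
  {a : X → ℝ} {b : Rd d → ℝ} {μ : Measure X} {ν : Measure (Rd d)} {m n : ℕ} {T T' : ℝ}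
  {q : (X → ℝ) × (Rd d → ℝ)}

theorem integrable (h : IsDualPair C a b μ ν n T q) {ρ : Measure (Rd d)} [IsFiniteMeasure ρ]
    (hρ : ρ (box d n)ᶜ = 0) : Integrable q.2 ρ :=
  integrable_of_bounded_box h.measurable_snd h.bounded.choose_spec hρ

theorem integrable_restrict [IsFiniteMeasure ν] (h : IsDualPair C a b μ ν n T q) :
    Integrable q.2 (ν.restrict (box d n)) :=
  h.integrable (by rw [Measure.restrict_apply (measurableSet_box d n).compl]; simp)

theorem mono [IsFiniteMeasure ν] (hb : Integrable b ν) (h : IsDualPair C a b μ ν n T q)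
    (hmn : m ≤ n) (hT : T ≤ T') : IsDualPair C a b μ ν m T' q := by
  have hbox := box_mono (d := d) hmn
  obtain ⟨M, hM⟩ := h.bounded
  refine ⟨h.1, h.2, h.3, h.convexOn.subset hbox (convex_box d m), ⟨M, fun y hy => hM y (hbox hy)⟩,
    h.fst_le, fun y hy => h.neg_le_snd y (hbox hy), fun x ρ _ hρ => ?_, ?_⟩
  · exact h.le_cost x ρ (measure_mono_null (compl_subset_compl.2 hbox) hρ)
  · refine le_trans ?_ (h.defect_le.trans hT)
    have hi : IntegrableOn (fun y => q.2 y + b y) (box d n) ν :=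
      h.integrable_restrict.add hb.restrict
    refine add_le_add_right (setIntegral_mono_set hi ?_ hbox.eventuallyLE) _
    · refine (ae_restrict_iff' (measurableSet_box d n)).2 (.of_forall fun y hy => ?_)
      have := h.neg_le_snd y hy
      simp only [Pi.zero_apply]
      linarith

theorem convex [IsFiniteMeasure ν] (ha : Integrable a μ) (hb : Integrable b ν) :
    Convex ℝ {q | IsDualPair C a b μ ν n T q} := by
  intro q hq q' hq' s t hs ht hst
  obtain ⟨M, hM⟩ := hq.bounded
  obtain ⟨M', hM'⟩ := hq'.bounded
  refine ⟨(hq.1.const_smul s).add (hq'.1.const_smul t), (hq.2.smul s).add (hq'.2.smul t),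
    (hq.3.const_smul s).add (hq'.3.const_smul t), (hq.convexOn.smul hs).add (hq'.convexOn.smul ht),
    ⟨s * M + t * M', fun y hy => ?_⟩, fun x => ?_, fun y hy => ?_, fun x ρ _ hρ => ?_, ?_⟩
  · simp only [Prod.snd_add, Prod.smul_snd, Pi.add_apply, Pi.smul_apply, smul_eq_mul]
    refine (abs_add_le _ _).trans ?_
    rw [abs_mul, abs_mul, abs_of_nonneg hs, abs_of_nonneg ht]
    gcongr
    exacts [hM y hy, hM' y hy]
  · simp only [Prod.fst_add, Prod.smul_fst, Pi.add_apply, Pi.smul_apply, smul_eq_mul]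
    calc _ ≤ s * a x + t * a x := by gcongr; exacts [hq.fst_le x, hq'.fst_le x]
      _ = _ := by rw [← add_mul, hst, one_mul]
  · simp only [Prod.snd_add, Prod.smul_snd, Pi.add_apply, Pi.smul_apply, smul_eq_mul]
    calc -b y = s * (-b y) + t * (-b y) := by rw [← add_mul, hst, one_mul]
      _ ≤ _ := by gcongr; exacts [hq.neg_le_snd y hy, hq'.neg_le_snd y hy]
  · simp only [Prod.fst_add, Prod.smul_fst, Prod.snd_add, Prod.smul_snd, Pi.add_apply,
      Pi.smul_apply, smul_eq_mul]
    rw [integral_add ((hq.integrable hρ).const_mul s) ((hq'.integrable hρ).const_mul t),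
      integral_const_mul, integral_const_mul]
    by_cases hc : C x ρ = ⊤
    · rw [hc]; exact le_top
    have h1 := hq.le_cost x ρ hρ
    have h2 := hq'.le_cost x ρ hρ
    rw [ENNReal.ofReal_le_iff_le_toReal hc] at h1 h2 ⊢
    calc _ = s * (q.1 x - ∫ y, q.2 y ∂ρ) + t * (q'.1 x - ∫ y, q'.2 y ∂ρ) := by ring
      _ ≤ s * (C x ρ).toReal + t * (C x ρ).toReal := by gcongr
      _ = _ := by rw [← add_mul, hst, one_mul]
  · have h1 := hq.defect_le
    have h2 := hq'.defect_le
    have ea : ∀ r r' A : ℝ, A - (s * r + t * r') = s * (A - r) + t * (A - r') := fun r r' A => by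
      linear_combination (-A) * hst
    have eb : ∀ r r' A : ℝ, (s * r + t * r') + A = s * (r + A) + t * (r' + A) := fun r r' A => by
      linear_combination (-A) * hst
    simp only [Prod.fst_add, Prod.smul_fst, Prod.snd_add, Prod.smul_snd, Pi.add_apply,
      Pi.smul_apply, smul_eq_mul, ea, eb]
    have i1 : Integrable (fun x => a x - q.1 x) μ := ha.sub hq.2
    have i2 : Integrable (fun x => a x - q'.1 x) μ := ha.sub hq'.2
    have i3 : Integrable (fun y => q.2 y + b y) (ν.restrict (box d n)) :=
      hq.integrable_restrict.add hb.restrict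
    have i4 : Integrable (fun y => q'.2 y + b y) (ν.restrict (box d n)) :=
      hq'.integrable_restrict.add hb.restrict
    rw [integral_add (i1.const_mul s) (i2.const_mul t), integral_add (i3.const_mul s)
      (i4.const_mul t)]
    simp only [integral_const_mul]
    calc _ = s * (∫ x, (a x - q.1 x) ∂μ + ∫ y in box d n, (q.2 y + b y) ∂ν) +
          t * (∫ x, (a x - q'.1 x) ∂μ + ∫ y in box d n, (q'.2 y + b y) ∂ν) := by ring
      _ ≤ s * T + t * T := by gcongr
      _ = T := by rw [← add_mul, hst, one_mul]

end IsDualPair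

theorem CostData.exists_dual_seq {X : Type*} [TopologicalSpace X] [SecondCountableTopology X]
    [MeasurableSpace X] [BorelSpace X] {d : ℕ} {p : ℝ} {C : X → Measure (Rd d) → ℝ≥0∞}
    {a : X → ℝ} {b : Rd d → ℝ} (hD : CostData p C a b) {μ : Measure X} [IsProbabilityMeasure μ]
    (ha : Integrable a μ) {ν : Measure (Rd d)} [IsProbabilityMeasure ν] (hνp : HasMomentP p ν)
    (hb : Integrable b ν) {v : ℝ} (hv0 : 0 ≤ v) (hv : ENNReal.ofReal v ≤ primal μ ν C) :
    ∃ (φ : ℕ → X → ℝ) (E : ℕ → Rd d → ℝ),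
      (∀ n : ℕ, IsDualPair C a b μ ν n (∫ x, a x ∂μ + ∫ y, b y ∂ν - v + 1 / ((n : ℝ) + 1))
        (φ n, E n)) ∧
      ∀ᵐ y ∂ν, ∃ r, Tendsto (fun n => Real.exp (-(E n y + b y) / 2)) atTop (𝓝 r) := by
  have hex (n : ℕ) : ∃ q : (X → ℝ) × (Rd d → ℝ), IsDualPair C a b μ ν n
      (∫ x, a x ∂μ + ∫ y, b y ∂ν - v + 1 / ((n : ℝ) + 1)) q := by
    obtain ⟨φ, E, h1, h2, h3, h4, h5, h6, h7, h8, h9⟩ :=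
      hD.exists_dual_restrict ha hνp hb hv0 hv n (Nat.one_div_pos_of_nat (α := ℝ) (n := n))
    exact ⟨(φ, E), h1, h2, h3, h4, h5, h6, h7, h8, h9⟩
  choose q hq using hex
  let f : ℕ → Rd d → ℝ := fun n => (box d n).indicator fun y => (q n).2 y + b y
  have hf (n : ℕ) : AEMeasurable (f n) ν :=
    ((hq n).measurable_snd.aemeasurable.add hb.aemeasurable).indicator (measurableSet_box d n)
  have hf0 (n : ℕ) (y : Rd d) : 0 ≤ f n y := by
    refine indicator_apply_nonneg fun hy => ?_
    have := (hq n).neg_le_snd y hy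
    linarith
  obtain ⟨l, hl, hlim⟩ := exists_tailWeights_tendsto_exp hf hf0
  let Q : ℕ → (X → ℝ) × (Rd d → ℝ) := fun n => Finsupp.linearCombination ℝ q (l n)
  refine ⟨fun n => (Q n).1, fun n => (Q n).2, fun n => ?_, ?_⟩
  · refine tailWeights_linearCombination_mem (hl n) (IsDualPair.convex ha hb) fun j hj => ?_
    exact (hq j).mono hb hj (by gcongr)
  · filter_upwards [hlim] with y hy
    obtain ⟨r, hr⟩ := hy
    refine ⟨r, hr.congr' ?_⟩
    obtain ⟨N, hN⟩ := exists_mem_box y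
    filter_upwards [eventually_ge_atTop N] with n hn
    have key : (Finsupp.linearCombination ℝ (fun j => (f j y, (q j).2 y)) (l n)) ∈
        {z : ℝ × ℝ | z.1 = z.2 + b y} := by
      refine tailWeights_linearCombination_mem (hl n) ?_ fun j hj => ?_
      · intro z hz z' hz' s t _ _ hst
        simp only [mem_ofPred_eq, Prod.fst_add, Prod.smul_fst, Prod.snd_add, Prod.smul_snd,
          smul_eq_mul] at hz hz' ⊢
        rw [hz, hz']
        linear_combination (b y) * hst
      · exact indicator_of_mem (box_mono (hn.trans hj) hN) fun y => (q j).2 y + b y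
    have e1 : (Finsupp.linearCombination ℝ (fun j => (f j y, (q j).2 y)) (l n)).1 =
        Finsupp.linearCombination ℝ f (l n) y := by
      have h1 := Finsupp.apply_linearCombination ℝ (LinearMap.fst ℝ ℝ ℝ)
        (fun j => (f j y, (q j).2 y)) (l n)
      have h2 := Finsupp.apply_linearCombination ℝ (LinearMap.proj (R := ℝ) (φ := fun _ => ℝ) y) f
        (l n)
      exact h1.trans h2.symm
    have e2 : (Finsupp.linearCombination ℝ (fun j => (f j y, (q j).2 y)) (l n)).2 =
        (Q n).2 y := by
      have h1 := Finsupp.apply_linearCombination ℝ (LinearMap.snd ℝ ℝ ℝ)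
        (fun j => (f j y, (q j).2 y)) (l n)
      have h2 := Finsupp.apply_linearCombination ℝ
        ((LinearMap.proj (R := ℝ) (φ := fun _ => ℝ) y) ∘ₗ (LinearMap.snd ℝ (X → ℝ) (Rd d → ℝ))) q
        (l n)
      exact h1.trans h2.symm
    have h3 : Finsupp.linearCombination ℝ f (l n) y = (Q n).2 y + b y := by
      rw [← e1, ← e2]; exact key
    rw [h3]

theorem eConvex_of_lt {d : ℕ} {ψ : Rd d → EReal} (hbot : ∀ y, ψ y ≠ ⊥)
    (h : ∀ y z : Rd d, ∀ r s t : ℝ, 0 ≤ t → t ≤ 1 → ψ y < r → ψ z < s →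
      ψ (t • y + (1 - t) • z) ≤ ((t * r + (1 - t) * s : ℝ) : EReal)) : EConvex ψ := by
  intro y z t ht0 ht1
  rcases eq_or_lt_of_le ht0 with rfl | ht0'
  · simp
  rcases eq_or_lt_of_le ht1 with rfl | ht1'
  · simp
  have ht1'' : 0 < 1 - t := by linarith
  have hnb (w : Rd d) {u : ℝ} (hu : 0 < u) : (u : EReal) * ψ w ≠ ⊥ := by
    induction hw : ψ w with
    | bot => exact absurd hw (hbot w)
    | coe r => exact_mod_cast EReal.coe_ne_bot (u * r)
    | top => rw [EReal.coe_mul_top_of_pos hu]; exact top_ne_bot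
  rcases eq_or_ne (ψ y) ⊤ with hy | hy
  · rw [hy, EReal.coe_mul_top_of_pos ht0', EReal.top_add_of_ne_bot (hnb z ht1'')]
    exact le_top
  rcases eq_or_ne (ψ z) ⊤ with hz | hz
  · rw [hz, EReal.coe_mul_top_of_pos ht1'', EReal.add_top_of_ne_bot (hnb y ht0')]
    exact le_top
  lift ψ y to ℝ using ⟨hy, hbot y⟩ with r hr
  lift ψ z to ℝ using ⟨hz, hbot z⟩ with s hs
  rw [← EReal.coe_mul, ← EReal.coe_mul, ← EReal.coe_add]
  refine EReal.le_of_forall_lt_iff_le.1 fun c hc => ?_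
  have hc' : t * r + (1 - t) * s < c := by exact_mod_cast hc
  set ε := c - (t * r + (1 - t) * s) with hε
  have hε0 : 0 < ε := by linarith
  refine (h y z (r + ε) (s + ε) t ht0 ht1 ?_ ?_).trans ?_
  · rw [← hr]; exact_mod_cast lt_add_of_pos_right r hε0
  · rw [← hs]; exact_mod_cast lt_add_of_pos_right s hε0
  · refine EReal.coe_le_coe_iff.2 (le_of_eq ?_)
    rw [hε]; ring

theorem eConvex_limsup {d : ℕ} {E : ℕ → Rd d → ℝ} (hE : ∀ n, ConvexOn ℝ (box d n) (E n))
    {b : Rd d → ℝ} (hb : ∀ n, ∀ y ∈ box d n, -b y ≤ E n y) :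
    (∀ y, ((-b y : ℝ) : EReal) ≤ limsup (fun n => (E n y : EReal)) atTop) ∧
      EConvex fun y => limsup (fun n => (E n y : EReal)) atTop := by
  have hev (y : Rd d) : ∀ᶠ n in atTop, y ∈ box d n := by
    obtain ⟨N, hN⟩ := exists_mem_box y
    filter_upwards [eventually_ge_atTop N] with n hn using box_mono hn hN
  have h1 (y : Rd d) : ((-b y : ℝ) : EReal) ≤ limsup (fun n => (E n y : EReal)) atTop := by
    refine le_limsup_of_frequently_le (Eventually.frequently ?_)
    filter_upwards [hev y] with n hn using EReal.coe_le_coe_iff.2 (hb n y hn)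
  refine ⟨h1, eConvex_of_lt (fun y => ?_) fun y z r s t ht0 ht1 hr hs => ?_⟩
  · exact (lt_of_lt_of_le (EReal.bot_lt_coe _) (h1 y)).ne'
  · refine limsup_le_of_le (by isBoundedDefault) ?_
    filter_upwards [hev y, hev z, eventually_lt_of_limsup_lt hr, eventually_lt_of_limsup_lt hs]
      with n hy hz hyr hzs
    have hyr' : E n y < r := by exact_mod_cast hyr
    have hzs' : E n z < s := by exact_mod_cast hzs
    have ht1' : 0 ≤ 1 - t := by linarith
    refine EReal.coe_le_coe_iff.2 (((hE n).2 hy hz ht0 ht1' (by ring)).trans ?_)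
    simp only [smul_eq_mul]
    gcongr

/-- The lower envelope of a subset of `ℝ^d × ℝ`, as an extended real valued function. -/
noncomputable def epiInf {d : ℕ} (S : Set (Rd d × ℝ)) (y : Rd d) : EReal :=
  ⨅ t : {t : ℝ // (y, t) ∈ S}, (t.1 : EReal)

section epiInf

variable {d : ℕ} {S S' : Set (Rd d × ℝ)}

theorem epiInf_le {y : Rd d} {t : ℝ} (h : (y, t) ∈ S) : epiInf S y ≤ t :=
  iInf_le (fun t : {t : ℝ // (y, t) ∈ S} => (t.1 : EReal)) ⟨t, h⟩

theorem epiInf_anti (h : S ⊆ S') (y : Rd d) : epiInf S' y ≤ epiInf S y :=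
  le_iInf fun t => epiInf_le (h t.2)

theorem exists_mem_of_epiInf_lt {y : Rd d} {c : EReal} (h : epiInf S y < c) :
    ∃ t : ℝ, (y, t) ∈ S ∧ (t : EReal) < c := by
  obtain ⟨t, ht⟩ := iInf_lt_iff.1 h
  exact ⟨t.1, t.2, ht⟩

theorem mem_of_epiInf_ne_top (hS : IsCompact S) {y : Rd d} (h : epiInf S y ≠ ⊤) :
    ∃ t : ℝ, (y, t) ∈ S ∧ epiInf S y = t := by
  obtain ⟨t₀, ht₀, -⟩ := exists_mem_of_epiInf_lt (lt_top_iff_ne_top.2 h)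
  have hc : IsCompact {t : ℝ | (y, t) ∈ S} := by
    have : {t : ℝ | (y, t) ∈ S} = Prod.snd '' (S ∩ Prod.fst ⁻¹' {y}) := by
      ext t
      constructor
      · intro h; exact ⟨(y, t), ⟨h, rfl⟩, rfl⟩
      · rintro ⟨⟨y', t'⟩, ⟨hz, rfl⟩, rfl⟩; exact hz
    rw [this]
    exact (hS.inter_right (isClosed_singleton.preimage continuous_fst)).image continuous_snd
  obtain ⟨t, ht, hmin⟩ := hc.exists_isLeast ⟨t₀, ht₀⟩
  exact ⟨t, ht, le_antisymm (epiInf_le ht) (le_iInf fun s => EReal.coe_le_coe_iff.2 (hmin s.2))⟩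

theorem measurable_epiInf (hS : IsCompact S) : Measurable (epiInf S) := by
  refine LowerSemicontinuous.measurable (lowerSemicontinuous_iff_isClosed_preimage.2 fun c => ?_)
  induction c with
  | bot =>
    have : epiInf S ⁻¹' Iic ⊥ = ∅ := by
      refine eq_empty_of_forall_notMem fun y hy => ?_
      have hy' : epiInf S y = ⊥ := le_bot_iff.1 hy
      obtain ⟨t, -, ht⟩ := mem_of_epiInf_ne_top hS (y := y) (by rw [hy']; exact bot_ne_top)
      exact EReal.coe_ne_bot t (ht.symm.trans hy')
    rw [this]; exact isClosed_empty
  | coe r =>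
    have : epiInf S ⁻¹' Iic (r : EReal) = Prod.fst '' (S ∩ Prod.snd ⁻¹' Iic r) := by
      ext y
      constructor
      · intro hy
        have hy' : epiInf S y ≤ r := hy
        obtain ⟨t, ht, he⟩ := mem_of_epiInf_ne_top hS (y := y)
          (ne_top_of_le_ne_top (EReal.coe_ne_top r) hy')
        exact ⟨(y, t), ⟨ht, by rw [he] at hy'; exact_mod_cast hy'⟩, rfl⟩
      · rintro ⟨⟨y', t⟩, ⟨h, ht⟩, rfl⟩
        exact (epiInf_le h).trans (EReal.coe_le_coe_iff.2 ht)
    rw [this]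
    exact ((hS.inter_right (isClosed_Iic.preimage continuous_snd)).image continuous_fst).isClosed
  | top => simp

/-- The pointwise infimum of the lower envelopes of a sequence of sets. -/
noncomputable def epiLim (H : ℕ → Set (Rd d × ℝ)) (y : Rd d) : EReal := ⨅ m, epiInf (H m) y

theorem measurable_epiLim {H : ℕ → Set (Rd d × ℝ)} (hH : ∀ m, IsCompact (H m)) :
    Measurable (epiLim H) := .iInf fun m => measurable_epiInf (hH m)

theorem epiLim_le {H : ℕ → Set (Rd d × ℝ)} {m : ℕ} {z : Rd d × ℝ} (h : z ∈ H m) :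
    epiLim H z.1 ≤ z.2 := (iInf_le _ m).trans (epiInf_le h)

end epiInf

/-- Replace a convex function by the lower envelope of an increasing sequence of compact convex
subsets of its epigraph. -/
theorem exists_compact_epi {d : ℕ} (ν : Measure (Rd d)) [IsFiniteMeasure ν] {ψ : Rd d → EReal}
    (hψ : Measurable ψ) (hconv : EConvex ψ) (hbot : ∀ y, ψ y ≠ ⊥) (htop : ∀ᵐ y ∂ν, ψ y ≠ ⊤) :
    ∃ H : ℕ → Set (Rd d × ℝ), (∀ m, IsCompact (H m)) ∧ Monotone H ∧ (∀ m, Convex ℝ (H m)) ∧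
      (∀ m, ∀ z ∈ H m, ψ z.1 ≤ z.2) ∧ ∀ᵐ y ∂ν, epiLim H y = ψ y := by
  let G : Set (Rd d × ℝ) := {z | ψ z.1 = (z.2 : EReal)}
  have hG : MeasurableSet G :=
    measurableSet_eq_fun (hψ.comp measurable_fst) (measurable_coe_real_ereal.comp measurable_snd)
  have hmg : Measurable fun y : Rd d => (y, (ψ y).toReal) :=
    measurable_id.prodMk (measurable_ereal_toReal.comp hψ)
  let γ : Measure (Rd d × ℝ) := ν.map fun y => (y, (ψ y).toReal)
  have hγG : γ Gᶜ = 0 := by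
    rw [Measure.map_apply hmg hG.compl]
    refine measure_mono_null (fun y hy => ?_) (ae_iff.1 htop)
    intro hy'
    exact hy (EReal.coe_toReal hy' (hbot y)).symm
  have hex (m : ℕ) : ∃ K ⊆ G, IsCompact K ∧ γ G < γ K + ((m : ℝ≥0∞) + 1)⁻¹ :=
    hG.exists_isCompact_lt_add (measure_ne_top _ _) (by simp)
  choose K hKG hK hγK using hex
  let Γ : ℕ → Set (Rd d × ℝ) := Set.accumulate K
  have hΓ (m : ℕ) : IsCompact (Γ m) := isCompact_accumulate hK m
  have hepi : Convex ℝ {z : Rd d × ℝ | ψ z.1 ≤ (z.2 : EReal)} := by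
    intro z hz w hw s t hs ht hst
    have ht' : t = 1 - s := by linarith
    have hle := hconv z.1 w.1 s hs (by linarith)
    subst ht'
    refine hle.trans ?_
    have hz' : ψ z.1 ≤ z.2 := hz
    have hw' : ψ w.1 ≤ w.2 := hw
    have : ((s • z + (1 - s) • w).2 : EReal) = (s : EReal) * z.2 + ((1 - s : ℝ) : EReal) * w.2 := by
      simp [EReal.coe_add, EReal.coe_mul]
    rw [this]
    exact add_le_add (mul_le_mul_of_nonneg_left hz' (EReal.coe_nonneg.2 hs))
      (mul_le_mul_of_nonneg_left hw' (EReal.coe_nonneg.2 ht))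
  have hsub (m : ℕ) : convexHull ℝ (Γ m) ⊆ {z : Rd d × ℝ | ψ z.1 ≤ (z.2 : EReal)} := by
    refine convexHull_min (fun z hz => ?_) hepi
    obtain ⟨i, -, hi⟩ := Set.mem_accumulate.1 hz
    exact (hKG i hi).le
  have hfull : γ (⋃ m, K m)ᶜ = 0 := by
    have hm : MeasurableSet (⋃ m, K m) := .iUnion fun m => (hK m).measurableSet
    have hle : γ G ≤ γ (⋃ m, K m) := by
      refine ENNReal.le_of_forall_pos_le_add fun ε hε _ => ?_
      obtain ⟨m, hm⟩ := ENNReal.exists_inv_nat_lt (a := (ε : ℝ≥0∞)) (by simpa using hε.ne')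
      refine (hγK m).le.trans (add_le_add (measure_mono (subset_iUnion K m)) ?_)
      exact (ENNReal.inv_le_inv.2 le_self_add).trans hm.le
    have hu : γ univ ≤ γ (⋃ m, K m) := by
      rw [← measure_add_measure_compl hG, hγG, add_zero]; exact hle
    rw [measure_compl hm (measure_ne_top _ _)]
    exact tsub_eq_zero_of_le hu
  refine ⟨fun m => convexHull ℝ (Γ m), fun m => (hΓ m).convexHull_finrank, fun m n hmn =>
    convexHull_mono (Set.monotone_accumulate hmn), fun m => convex_convexHull ℝ _,
    fun m z hz => hsub m hz, ?_⟩
  have hfull' : ∀ᵐ y ∂ν, (y, (ψ y).toReal) ∈ ⋃ m, K m := by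
    have hm : MeasurableSet (⋃ m, K m) := .iUnion fun m => (hK m).measurableSet
    rw [Measure.map_apply hmg hm.compl] at hfull
    exact hfull
  filter_upwards [hfull'] with y hy
  refine le_antisymm ?_ (le_iInf fun m => le_iInf fun t => hsub m t.2)
  obtain ⟨m, hm⟩ := mem_iUnion.1 hy
  refine (iInf_le _ m).trans ((epiInf_le (subset_convexHull ℝ _
    (Set.mem_accumulate.2 ⟨m, le_rfl, hm⟩))).trans (hKG m hm).ge)

theorem eConvex_epiLim {d : ℕ} {H : ℕ → Set (Rd d × ℝ)} (hmono : Monotone H)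
    (hconv : ∀ m, Convex ℝ (H m)) (hbot : ∀ y, epiLim H y ≠ ⊥) :
    EConvex fun y => epiLim H y := by
  refine eConvex_of_lt hbot fun y z r s t ht0 ht1 hr hs => ?_
  obtain ⟨m, hm⟩ := iInf_lt_iff.1 hr
  obtain ⟨n, hn⟩ := iInf_lt_iff.1 hs
  obtain ⟨r', hr', hrr⟩ := exists_mem_of_epiInf_lt hm
  obtain ⟨s', hs', hss⟩ := exists_mem_of_epiInf_lt hn
  have hrr' : r' < r := by exact_mod_cast hrr
  have hss' : s' < s := by exact_mod_cast hss
  have ht1' : 0 ≤ 1 - t := by linarith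
  have hmem := hconv (max m n) (hmono (le_max_left m n) hr') (hmono (le_max_right m n) hs') ht0
    ht1' (by ring)
  refine (iInf_le _ (max m n)).trans ((epiInf_le (t := t * r' + (1 - t) * s') hmem).trans ?_)
  refine EReal.coe_le_coe_iff.2 ?_
  gcongr

open ProbabilityTheory

section Conditioning

variable {α : Type*} [MeasurableSpace α] {ρ : Measure α} {Y : ℕ → Set α}

theorem integral_cond_eq (ρ : Measure α) (A : Set α) (f : α → ℝ) :
    ∫ y, f y ∂ρ[|A] = (ρ A).toReal⁻¹ * ∫ y in A, f y ∂ρ := by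
  rw [ProbabilityTheory.cond, integral_smul_measure, ENNReal.toReal_inv, smul_eq_mul]

theorem tendsto_toReal_measure_of_iUnion [IsProbabilityMeasure ρ] (hmono : Monotone Y)
    (hU : ⋃ k, Y k = univ) : Tendsto (fun k => (ρ (Y k)).toReal) atTop (𝓝 1) := by
  have h := tendsto_measure_iUnion_atTop (μ := ρ) hmono
  rw [hU, measure_univ] at h
  exact (ENNReal.tendsto_toReal ENNReal.one_ne_top).comp h

theorem eventually_measure_ne_zero [IsProbabilityMeasure ρ] (hmono : Monotone Y)
    (hU : ⋃ k, Y k = univ) : ∀ᶠ k in atTop, ρ (Y k) ≠ 0 := by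
  filter_upwards [(tendsto_toReal_measure_of_iUnion (ρ := ρ) hmono hU).eventually_ne one_ne_zero]
    with k hk h
  exact hk (by rw [h, ENNReal.toReal_zero])

theorem tendsto_inv_mul_of_iUnion [IsProbabilityMeasure ρ] (hmono : Monotone Y)
    (hU : ⋃ k, Y k = univ) {s : ℕ → ℝ} {c : ℝ} (hs : Tendsto s atTop (𝓝 c)) :
    Tendsto (fun k => (ρ (Y k)).toReal⁻¹ * s k) atTop (𝓝 c) := by
  simpa using ((tendsto_toReal_measure_of_iUnion (ρ := ρ) hmono hU).inv₀ one_ne_zero).mul hs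

theorem tendsto_integral_cond [IsProbabilityMeasure ρ] (hY : ∀ k, MeasurableSet (Y k))
    (hmono : Monotone Y) (hU : ⋃ k, Y k = univ) {f : α → ℝ} (hf : Integrable f ρ) :
    Tendsto (fun k => ∫ y, f y ∂ρ[|Y k]) atTop (𝓝 (∫ y, f y ∂ρ)) := by
  simp only [integral_cond_eq]
  refine tendsto_inv_mul_of_iUnion hmono hU ?_
  have h := tendsto_setIntegral_of_monotone hY hmono hf.integrableOn
  rwa [hU, setIntegral_univ] at h

theorem integrable_cond [IsFiniteMeasure ρ] {A : Set α} (hA : ρ A ≠ 0) {f : α → ℝ}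
    (hf : IntegrableOn f A ρ) : Integrable f ρ[|A] :=
  hf.smul_measure (ENNReal.inv_ne_top.2 hA)

theorem CondC.ofReal_le {X : Type*} [MeasurableSpace X] {d : ℕ} {p : ℝ}
    {C : X → Measure (Rd d) → ℝ≥0∞} (hC : CondC p C) (x : X) (ρ : Pp p d)
    {Y : ℕ → Set (Rd d)} (hY : ∀ k, MeasurableSet (Y k)) (hmono : Monotone Y)
    (hU : ⋃ k, Y k = univ) {r c : ℝ} {s : ℕ → ℝ} (hs : Tendsto s atTop (𝓝 c))
    (h : ∀ᶠ k in atTop, ENNReal.ofReal (r - s k) ≤ C x (ρ.1[|Y k])) :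
    ENNReal.ofReal (r - c) ≤ C x ρ.1 := by
  have h1 : Tendsto (fun k => ENNReal.ofReal (r - s k)) atTop (𝓝 (ENNReal.ofReal (r - c))) :=
    ENNReal.tendsto_ofReal (hs.const_sub r)
  rw [← h1.limsup_eq]
  exact (limsup_le_limsup h).trans (hC x ρ Y hY hmono hU)

end Conditioning

/-- A version of the reverse Fatou lemma. -/
theorem le_integral_of_frequently_le {α : Type*} [MeasurableSpace α] {ρ : Measure α}
    [IsFiniteMeasure ρ] {f : ℕ → α → ℝ} {F : α → ℝ} {c M : ℝ} (hF : Integrable F ρ)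
    (hf : ∀ᶠ n in atTop, Integrable (f n) ρ) (hM : ∀ᶠ n in atTop, ∀ᵐ y ∂ρ, f n y ≤ M)
    (hlim : ∀ᵐ y ∂ρ, ∀ ε > 0, ∀ᶠ n in atTop, f n y ≤ F y + ε)
    (hc : ∃ᶠ n in atTop, c ≤ ∫ y, f n y ∂ρ) : c ≤ ∫ y, F y ∂ρ := by
  have h1 : Tendsto (fun n => ∫ y, max (f n y) (F y) ∂ρ) atTop (𝓝 (∫ y, F y ∂ρ)) := by
    refine tendsto_integral_filter_of_dominated_convergence (fun y => |M| + |F y|)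
      (hf.mono fun n hn => (hn.sup hF).aestronglyMeasurable) ?_ ((integrable_const _).add hF.abs) ?_
    · filter_upwards [hM] with n hn
      filter_upwards [hn] with y hy
      rw [Real.norm_eq_abs, abs_le]
      have := neg_abs_le (F y)
      have := le_abs_self (F y)
      have := le_abs_self M
      have := abs_nonneg M
      have := abs_nonneg (F y)
      exact ⟨by linarith [le_max_right (f n y) (F y)], max_le (by linarith) (by linarith)⟩
    · filter_upwards [hlim] with y hy
      rw [tendsto_order]
      refine ⟨fun u hu => .of_forall fun n => hu.trans_le (le_max_right _ _), fun u hu => ?_⟩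
      filter_upwards [hy ((u - F y) / 2) (by linarith)] with n hn
      exact max_lt (by linarith) hu
  refine ge_of_tendsto_of_frequently h1 ((hc.and_eventually hf).mono fun n hn => ?_)
  exact hn.1.trans (integral_mono hn.2 (hn.2.sup hF) fun y => le_max_left _ _)

theorem coe_le_conjL1_iff {X : Type*} [MeasurableSpace X] {d : ℕ} {p : ℝ}
    {C : X → Measure (Rd d) → ℝ≥0∞} {ψ : Rd d → EReal} {x : X} {r : ℝ} :
    (r : EReal) ≤ conjL1 p C ψ x ↔ ∀ ρ : Pp p d, MemL1 ρ.1 ψ →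
      ENNReal.ofReal (r - ∫ y, (ψ y).toReal ∂ρ.1) ≤ C x ρ.1 := by
  unfold conjL1
  rw [le_iInf_iff, Subtype.forall]
  refine forall₂_congr fun ρ hρ => ?_
  rw [hρ.eInt_eq]
  rcases eq_or_ne (C x ρ.1) ⊤ with hc | hc
  · simp [hc]
  · rw [coe_ennreal_eq_coe_toReal hc, ENNReal.ofReal_le_iff_le_toReal hc, ← EReal.coe_add,
      EReal.coe_le_coe_iff, sub_le_iff_le_add']

section Compact

variable {X : Type*} [MeasurableSpace X] {d : ℕ} {p : ℝ} {C : X → Measure (Rd d) → ℝ≥0∞}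
  {H : ℕ → Set (Rd d × ℝ)} {x : X} {r : ℝ}

theorem map_fst_cond {α β : Type*} [MeasurableSpace α] [MeasurableSpace β] (γ : Measure (α × β))
    {A : Set α} (hA : MeasurableSet A) :
    (γ.map Prod.fst)[|A] = (γ[|Prod.fst ⁻¹' A]).map Prod.fst := by
  unfold ProbabilityTheory.cond
  rw [Measure.map_smul, Measure.restrict_map measurable_fst hA, Measure.map_apply measurable_fst hA]

theorem ofReal_sub_le_of_compact (hp : 1 ≤ p) (hC : CondC p C) (hH : ∀ m, IsCompact (H m))
    (hbot : ∀ y, epiLim H y ≠ ⊥)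
    (h : ∀ ρ : Pp p d, MemL1 ρ.1 (epiLim H) →
      ENNReal.ofReal (r - ∫ y, (epiLim H y).toReal ∂ρ.1) ≤ C x ρ.1)
    (m : ℕ) (γ : Measure (Rd d × ℝ)) [IsProbabilityMeasure γ] (hγ : ∀ᵐ z ∂γ, z ∈ H m) :
    ENNReal.ofReal (r - ∫ z, z.2 ∂γ) ≤ C x (γ.map Prod.fst) := by
  obtain ⟨T, hT⟩ := (hH m).isBounded.exists_norm_le
  have hmψ : Measurable (epiLim H) := measurable_epiLim hH
  have hp1 (γ' : Measure (Rd d × ℝ)) [IsProbabilityMeasure γ'] (hγ' : ∀ᵐ z ∂γ', z ∈ H m) :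
      HasMomentP p (γ'.map Prod.fst) := by
    refine hasMomentP_of_ae_le hp (r := T) ?_
    rw [ae_map_iff measurable_fst.aemeasurable (measurableSet_le (by fun_prop) (by fun_prop))]
    filter_upwards [hγ'] with z hz using (norm_fst_le z).trans (hT z hz)
  have hi (γ' : Measure (Rd d × ℝ)) [IsProbabilityMeasure γ'] (hγ' : ∀ᵐ z ∂γ', z ∈ H m) :
      Integrable (fun z : Rd d × ℝ => z.2) γ' := by
    refine Integrable.of_bound measurable_snd.aestronglyMeasurable T ?_
    filter_upwards [hγ'] with z hz using (norm_snd_le z).trans (hT z hz)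
  let Y : ℕ → Set (Rd d) := fun k => {y | ((-k : ℝ) : EReal) ≤ epiLim H y}
  have hY (k : ℕ) : MeasurableSet (Y k) := measurableSet_le measurable_const hmψ
  have hYm : Monotone Y := fun k l hkl y hy =>
    (EReal.coe_le_coe_iff.2 (neg_le_neg (Nat.cast_le.2 hkl))).trans hy
  have hYU : ⋃ k, Y k = univ := by
    refine eq_univ_of_forall fun y => mem_iUnion.2 ?_
    obtain ⟨c, hc⟩ := EReal.lt_iff_exists_real_btwn.1 (bot_lt_iff_ne_bot.2 (hbot y))
    obtain ⟨k, hk⟩ := exists_nat_ge (-c)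
    exact ⟨k, (EReal.coe_le_coe_iff.2 (by linarith)).trans hc.2.le⟩
  let Z : ℕ → Set (Rd d × ℝ) := fun k => Prod.fst ⁻¹' Y k
  have hZ (k : ℕ) : MeasurableSet (Z k) := measurable_fst (hY k)
  have hZm : Monotone Z := fun k l hkl => preimage_mono (hYm hkl)
  have hZU : ⋃ k, Z k = univ := by rw [← preimage_iUnion, hYU, preimage_univ]
  have hpm : IsProbabilityMeasure (γ.map Prod.fst) :=
    Measure.isProbabilityMeasure_map measurable_fst.aemeasurable
  refine hC.ofReal_le x ⟨γ.map Prod.fst, hpm, hp1 γ hγ⟩ hY hYm hYU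
    (tendsto_integral_cond hZ hZm hZU (hi γ hγ)) ?_
  filter_upwards [eventually_measure_ne_zero (ρ := γ) hZm hZU] with k hk
  have hpc : IsProbabilityMeasure γ[|Z k] := cond_isProbabilityMeasure hk
  have hae : ∀ᵐ z ∂γ[|Z k], z ∈ H m := cond_absolutelyContinuous.ae_le hγ
  have hmem : ∀ᵐ z ∂γ[|Z k], z ∈ Z k := ae_cond_mem (hZ k)
  have hpm' : IsProbabilityMeasure ((γ[|Z k]).map Prod.fst) :=
    Measure.isProbabilityMeasure_map measurable_fst.aemeasurable
  have hreal : ∀ᵐ z ∂γ[|Z k], ∃ t : ℝ, epiLim H z.1 = t ∧ -(k : ℝ) ≤ t ∧ t ≤ z.2 := by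
    filter_upwards [hae, hmem] with z hz hzk
    have h1 := epiLim_le hz
    have h2 : ((-k : ℝ) : EReal) ≤ epiLim H z.1 := hzk
    lift epiLim H z.1 to ℝ using ⟨ne_top_of_le_ne_top (EReal.coe_ne_top _) h1, hbot _⟩ with t
    exact ⟨t, rfl, EReal.coe_le_coe_iff.1 h2, EReal.coe_le_coe_iff.1 h1⟩
  have hint : Integrable (fun z : Rd d × ℝ => (epiLim H z.1).toReal) γ[|Z k] := by
    refine Integrable.of_bound (hmψ.ereal_toReal.comp measurable_fst).aestronglyMeasurable
      (max (k : ℝ) T) ?_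
    filter_upwards [hae, hreal] with z hz hzr
    obtain ⟨t, ht, h1, h2⟩ := hzr
    have h3 := (le_abs_self z.2).trans ((norm_snd_le z).trans (hT z hz))
    rw [ht, EReal.toReal_coe, Real.norm_eq_abs, abs_le]
    exact ⟨by linarith [le_max_left (k : ℝ) T], by linarith [le_max_right (k : ℝ) T]⟩
  rw [map_fst_cond γ (hY k)]
  have hL1 : MemL1 ((γ[|Z k]).map Prod.fst) (epiLim H) := by
    refine memL1_iff.2 ⟨hmψ, hbot, ?_, ?_⟩
    · have hms : MeasurableSet {y | epiLim H y ≠ ⊤} := (hmψ (measurableSet_singleton ⊤)).compl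
      refine (ae_map_iff measurable_fst.aemeasurable hms).2 ?_
      filter_upwards [hreal] with z hz
      obtain ⟨t, ht, -⟩ := hz
      rw [ht]; exact EReal.coe_ne_top t
    · exact (integrable_map_measure hmψ.ereal_toReal.aestronglyMeasurable
        measurable_fst.aemeasurable).2 hint
  refine le_trans (ENNReal.ofReal_le_ofReal ?_) (h ⟨_, hpm', hp1 _ hae⟩ hL1)
  refine sub_le_sub_left ?_ r
  rw [integral_map measurable_fst.aemeasurable hmψ.ereal_toReal.aestronglyMeasurable]
  refine integral_mono_ae hint (hi _ hae) ?_
  filter_upwards [hreal] with z hz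
  obtain ⟨t, ht, -, h2⟩ := hz
  simpa [ht] using h2

theorem ofReal_sub_le_of_memL1 (hC : CondC p C) (hH : ∀ m, IsCompact (H m)) (hmono : Monotone H)
    (h : ∀ (m : ℕ) (γ : Measure (Rd d × ℝ)) [IsProbabilityMeasure γ], (∀ᵐ z ∂γ, z ∈ H m) →
      ENNReal.ofReal (r - ∫ z, z.2 ∂γ) ≤ C x (γ.map Prod.fst))
    (ρ : Pp p d) (hρ : MemL1 ρ.1 (epiLim H)) :
    ENNReal.ofReal (r - ∫ y, (epiLim H y).toReal ∂ρ.1) ≤ C x ρ.1 := by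
  have hpr : IsProbabilityMeasure ρ.1 := ρ.2.1
  have hmψ : Measurable (epiLim H) := measurable_epiLim hH
  have hm (k : ℕ) : Measurable (epiInf (H k)) := measurable_epiInf (hH k)
  have hanti (y : Rd d) : Antitone fun k => epiInf (H k) y := fun k l hkl =>
    epiInf_anti (hmono hkl) y
  let Y : ℕ → Set (Rd d) := fun k => {y | epiInf (H k) y ≤ epiLim H y + 1}
  have hY (k : ℕ) : MeasurableSet (Y k) := measurableSet_le (hm k) (hmψ.add_const 1)
  have hYm : Monotone Y := fun k l hkl y hy => (hanti y hkl).trans hy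
  have hYU : ⋃ k, Y k = univ := by
    refine eq_univ_of_forall fun y => mem_iUnion.2 ?_
    rcases eq_or_ne (epiLim H y) ⊤ with hy | hy
    · exact ⟨0, by simp only [Y, mem_ofPred_eq, hy]; exact le_top⟩
    · have : epiLim H y < epiLim H y + 1 := by
        lift epiLim H y to ℝ using ⟨hy, hρ.2.1 y⟩ with t
        exact_mod_cast lt_add_one t
      obtain ⟨k, hk⟩ := iInf_lt_iff.1 this
      exact ⟨k, hk.le⟩
  have hreal : ∀ᵐ y ∂ρ.1, ∀ k, y ∈ Y k → ∃ t : ℝ, epiInf (H k) y = t ∧ (y, t) ∈ H k ∧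
      (epiLim H y).toReal ≤ t ∧ t ≤ (epiLim H y).toReal + 1 := by
    filter_upwards [hρ.ae_ne_top] with y hy k hk
    have hk' : epiInf (H k) y ≤ epiLim H y + 1 := hk
    have hle : epiLim H y ≤ epiInf (H k) y := iInf_le _ k
    lift epiLim H y to ℝ using ⟨hy, hρ.2.1 y⟩ with s
    obtain ⟨t, ht, he⟩ := mem_of_epiInf_ne_top (hH k) (y := y)
      (ne_top_of_le_ne_top (EReal.coe_ne_top (s + 1)) (by exact_mod_cast hk'))
    rw [he] at hk' hle
    exact ⟨t, he, ht, by exact_mod_cast hle, by exact_mod_cast hk'⟩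
  have hi := hρ.integrable
  have hs : Tendsto (fun k => ∫ y in Y k, (epiInf (H k) y).toReal ∂ρ.1) atTop
      (𝓝 (∫ y, (epiLim H y).toReal ∂ρ.1)) := by
    simp only [← integral_indicator (hY _)]
    refine tendsto_integral_of_dominated_convergence (fun y => |(epiLim H y).toReal| + 1)
      (fun k => ((hm k).ereal_toReal.indicator (hY k)).aestronglyMeasurable)
      (hi.abs.add (integrable_const 1)) (fun k => ?_) ?_
    · filter_upwards [hreal] with y hy
      by_cases hk : y ∈ Y k
      · obtain ⟨t, ht, -, h1, h2⟩ := hy k hk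
        rw [indicator_of_mem hk, ht, EReal.toReal_coe, Real.norm_eq_abs, abs_le]
        have := neg_abs_le (epiLim H y).toReal
        have := le_abs_self (epiLim H y).toReal
        constructor <;> linarith
      · rw [indicator_of_notMem hk, norm_zero]; positivity
    · filter_upwards [hρ.ae_ne_top] with y hy
      have h1 : Tendsto (fun k => (epiInf (H k) y).toReal) atTop (𝓝 (epiLim H y).toReal) :=
        (EReal.tendsto_toReal hy (hρ.2.1 y)).comp (tendsto_atTop_iInf (hanti y))
      refine h1.congr' ?_
      obtain ⟨N, hN⟩ := mem_iUnion.1 (hYU.ge (mem_univ y))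
      filter_upwards [eventually_ge_atTop N] with k hk
      rw [indicator_of_mem (hYm hk hN)]
  refine hC.ofReal_le x ρ hY hYm hYU (tendsto_inv_mul_of_iUnion (ρ := ρ.1) hYm hYU hs) ?_
  filter_upwards [eventually_measure_ne_zero (ρ := ρ.1) hYm hYU] with k hk
  have hpc : IsProbabilityMeasure ρ.1[|Y k] := cond_isProbabilityMeasure hk
  have hF : Measurable fun y => (y, (epiInf (H k) y).toReal) :=
    measurable_id.prodMk (hm k).ereal_toReal
  have hpm : IsProbabilityMeasure ((ρ.1[|Y k]).map fun y => (y, (epiInf (H k) y).toReal)) :=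
    Measure.isProbabilityMeasure_map hF.aemeasurable
  have hk' := h k ((ρ.1[|Y k]).map fun y => (y, (epiInf (H k) y).toReal)) ?_
  · rw [integral_map hF.aemeasurable measurable_snd.aestronglyMeasurable, integral_cond_eq,
      Measure.map_map measurable_fst hF] at hk'
    simpa [Function.comp_def] using hk'
  · have hms : MeasurableSet {z | z ∈ H k} := (hH k).measurableSet
    refine (ae_map_iff hF.aemeasurable hms).2 ?_
    have h1 : ∀ᵐ y ∂ρ.1[|Y k], y ∈ Y k := ae_cond_mem (hY k)
    filter_upwards [h1, cond_absolutelyContinuous.ae_le hreal] with y hy hyr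
    obtain ⟨t, ht, hmem, -⟩ := hyr k hy
    rwa [ht, EReal.toReal_coe]

end Compact

theorem coe_le_conjL1_epiLim_iff {X : Type*} [MeasurableSpace X] {d : ℕ} {p : ℝ}
    {C : X → Measure (Rd d) → ℝ≥0∞} {H : ℕ → Set (Rd d × ℝ)} {x : X} {r : ℝ}
    (hp : 1 ≤ p) (hC : CondC p C) (hH : ∀ m, IsCompact (H m)) (hmono : Monotone H)
    (hbot : ∀ y, epiLim H y ≠ ⊥) :
    (r : EReal) ≤ conjL1 p C (epiLim H) x ↔ ∀ (m : ℕ) (γ : ProbabilityMeasure (H m)),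
      ENNReal.ofReal (r - ∫ z, z.1.2 ∂(γ : Measure (H m))) ≤
        C x ((γ : Measure (H m)).map fun z => z.1.1) := by
  rw [coe_le_conjL1_iff]
  constructor
  · intro h m γ
    have hpm : IsProbabilityMeasure ((γ : Measure (H m)).map Subtype.val) :=
      Measure.isProbabilityMeasure_map measurable_subtype_coe.aemeasurable
    have h1 := ofReal_sub_le_of_compact hp hC hH hbot h m ((γ : Measure (H m)).map Subtype.val) (by
      have hms : MeasurableSet {z | z ∈ H m} := (hH m).measurableSet
      exact (ae_map_iff measurable_subtype_coe.aemeasurable hms).2 (ae_of_all _ fun z => z.2))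
    rwa [integral_map measurable_subtype_coe.aemeasurable measurable_snd.aestronglyMeasurable,
      Measure.map_map measurable_fst measurable_subtype_coe] at h1
  · intro h ρ hρ
    refine ofReal_sub_le_of_memL1 hC hH hmono (fun m γ _ hγ => ?_) ρ hρ
    have hval : (γ.comap Subtype.val : Measure (H m)).map Subtype.val = γ := by
      rw [map_comap_subtype_coe (hH m).measurableSet]
      exact Measure.restrict_eq_self_of_ae_mem hγ
    have hpm : IsProbabilityMeasure (γ.comap Subtype.val : Measure (H m)) := by
      constructor
      rw [← preimage_univ (f := Subtype.val), ← Measure.map_apply measurable_subtype_coe .univ,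
        hval, measure_univ]
    have h1 := h m ⟨γ.comap Subtype.val, hpm⟩
    have e1 : ∫ z : H m, z.1.2 ∂(γ.comap Subtype.val) = ∫ z, z.2 ∂γ := by
      conv_rhs => rw [← hval]
      rw [integral_map measurable_subtype_coe.aemeasurable measurable_snd.aestronglyMeasurable]
    have e2 : (γ.comap Subtype.val : Measure (H m)).map (fun z => z.1.1) = γ.map Prod.fst := by
      conv_rhs => rw [← hval]
      rw [Measure.map_map measurable_fst measurable_subtype_coe]
      rfl
    rw [← e1, ← e2]
    exact h1

namespace CostData

variable {X : Type*} [TopologicalSpace X] [MeasurableSpace X] {d : ℕ} {p : ℝ}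
  {C : X → Measure (Rd d) → ℝ≥0∞} {a : X → ℝ} {b : Rd d → ℝ}

theorem measurable_conjL1 [BorelSpace X] {H : ℕ → Set (Rd d × ℝ)} (hD : CostData p C a b)
    (hC : CondC p C) (hH : ∀ m, IsCompact (H m)) (hmono : Monotone H)
    (hbot : ∀ y, epiLim H y ≠ ⊥) : Measurable (conjL1 p C (epiLim H)) := by
  have hreal (r : ℝ) : MeasurableSet {x | (r : EReal) ≤ conjL1 p C (epiLim H) x} := by
    simp only [coe_le_conjL1_epiLim_iff hD.one_le hC hH hmono hbot, ofPred_forall]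
    refine .iInter fun m => ?_
    have hcs : CompactSpace (H m) := isCompact_iff_compactSpace.1 (hH m)
    obtain ⟨T, hT⟩ := (hH m).isBounded.exists_norm_le
    let fstC : C(H m, Rd d) := ⟨fun z => z.1.1, by fun_prop⟩
    let sndC : C(H m, ℝ) := ⟨fun z => z.1.2, by fun_prop⟩
    let g : X × ProbabilityMeasure (H m) → ℝ≥0∞ := fun q =>
      ENNReal.ofReal (∫ z, sndC z ∂(q.2 : Measure (H m)) + T) +
        C q.1 (pushPp hD.one_le fstC q.2).1
    have hg : LowerSemicontinuous g := by
      refine LowerSemicontinuous.add (Continuous.lowerSemicontinuous ?_) ?_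
      · exact ENNReal.continuous_ofReal.comp
          (((continuous_probabilityMeasure_integral sndC).comp continuous_snd).add continuous_const)
      · exact hD.lsc.comp (continuous_fst.prodMk
          ((continuous_pushPp hD.one_le fstC).comp continuous_snd))
    have heq : {x | ∀ γ : ProbabilityMeasure (H m),
        ENNReal.ofReal (r - ∫ z, z.1.2 ∂(γ : Measure (H m))) ≤
          C x ((γ : Measure (H m)).map fun z => z.1.1)} =
        {x | ENNReal.ofReal (r + T) ≤ ⨅ γ, g (x, γ)} := by
      ext x
      simp only [mem_ofPred_eq, le_iInf_iff]
      refine forall_congr' fun γ => ?_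
      have hnn : 0 ≤ ∫ z, sndC z ∂(γ : Measure (H m)) + T := by
        have h1 : |∫ z, sndC z ∂(γ : Measure (H m))| ≤ T := by
          have := norm_integral_le_of_norm_le_const (μ := (γ : Measure (H m))) (f := sndC) (C := T)
            (ae_of_all _ fun z => (norm_snd_le z.1).trans (hT z.1 z.2))
          simpa using this
        linarith [neg_abs_le (∫ z, sndC z ∂(γ : Measure (H m)))]
      have he : r - ∫ z, z.1.2 ∂(γ : Measure (H m)) =
          r + T - (∫ z, sndC z ∂(γ : Measure (H m)) + T) := by
        simp only [sndC, ContinuousMap.coe_mk]; ring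
      rw [he, ENNReal.ofReal_sub _ hnn, tsub_le_iff_left]
      rfl
    rw [← ofPred_forall, heq]
    exact measurableSet_le measurable_const (measurable_iInf_compact hg)
  refine measurable_of_Ici fun c => ?_
  induction c with
  | bot => simp
  | coe r => exact hreal r
  | top =>
    have : conjL1 p C (epiLim H) ⁻¹' Ici ⊤ =
        ⋂ n : ℕ, {x | ((n : ℝ) : EReal) ≤ conjL1 p C (epiLim H) x} := by
      ext x
      simp only [mem_preimage, mem_Ici, top_le_iff, mem_iInter, mem_ofPred_eq]
      refine ⟨fun h n => by rw [h]; exact le_top, fun h => ?_⟩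
      refine (EReal.eq_top_iff_forall_lt _).2 fun y => ?_
      obtain ⟨n, hn⟩ := exists_nat_gt y
      exact (EReal.coe_lt_coe_iff.2 hn).trans_le (h n)
    rw [this]
    exact .iInter fun n => hreal n

end CostData

/-- The limit superior of dual potentials on increasing boxes lies below the conjugate of any
majorant of the limit superior of the companion potentials. -/
theorem limsup_le_conjL1 {X : Type*} [MeasurableSpace X] {d : ℕ} {p : ℝ}
    {C : X → Measure (Rd d) → ℝ≥0∞} {a : X → ℝ} {b : Rd d → ℝ} {μ : Measure X}
    {ν : Measure (Rd d)} {φ : ℕ → X → ℝ}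
    {E : ℕ → Rd d → ℝ} {T : ℕ → ℝ} (hC : CondC p C)
    (hq : ∀ n, IsDualPair C a b μ ν n (T n) (φ n, E n)) {ψ : Rd d → EReal}
    (hψ : ∀ y, limsup (fun n => (E n y : EReal)) atTop ≤ ψ y) (x : X) :
    limsup (fun n => (φ n x : EReal)) atTop ≤ conjL1 p C ψ x := by
  refine EReal.ge_of_forall_gt_iff_ge.1 fun r hr => coe_le_conjL1_iff.2 fun ρ hρ => ?_
  have hpr : IsProbabilityMeasure ρ.1 := ρ.2.1
  have hfreq : ∃ᶠ n in atTop, r < φ n x :=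
    (frequently_lt_of_lt_limsup (by isBoundedDefault) hr).mono fun n hn => by exact_mod_cast hn
  let Y : ℕ → Set (Rd d) := fun k => (box d k ∩ ⋂ n ≥ k, {y | E n y ≤ k}) ∪ {y | ψ y = ⊤}
  have hY (k : ℕ) : MeasurableSet (Y k) := by
    refine ((measurableSet_box d k).inter ?_).union (hρ.1 (measurableSet_singleton ⊤))
    exact .iInter fun n => .iInter fun _ => measurableSet_le (hq n).measurable_snd measurable_const
  have hYm : Monotone Y := by
    intro k l hkl
    refine union_subset_union_left _ (inter_subset_inter (box_mono hkl) fun y hy => ?_)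
    simp only [mem_iInter, mem_ofPred_eq] at hy ⊢
    exact fun n hn => (hy n (hkl.trans hn)).trans (Nat.cast_le.2 hkl)
  have hYU : ⋃ k, Y k = univ := by
    refine eq_univ_of_forall fun y => mem_iUnion.2 ?_
    rcases eq_or_ne (ψ y) ⊤ with hy | hy
    · exact ⟨0, Or.inr hy⟩
    · have h1 := (hψ y).trans_lt (lt_top_iff_ne_top.2 hy)
      obtain ⟨c, hc, -⟩ := EReal.lt_iff_exists_real_btwn.1 h1
      obtain ⟨N, hN⟩ := eventually_atTop.1 (eventually_lt_of_limsup_lt hc)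
      obtain ⟨M, hM⟩ := exists_mem_box y
      obtain ⟨k, hk⟩ := exists_nat_ge c
      refine ⟨max N (max M k), Or.inl ⟨box_mono (by omega) hM, ?_⟩⟩
      simp only [mem_iInter, mem_ofPred_eq]
      intro n hn
      have h2 : E n y < c := by exact_mod_cast hN n (by omega)
      have h3 : (k : ℝ) ≤ (max N (max M k) : ℕ) := Nat.cast_le.2 (by omega)
      linarith
  refine hC.ofReal_le x ρ hY hYm hYU (tendsto_integral_cond hY hYm hYU hρ.integrable) ?_
  filter_upwards [eventually_measure_ne_zero (ρ := ρ.1) hYm hYU] with k hk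
  have hpc : IsProbabilityMeasure ρ.1[|Y k] := cond_isProbabilityMeasure hk
  have htop : ∀ᵐ y ∂ρ.1[|Y k], ψ y ≠ ⊤ := cond_absolutelyContinuous.ae_le hρ.ae_ne_top
  have hY' : ∀ᵐ y ∂ρ.1[|Y k], y ∈ box d k ∧ ∀ n ≥ k, E n y ≤ k := by
    have h1 : ∀ᵐ y ∂ρ.1[|Y k], y ∈ Y k := ae_cond_mem (hY k)
    filter_upwards [h1, htop] with y hy hyt
    rcases hy with hy | hy
    · simpa using hy
    · exact absurd hy hyt
  have hbox {n : ℕ} (hn : k ≤ n) : ρ.1[|Y k] (box d n)ᶜ = 0 := by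
    refine mem_ae_iff.1 ?_
    filter_upwards [hY'] with y hy using box_mono hn hy.1
  rcases eq_or_ne (C x (ρ.1[|Y k])) ⊤ with hc | hc
  · rw [hc]; exact le_top
  rw [ENNReal.ofReal_le_iff_le_toReal hc, sub_le_comm]
  refine le_integral_of_frequently_le (f := E) (M := k) (integrable_cond hk
    hρ.integrable.integrableOn) ?_ ?_ ?_ ?_
  · filter_upwards [eventually_ge_atTop k] with n hn using (hq n).integrable (hbox hn)
  · filter_upwards [eventually_ge_atTop k] with n hn
    filter_upwards [hY'] with y hy using hy.2 n hn
  · filter_upwards [htop] with y hy ε hε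
    have h1 : limsup (fun n => (E n y : EReal)) atTop < (((ψ y).toReal + ε : ℝ) : EReal) := by
      refine (hψ y).trans_lt ?_
      lift ψ y to ℝ using ⟨hy, hρ.2.1 y⟩ with t
      exact_mod_cast lt_add_of_pos_right t hε
    filter_upwards [eventually_lt_of_limsup_lt h1] with n hn
    exact_mod_cast hn.le
  · refine (hfreq.and_eventually (eventually_ge_atTop k)).mono fun n hn => ?_
    have h1 := (hq n).le_cost x (ρ.1[|Y k]) (hbox hn.2)
    rw [ENNReal.ofReal_le_iff_le_toReal hc] at h1
    simp only at h1
    linarith [hn.1]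

theorem integrable_integral_bind {X Y : Type*} [MeasurableSpace X] [MeasurableSpace Y]
    {μ : Measure X} (κ : ProbabilityTheory.Kernel X Y) {f : Y → ℝ}
    (hf : Integrable f (μ.bind κ)) :
    (∀ᵐ x ∂μ, Integrable f (κ x)) ∧ Integrable (fun x => ∫ y, f y ∂(κ x)) μ := by
  have e : (κ.comp (ProbabilityTheory.Kernel.const Unit μ)) () = μ.bind κ := by
    rw [ProbabilityTheory.Kernel.comp_apply, ProbabilityTheory.Kernel.const_apply]
  rw [← e] at hf
  exact ⟨hf.ae_of_comp, hf.integral_comp⟩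

theorem isCoupling_bind {X : Type*} [MeasurableSpace X] {d : ℕ} {μ : Measure X}
    {ν : Measure (Rd d)} {π : Measure (X × Rd d)} (hπ : IsCoupling π μ ν) :
    (∀ x, IsProbabilityMeasure (disint π x)) ∧ μ.bind (disint π) = ν := by
  obtain ⟨hp, h1, h2⟩ := hπ
  have e : disint π = π.condKernel := dif_pos (inferInstanceAs (IsFiniteMeasure π))
  rw [e]
  refine ⟨fun x => inferInstance, ?_⟩
  have h3 : π.fst.compProd π.condKernel = π := Measure.disintegrate π π.condKernel
  rw [← h2, show μ = π.fst from h1.symm]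
  have h4 := Measure.snd_compProd π.fst π.condKernel
  rw [h3] at h4
  exact h4.symm

theorem ae_of_ae_bind_kernel {X Y : Type*} [MeasurableSpace X] [MeasurableSpace Y]
    {μ : Measure X} (κ : ProbabilityTheory.Kernel X Y) {P : Y → Prop}
    (h : ∀ᵐ y ∂(μ.bind κ), P y) : ∀ᵐ x ∂μ, ∀ᵐ y ∂(κ x), P y :=
  Measure.ae_ae_of_ae_bind κ.aemeasurable h

theorem InPhi.eInt_sub_le_lintegral {X : Type*} [MeasurableSpace X] {d : ℕ} {p : ℝ}
    {C : X → Measure (Rd d) → ℝ≥0∞} {μ : Measure X} {ν : Measure (Rd d)} (hνp : HasMomentP p ν)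
    {w : X → EReal} {ψ : Rd d → EReal} (h : InPhi p μ ν C w ψ) {π : Measure (X × Rd d)}
    (hπ : IsCoupling π μ ν) :
    eInt μ w - eInt ν ψ ≤ ((∫⁻ x, C x (disint π x) ∂μ : ℝ≥0∞) : EReal) := by
  obtain ⟨hw, hψ, hle⟩ := h
  obtain ⟨hκ, hb⟩ := isCoupling_bind hπ
  set κ := disint π
  have hwi : Integrable (fun x => (w x).toReal) μ := by
    have := hw.integrable.neg
    refine this.congr (ae_of_all _ fun x => ?_)
    simp
  have hwt : ∀ x, w x ≠ ⊤ := fun x hx => hw.2.1 x (by simp [hx])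
  have hwb : ∀ᵐ x ∂μ, w x ≠ ⊥ := hw.ae_ne_top.mono fun x hx hx' => hx (by simp [hx'])
  have e1 : eInt μ w = ((∫ x, (w x).toReal ∂μ : ℝ) : EReal) := by
    rw [← eInt_coe hwi]
    exact eInt_congr (hwb.mono fun x hx => (EReal.coe_toReal (hwt x) hx).symm)
  rw [e1, hψ.eInt_eq]
  by_cases htop : ∫⁻ x, C x (κ x) ∂μ = ⊤
  · rw [htop]; exact le_top
  have hψi := hψ.integrable
  have hψt := hψ.ae_ne_top
  rw [HasMomentP, ← hb, Measure.lintegral_bind κ.aemeasurable (by fun_prop)] at hνp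
  rw [← hb] at hψi hψt
  obtain ⟨hI1, hI2⟩ := integrable_integral_bind κ hψi
  have hM : ∀ᵐ x ∂μ, HasMomentP p (κ x) := by
    filter_upwards [ae_lt_top (Measurable.lintegral_kernel (by fun_prop)) hνp] with x hx using hx.ne
  have hfin : ∀ᵐ x ∂μ, ENNReal.ofReal ((w x).toReal - ∫ y, (ψ y).toReal ∂(κ x)) ≤ C x (κ x) := by
    filter_upwards [hM, hI1, ae_of_ae_bind_kernel κ hψt, hwb] with x h1 h2 h3 h4
    have hm : MemL1 (κ x) ψ := memL1_iff.2 ⟨hψ.1, hψ.2.1, h3, h2⟩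
    have h5 := hle x ⟨κ x, hκ x, h1⟩ hm
    rw [hm.eInt_eq, ← EReal.coe_toReal (hwt x) h4, ← EReal.coe_sub] at h5
    rw [← EReal.coe_ennreal_le_coe_ennreal_iff, EReal.coe_ennreal_ofReal]
    rcases max_cases ((w x).toReal - ∫ y, (ψ y).toReal ∂(κ x)) 0 with ⟨e, -⟩ | ⟨e, -⟩ <;> rw [e]
    · exact h5
    · exact EReal.coe_ennreal_nonneg _
  have hint : Integrable (fun x => (w x).toReal - ∫ y, (ψ y).toReal ∂(κ x)) μ := hwi.sub hI2
  have e2 : ∫ y, (ψ y).toReal ∂ν = ∫ x, ∫ y, (ψ y).toReal ∂(κ x) ∂μ := by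
    rw [← integral_bind_kernel κ hψi, hb]
  rw [e2, ← EReal.coe_sub, ← integral_sub hwi hI2, coe_ennreal_eq_coe_toReal htop,
    EReal.coe_le_coe_iff, integral_eq_lintegral_pos_part_sub_lintegral_neg_part hint]
  refine (sub_le_self _ ENNReal.toReal_nonneg).trans ?_
  exact ENNReal.toReal_mono htop (lintegral_mono_ae hfin)

theorem InPhi.eInt_sub_le_primal {X : Type*} [MeasurableSpace X] {d : ℕ} {p : ℝ}
    {C : X → Measure (Rd d) → ℝ≥0∞} {μ : Measure X} {ν : Measure (Rd d)} (hνp : HasMomentP p ν)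
    {w : X → EReal} {ψ : Rd d → EReal} (h : InPhi p μ ν C w ψ) :
    eInt μ w - eInt ν ψ ≤ ((primal μ ν C : ℝ≥0∞) : EReal) := by
  refine EReal.le_of_forall_lt_iff_le.1 fun z hz => ?_
  have hz0 : 0 ≤ z := EReal.coe_nonneg.1 ((EReal.coe_ennreal_nonneg _).trans hz.le)
  rw [← max_eq_left hz0, ← EReal.coe_ennreal_ofReal, EReal.coe_ennreal_lt_coe_ennreal_iff] at hz
  obtain ⟨π, hπ⟩ := iInf_lt_iff.1 hz
  refine (h.eInt_sub_le_lintegral hνp π.2).trans ?_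
  rw [← max_eq_left hz0, ← EReal.coe_ennreal_ofReal, EReal.coe_ennreal_le_coe_ennreal_iff]
  exact hπ.le

theorem ENNReal.liminf_add_liminf_le (u v : ℕ → ℝ≥0∞) :
    liminf u atTop + liminf v atTop ≤ liminf (fun n => u n + v n) atTop := by
  simp only [liminf_eq_iSup_iInf_of_nat']
  rw [ENNReal.iSup_add_iSup_of_monotone]
  · exact iSup_mono fun n => le_iInf fun i => add_le_add (iInf_le _ i) (iInf_le _ i)
  all_goals
    intro m n hmn
    refine le_iInf fun i => iInf_le_of_le (i + (n - m)) ?_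
    rw [add_assoc, Nat.sub_add_cancel hmn]

theorem lintegral_liminf_add_le {α β : Type*} [MeasurableSpace α] [MeasurableSpace β]
    {μ : Measure α} {ν : Measure β} {f : ℕ → α → ℝ≥0∞} {g : ℕ → β → ℝ≥0∞}
    (hf : ∀ n, AEMeasurable (f n) μ) (hg : ∀ n, AEMeasurable (g n) ν) {s : ℕ → ℝ≥0∞} {S : ℝ≥0∞}
    (hs : Tendsto s atTop (𝓝 S)) (h : ∀ n, ∫⁻ x, f n x ∂μ + ∫⁻ y, g n y ∂ν ≤ s n) :
    ∫⁻ x, liminf (fun n => f n x) atTop ∂μ + ∫⁻ y, liminf (fun n => g n y) atTop ∂ν ≤ S := by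
  refine (add_le_add (lintegral_liminf_le' hf) (lintegral_liminf_le' hg)).trans ?_
  refine (ENNReal.liminf_add_liminf_le _ _).trans ?_
  rw [← hs.liminf_eq]
  exact liminf_le_liminf (Eventually.of_forall h)

theorem exists_tendsto_of_exp {t : ℕ → ℝ} {r : ℝ}
    (hr : Tendsto (fun n => Real.exp (-t n / 2)) atTop (𝓝 r))
    (ht : liminf (fun n => ENNReal.ofReal (t n)) atTop ≠ ⊤) : ∃ s, Tendsto t atTop (𝓝 s) := by
  rcases (ge_of_tendsto' hr fun n => (Real.exp_pos _).le).eq_or_lt with h | h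
  · rw [← h, Real.tendsto_exp_comp_nhds_zero] at hr
    have h1 : Tendsto t atTop atTop := by
      have := (tendsto_neg_atBot_atTop.comp hr).atTop_mul_const (two_pos (α := ℝ))
      refine this.congr fun n => ?_
      simp only [Function.comp_apply]; ring
    exact absurd (ENNReal.tendsto_ofReal_atTop.comp h1).liminf_eq ht
  · refine ⟨_, (((Real.continuousAt_log h.ne').tendsto.comp hr).const_mul (-2)).congr fun n => ?_⟩
    simp only [Function.comp_apply, Real.log_exp]; ring

theorem ofReal_sub_toReal_le_liminf {a : ℝ} {φ : ℕ → ℝ} {w : EReal} (hw : w ≠ ⊤)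
    (h : limsup (fun n => (φ n : EReal)) atTop ≤ w) :
    (w = ⊥ → liminf (fun n => ENNReal.ofReal (a - φ n)) atTop = ⊤) ∧
    (w ≠ ⊥ → ENNReal.ofReal (a - w.toReal) ≤ liminf (fun n => ENNReal.ofReal (a - φ n)) atTop) := by
  have key : ∀ r : ℝ, w < r →
      ENNReal.ofReal (a - r) ≤ liminf (fun n => ENNReal.ofReal (a - φ n)) atTop := by
    intro r hr
    refine le_liminf_of_le (by isBoundedDefault) ?_
    filter_upwards [eventually_lt_of_limsup_lt (h.trans_lt hr) (by isBoundedDefault)] with n hn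
    have := EReal.coe_lt_coe_iff.1 hn
    gcongr
  constructor
  · rintro rfl
    refine ENNReal.eq_top_of_forall_nnreal_le fun r => ?_
    have := key (a - r) (EReal.bot_lt_coe _)
    rwa [sub_sub_cancel, ENNReal.ofReal_coe_nnreal] at this
  · intro hb
    lift w to ℝ using ⟨hw, hb⟩ with t
    refine ENNReal.le_of_forall_pos_le_add fun ε hε _ => ?_
    have h1 := key (t + ε) (EReal.coe_lt_coe_iff.2 (by simpa using hε))
    rw [EReal.toReal_coe]
    calc ENNReal.ofReal (a - t) = ENNReal.ofReal ((a - (t + ε)) + ε) := by congr 1; ring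
      _ ≤ ENNReal.ofReal (a - (t + ε)) + ENNReal.ofReal ε := ENNReal.ofReal_add_le
      _ ≤ _ := by rw [ENNReal.ofReal_coe_nnreal]; gcongr

theorem CostData.primal_le {X : Type*} [TopologicalSpace X] [MeasurableSpace X] {d : ℕ} {p : ℝ}
    {C : X → Measure (Rd d) → ℝ≥0∞} {a : X → ℝ} {b : Rd d → ℝ} (hD : CostData p C a b)
    {μ : Measure X} [IsProbabilityMeasure μ] (ha : Integrable a μ) {ν : Measure (Rd d)}
    [hν : IsProbabilityMeasure ν] (hνp : HasMomentP p ν) (hb : Integrable b ν) :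
    primal μ ν C ≤ ENNReal.ofReal (∫ x, a x ∂μ + ∫ y, b y ∂ν) := by
  refine (primal_le_lintegral_kernel C (ProbabilityTheory.Kernel.const X ν) (by simp)).trans ?_
  refine (lintegral_mono fun x => hD.bound x ⟨ν, hν, hνp⟩).trans_eq ?_
  rw [lintegral_add_right _ measurable_const, lintegral_const, measure_univ, mul_one,
    ENNReal.ofReal_add (integral_nonneg hD.a_nonneg) (integral_nonneg hD.b_nonneg),
    ofReal_integral_eq_lintegral_ofReal ha (ae_of_all _ hD.a_nonneg),
    ofReal_integral_eq_lintegral_ofReal hb (ae_of_all _ hD.b_nonneg)]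

theorem conjL1_le {X : Type*} [MeasurableSpace X] {d : ℕ} {p : ℝ}
    (C : X → Measure (Rd d) → ℝ≥0∞) {ψ : Rd d → EReal} (x : X) (ρ : Pp p d) (h : MemL1 ρ.1 ψ) :
    conjL1 p C ψ x ≤ eInt ρ.1 ψ + ((C x ρ.1 : ℝ≥0∞) : EReal) :=
  iInf_le_of_le (⟨ρ, h⟩ : {ρ : Pp p d // MemL1 ρ.1 ψ}) le_rfl

theorem exists_costData {X : Type*} [TopologicalSpace X] [MeasurableSpace X] {d : ℕ} {p : ℝ}
    (hp : 1 ≤ p) {μ : Measure X} {ν : Measure (Rd d)} {C : X → Measure (Rd d) → ℝ≥0∞}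
    (hlsc : LowerSemicontinuous fun q : X × Pp p d => C q.1 q.2.1)
    (hconv : ∀ x : X, ∀ ρ₁ ρ₂ : Pp p d, ∀ t : ℝ≥0∞, t ≤ 1 →
      C x (t • ρ₁.1 + (1 - t) • ρ₂.1) ≤ t * C x ρ₁.1 + (1 - t) * C x ρ₂.1)
    (hmono : ∀ x : X, ∀ ρ₁ ρ₂ : Pp p d, ConvexOrder ρ₁.1 ρ₂.1 → C x ρ₂.1 ≤ C x ρ₁.1)
    (hB : CondB p μ ν C) :
    ∃ (a : X → ℝ) (b : Rd d → ℝ), Integrable a μ ∧ Integrable b ν ∧ CostData p C a b := by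
  obtain ⟨a, ha, b, hb, h⟩ := hB
  refine ⟨fun x => |a x|, fun y => |b y|, ha.abs, hb.abs, hp, hlsc, hconv, hmono,
    fun x => abs_nonneg _, fun y => abs_nonneg _, fun x ρ => ?_⟩
  rw [← EReal.coe_ennreal_le_coe_ennreal_iff, EReal.coe_ennreal_add]
  refine (h x ρ).trans (add_le_add ?_ ?_)
  · rw [EReal.coe_ennreal_ofReal]
    exact EReal.coe_le_coe_iff.2 ((le_abs_self _).trans (le_max_left _ _))
  · unfold eInt
    refine (EReal.sub_le_sub le_rfl (EReal.coe_ennreal_nonneg _)).trans ?_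
    rw [sub_zero, EReal.coe_ennreal_le_coe_ennreal_iff]
    refine lintegral_mono fun y => ?_
    rw [erealToENN_coe]
    exact ENNReal.ofReal_le_ofReal (le_abs_self _)

theorem aemeasurable_liminf {α : Type*} [MeasurableSpace α] {μ : Measure α} {f : ℕ → α → ℝ≥0∞}
    (hf : ∀ n, AEMeasurable (f n) μ) : AEMeasurable (fun x => liminf (fun n => f n x) atTop) μ := by
  simp only [liminf_eq_iSup_iInf_of_nat']
  exact AEMeasurable.iSup fun n => AEMeasurable.iInf fun i => hf _

theorem IsDualPair.lintegral_add_le {X : Type*} [MeasurableSpace X] {d : ℕ}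
    {C : X → Measure (Rd d) → ℝ≥0∞} {a : X → ℝ} {b : Rd d → ℝ} {μ : Measure X}
    (ha : Integrable a μ) {ν : Measure (Rd d)} [IsFiniteMeasure ν] (hb : Integrable b ν)
    {n : ℕ} {T : ℝ} {φ : X → ℝ} {E : Rd d → ℝ} (h : IsDualPair C a b μ ν n T (φ, E)) :
    ∫⁻ x, ENNReal.ofReal (a x - φ x) ∂μ +
      ∫⁻ y, (box d n).indicator (fun y => ENNReal.ofReal (E y + b y)) y ∂ν ≤ ENNReal.ofReal T := by
  have h1 : Integrable (fun x => a x - φ x) μ := ha.sub h.integrable_fst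
  have h2 : Integrable (fun y => E y + b y) (ν.restrict (box d n)) :=
    h.integrable_restrict.add hb.integrableOn
  have h3 : ∀ x, 0 ≤ a x - φ x := fun x => sub_nonneg.2 (h.fst_le x)
  have h4 : ∀ y ∈ box d n, 0 ≤ E y + b y := fun y hy => by
    have := h.neg_le_snd y hy
    dsimp only at this
    linarith
  have hm := measurableSet_box d n
  rw [lintegral_indicator hm, ← ofReal_integral_eq_lintegral_ofReal h1 (ae_of_all _ h3),
    ← ofReal_integral_eq_lintegral_ofReal h2 ((ae_restrict_iff' hm).2 (ae_of_all _ h4)),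
    ← ENNReal.ofReal_add (integral_nonneg h3) (setIntegral_nonneg hm h4)]
  exact ENNReal.ofReal_le_ofReal h.defect_le

theorem CostData.exists_dual_potential {X : Type*} [TopologicalSpace X]
    [SecondCountableTopology X] [MeasurableSpace X] [BorelSpace X] {d : ℕ} {p : ℝ}
    {C : X → Measure (Rd d) → ℝ≥0∞} {a : X → ℝ} {b : Rd d → ℝ} (hD : CostData p C a b)
    (hC : CondC p C) {μ : Measure X} [IsProbabilityMeasure μ] (ha : Integrable a μ)
    {ν : Measure (Rd d)} [hν : IsProbabilityMeasure ν] (hνp : HasMomentP p ν)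
    (hb : Integrable b ν) :
    ∃ ψ : Rd d → EReal, EConvex ψ ∧ InPhi p μ ν C (conjL1 p C ψ) ψ ∧
      ((primal μ ν C : ℝ≥0∞) : EReal) ≤ eInt μ (conjL1 p C ψ) - eInt ν ψ := by
  have hprimal := hD.primal_le ha hνp hb
  have hfin : primal μ ν C ≠ ⊤ := ne_top_of_le_ne_top ENNReal.ofReal_ne_top hprimal
  set v := (primal μ ν C).toReal with hv
  obtain ⟨φ, E, hq, hexp⟩ := hD.exists_dual_seq ha hνp hb (v := v) ENNReal.toReal_nonneg
    (ENNReal.ofReal_toReal hfin).le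
  set α := ∫ x, a x ∂μ with hα
  set β := ∫ y, b y ∂ν with hβ
  have hS0 : 0 ≤ α + β - v := sub_nonneg.2 (ENNReal.toReal_le_of_le_ofReal
    (add_nonneg (integral_nonneg hD.a_nonneg) (integral_nonneg hD.b_nonneg)) hprimal)
  let g : ℕ → Rd d → ℝ≥0∞ := fun n => (box d n).indicator fun y => ENNReal.ofReal (E n y + b y)
  have hg (n : ℕ) : AEMeasurable (g n) ν :=
    (((hq n).measurable_snd.aemeasurable.add hb.aemeasurable).ennreal_ofReal).indicator
      (measurableSet_box d n)
  have hf (n : ℕ) : AEMeasurable (fun x => ENNReal.ofReal (a x - φ n x)) μ :=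
    (ha.aemeasurable.sub (hq n).measurable_fst.aemeasurable).ennreal_ofReal
  have hfatou := lintegral_liminf_add_le hf hg (S := ENNReal.ofReal (α + β - v)) (by
    have := (tendsto_one_div_add_atTop_nhds_zero_nat (𝕜 := ℝ)).const_add (α + β - v)
    rw [add_zero] at this
    exact (ENNReal.continuous_ofReal.tendsto _).comp this)
    fun n => (hq n).lintegral_add_le ha hb
  set F : X → ℝ≥0∞ := fun x => liminf (fun n => ENNReal.ofReal (a x - φ n x)) atTop with hF
  set G : Rd d → ℝ≥0∞ := fun y => liminf (fun n => g n y) atTop with hG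
  have hFm : AEMeasurable F μ := aemeasurable_liminf hf
  have hGm : AEMeasurable G ν := aemeasurable_liminf hg
  have hFG := ENNReal.add_ne_top.1 (ne_top_of_le_ne_top ENNReal.ofReal_ne_top hfatou)
  -- the limiting potential
  let ψ₀ : Rd d → EReal := fun y => limsup (fun n => (E n y : EReal)) atTop
  obtain ⟨hψ₀b, hψ₀c⟩ := eConvex_limsup (fun n => (hq n).convexOn) (fun n => (hq n).neg_le_snd)
  have hψ₀m : Measurable ψ₀ := Measurable.limsup fun n => (hq n).measurable_snd.coe_real_ereal
  have hψ₀ : ∀ᵐ y ∂ν, ∃ s : ℝ, ψ₀ y = s ∧ G y = ENNReal.ofReal (s + b y) := by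
    filter_upwards [hexp, ae_lt_top' hGm hFG.2] with y ⟨r, hr⟩ hGy
    obtain ⟨N, hN⟩ := exists_mem_box y
    have hGe : G y = liminf (fun n => ENNReal.ofReal (E n y + b y)) atTop :=
      liminf_congr ((eventually_ge_atTop N).mono fun n hn =>
        indicator_of_mem (box_mono hn hN) _)
    obtain ⟨s, hs⟩ := exists_tendsto_of_exp hr (hGe ▸ hGy.ne)
    have hs' : Tendsto (fun n => E n y) atTop (𝓝 (s - b y)) := by
      simpa using hs.sub_const (b y)
    refine ⟨s - b y, ((continuous_coe_real_ereal.tendsto _).comp hs').limsup_eq, ?_⟩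
    rw [hGe, sub_add_cancel]
    exact ((ENNReal.continuous_ofReal.tendsto _).comp hs).liminf_eq
  obtain ⟨H, hHc, hHm, hHv, hHsub, hHe⟩ := exists_compact_epi ν hψ₀m hψ₀c
    (fun y hy => EReal.coe_ne_bot _ (le_bot_iff.1 ((hψ₀b y).trans_eq hy)))
    (hψ₀.mono fun y ⟨s, hs, _⟩ => hs ▸ EReal.coe_ne_top s)
  set ψ := epiLim H with hψ
  have hle : ∀ y, ψ₀ y ≤ ψ y := fun y => le_iInf fun m => le_iInf fun t => hHsub m _ t.2
  have hψb : ∀ y, ψ y ≠ ⊥ := fun y hy =>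
    EReal.coe_ne_bot _ (le_bot_iff.1 (((hψ₀b y).trans (hle y)).trans_eq hy))
  have hψG : ∀ᵐ y ∂ν, ψ y ≠ ⊤ ∧ 0 ≤ (ψ y).toReal + b y ∧
      G y = ENNReal.ofReal ((ψ y).toReal + b y) := by
    filter_upwards [hψ₀, hHe] with y ⟨s, hs, hs'⟩ hy
    have h1 : ψ y = s := hy.trans hs
    have h2 := hψ₀b y
    rw [show limsup (fun n => (E n y : EReal)) atTop = s from hs, EReal.coe_le_coe_iff] at h2
    rw [h1, EReal.toReal_coe]
    exact ⟨EReal.coe_ne_top s, by linarith, hs'⟩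
  have hψm : Measurable ψ := measurable_epiLim hHc
  have hψi' : Integrable (fun y => (ψ y).toReal + b y) ν := by
    refine ⟨(hψm.ereal_toReal.aestronglyMeasurable).add hb.1, ?_⟩
    rw [hasFiniteIntegral_iff_ofReal (hψG.mono fun y hy => hy.2.1)]
    rw [← lintegral_congr_ae (hψG.mono fun y hy => hy.2.2)]
    exact hFG.2.lt_top
  have hψi : Integrable (fun y => (ψ y).toReal) ν := by
    refine (hψi'.sub hb).congr (ae_of_all _ fun y => ?_)
    simp
  have hψ1 : MemL1 ν ψ := memL1_iff.2 ⟨hψm, hψb, hψG.mono fun y hy => hy.1, hψi⟩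
  have hGe : ∫⁻ y, G y ∂ν = ENNReal.ofReal (∫ y, (ψ y).toReal ∂ν + β) := by
    rw [← integral_add hψi hb, ofReal_integral_eq_lintegral_ofReal hψi'
      (hψG.mono fun y hy => hy.2.1)]
    exact lintegral_congr_ae (hψG.mono fun y hy => hy.2.2)
  -- its conjugate
  set w := conjL1 p C ψ with hw
  have hwm : Measurable w := hD.measurable_conjL1 hC hHc hHm hψb
  have hwle : ∀ x, w x ≤ ((∫ y, (ψ y).toReal ∂ν + (a x + β) : ℝ) : EReal) := by
    intro x
    refine (conjL1_le C x ⟨ν, hν, hνp⟩ hψ1).trans ?_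
    rw [hψ1.eInt_eq, EReal.coe_add]
    refine add_le_add le_rfl ?_
    have h1 := hD.bound x ⟨ν, hν, hνp⟩
    rw [← ofReal_integral_eq_lintegral_ofReal hb (ae_of_all _ hD.b_nonneg),
      ← ENNReal.ofReal_add (hD.a_nonneg x) (integral_nonneg hD.b_nonneg)] at h1
    refine (EReal.coe_ennreal_le_coe_ennreal_iff.2 h1).trans_eq ?_
    rw [EReal.coe_ennreal_ofReal,
      max_eq_left (add_nonneg (hD.a_nonneg x) (integral_nonneg hD.b_nonneg))]
  have hwt : ∀ x, w x ≠ ⊤ := fun x hx => EReal.coe_ne_top _ (top_le_iff.1 (hx ▸ hwle x))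
  have hlim (x : X) := ofReal_sub_toReal_le_liminf (a := a x) (hwt x)
    (limsup_le_conjL1 hC hq hle x)
  have hwF : ∀ᵐ x ∂μ, w x ≠ ⊥ ∧ ENNReal.ofReal (a x - (w x).toReal) ≤ F x := by
    filter_upwards [ae_lt_top' hFm hFG.1] with x hx
    have h1 : w x ≠ ⊥ := fun h => hx.ne ((hlim x).1 h)
    exact ⟨h1, (hlim x).2 h1⟩
  set c := ∫ y, (ψ y).toReal ∂ν + β with hc
  have hc0 : 0 ≤ c := by
    rw [hc, hβ, ← integral_add hψi hb]
    exact integral_nonneg_of_ae (hψG.mono fun y hy => hy.2.1)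
  have hwc : ∀ᵐ x ∂μ, (w x).toReal ≤ a x + c := by
    filter_upwards [hwF] with x hx
    have := hwle x
    rw [← EReal.coe_toReal (hwt x) hx.1, EReal.coe_le_coe_iff] at this
    linarith
  have hui : Integrable (fun x => a x - (w x).toReal) μ := by
    have hm : AEStronglyMeasurable (fun x => a x - (w x).toReal) μ :=
      ha.1.sub hwm.ereal_toReal.aestronglyMeasurable
    have h1 : Integrable (fun x => a x - (w x).toReal + c) μ := by
      refine ⟨hm.add aestronglyMeasurable_const, ?_⟩
      rw [hasFiniteIntegral_iff_ofReal (hwc.mono fun x hx => by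
        simp only [Pi.zero_apply]; linarith)]
      calc _ ≤ ∫⁻ x, F x + ENNReal.ofReal c ∂μ := lintegral_mono_ae (hwF.mono fun x hx =>
            ENNReal.ofReal_add_le.trans (add_le_add hx.2 le_rfl))
        _ = ∫⁻ x, F x ∂μ + ENNReal.ofReal c := by
            rw [lintegral_add_right _ measurable_const, lintegral_const, measure_univ, mul_one]
        _ < ⊤ := ENNReal.add_lt_top.2 ⟨hFG.1.lt_top, ENNReal.ofReal_lt_top⟩
    refine (h1.sub (integrable_const c)).congr (ae_of_all _ fun x => ?_)
    simp
  have hwi : Integrable (fun x => (w x).toReal) μ := by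
    refine (ha.sub hui).congr (ae_of_all _ fun x => ?_)
    simp
  have hmain : ∫ x, (a x - (w x).toReal) ∂μ + c ≤ α + β - v := by
    have h1 : ∫ x, (a x - (w x).toReal) ∂μ ≤ (∫⁻ x, F x ∂μ).toReal := by
      rw [integral_eq_lintegral_pos_part_sub_lintegral_neg_part hui]
      exact (sub_le_self _ ENNReal.toReal_nonneg).trans
        (ENNReal.toReal_mono hFG.1 (lintegral_mono_ae (hwF.mono fun x hx => hx.2)))
    have h2 := ENNReal.toReal_le_of_le_ofReal hS0 hfatou
    rw [ENNReal.toReal_add hFG.1 hFG.2, hGe, ENNReal.toReal_ofReal hc0] at h2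
    linarith
  have hw1 : MemL1 μ fun x => -w x := by
    refine memL1_iff.2 ⟨hwm.neg, fun x hx => hwt x (by simpa using hx),
      hwF.mono fun x hx hx' => hx.1 (by simpa using hx'), ?_⟩
    exact hwi.neg.congr (ae_of_all _ fun x => by simp)
  have ew : eInt μ w = ((∫ x, (w x).toReal ∂μ : ℝ) : EReal) := by
    rw [← eInt_coe hwi]
    exact eInt_congr (hwF.mono fun x hx => (EReal.coe_toReal (hwt x) hx.1).symm)
  refine ⟨ψ, eConvex_epiLim hHm hHv hψb, ⟨hw1, hψ1, fun x ρ hρ => ?_⟩, ?_⟩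
  · have h1 := conjL1_le C x ρ hρ
    rw [hρ.eInt_eq] at h1 ⊢
    exact EReal.sub_le_of_le_add' h1
  · rw [ew, hψ1.eInt_eq, ← EReal.coe_sub, coe_ennreal_eq_coe_toReal hfin, EReal.coe_le_coe_iff]
    rw [integral_sub ha hwi] at hmain
    linarith

/-- **Dual attainment with convex potentials** (Theorem 7): under conditions (B) and (C),
the dual problem restricted to convex potentials has the same value as the primal weak
transport problem and is attained by a `ν`-integrable convex function
`ψ : ℝ^d → (-∞,∞]`. -/
theorem dual_attainment_convex
    {X : Type*} [TopologicalSpace X] [PolishSpace X] [MeasurableSpace X] [BorelSpace X]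
    {d : ℕ} {p : ℝ} (hp : 1 ≤ p)
    (μ : Measure X) (hμ : IsProbabilityMeasure μ)
    (ν : Measure (Rd d)) (hν : IsProbabilityMeasure ν) (hνp : HasMomentP p ν)
    (C : X → Measure (Rd d) → ℝ≥0∞)
    (hlsc : LowerSemicontinuous fun q : X × Pp p d => C q.1 q.2.1)
    (hconv : ∀ x : X, ∀ ρ₁ ρ₂ : Pp p d, ∀ t : ℝ≥0∞, t ≤ 1 →
      C x (t • ρ₁.1 + (1 - t) • ρ₂.1) ≤ t * C x ρ₁.1 + (1 - t) * C x ρ₂.1)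
    (hmono : ∀ x : X, ∀ ρ₁ ρ₂ : Pp p d, ConvexOrder ρ₁.1 ρ₂.1 → C x ρ₂.1 ≤ C x ρ₁.1)
    (hB : CondB p μ ν C) (hC : CondC p C) :
    (((primal μ ν C : ℝ≥0∞)) : EReal)
        = (⨆ ψ : {ψ : Rd d → EReal // EConvex ψ ∧ InPhi p μ ν C (conjL1 p C ψ) ψ},
            eInt μ (conjL1 p C ψ.1) - eInt ν ψ.1)
      ∧ ∃ ψ : Rd d → EReal, EConvex ψ ∧ InPhi p μ ν C (conjL1 p C ψ) ψ ∧
          eInt μ (conjL1 p C ψ) - eInt ν ψ = ((primal μ ν C : ℝ≥0∞) : EReal) := by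
  obtain ⟨a, b, ha, hb, hD⟩ := exists_costData hp hlsc hconv hmono hB
  obtain ⟨ψ, h1, h2, h3⟩ := hD.exists_dual_potential hC ha hνp hb
  refine ⟨le_antisymm ?_ ?_, ψ, h1, h2, (h2.eInt_sub_le_primal hνp).antisymm h3⟩
  · exact h3.trans (le_iSup (fun ψ : {ψ : Rd d → EReal //
      EConvex ψ ∧ InPhi p μ ν C (conjL1 p C ψ) ψ} => eInt μ (conjL1 p C ψ.1) - eInt ν ψ.1)
      ⟨ψ, h1, h2⟩)
  · exact iSup_le fun ψ => ψ.2.2.eInt_sub_le_primal hνp
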